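/- Let ε > 0 be real. There exist δ = δ(ε) > 0 and C = C(ε) > 0 such that the following holds. Let q be a cube-free positive integer and χ a primitive Dirichlet character mod q. Let A ⊂ [1, q] be a union of s pairwise disjoint intervals I_1, …, I_s, each of length at least q^ε, and suppose |A| · s^{−1/2} > q^{1/4 + ε}. Then |∑_{n ∈ A} χ(n)| ≤ C · |A| · q^{−δ}. -/

import Mathlib

section Polynomials

open Polynomial

/-- The exponents `j * t * m + k * (d * t + 1) + i` of the auxiliary polynomial are pairwise distinct. -/
theorem exponent_injOn {d t m : ℕ} (hcop : Nat.Coprime m d) {j k i j' k' i' : ℕ}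
    (hj : j < d) (hj' : j' < d) (hi : i + m < t) (hi' : i' + m < t)
    (h : j * t * m + k * (d * t + 1) + i = j' * t * m + k' * (d * t + 1) + i') :
    j = j' ∧ k = k' ∧ i = i' := by
  have hd : 0 < d := by omega
  have hc : IsCoprime (d : ℤ) m := Nat.isCoprime_iff_coprime.mpr hcop.symm
  zify at *
  have key : ((d : ℤ) * t + 1) * ((j * m + d * k) - (j' * m + d * k')) =
      (d * i' - j' * m) - (d * i - j * m) := by
    linear_combination (d : ℤ) * h
  have hb : |((d : ℤ) * i' - j' * m) - (d * i - j * m)| < d * t + 1 := by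
    rw [abs_lt]
    constructor <;> nlinarith [mul_nonneg (Int.natCast_nonneg j) (Int.natCast_nonneg m),
      mul_nonneg (Int.natCast_nonneg j') (Int.natCast_nonneg m), mul_nonneg (Int.natCast_nonneg d) (Int.natCast_nonneg i),
      mul_nonneg (Int.natCast_nonneg d) (Int.natCast_nonneg i')]
  have h0 := Int.eq_zero_of_abs_lt_dvd (Dvd.intro _ key) hb
  have h1 : (j * m + d * k : ℤ) - (j' * m + d * k') = 0 := by
    rw [h0] at key
    rcases mul_eq_zero.mp key with h | h
    · nlinarith [mul_nonneg (Int.natCast_nonneg d) (Int.natCast_nonneg t)]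
    · exact h
  have h2 : (d : ℤ) ∣ (j - j') * m := ⟨k' - k, by linear_combination h1⟩
  have h3 : (d : ℤ) ∣ (j - j') :=
    IsCoprime.dvd_of_dvd_mul_right hc h2
  have h4 : (j : ℤ) - j' = 0 := Int.eq_zero_of_abs_lt_dvd h3 (by rw [abs_lt]; omega)
  have h5 : (j : ℤ) = j' := by omega
  rw [h5] at h1
  have h6 : (d : ℤ) * (k - k') = 0 := by linear_combination h1
  have h7 : (k : ℤ) = k' := by
    rcases mul_eq_zero.mp h6 with h | h <;> omega
  refine ⟨h5, h7, ?_⟩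
  rw [h5, h7] at h
  linarith

theorem card_eval_pow_eq_one_le {E : Type*} [Field E] [Fintype E] [DecidableEq E] {p a d t m : ℕ}
    [Fact p.Prime] [CharP E p] (hq : p ^ a = d * t + 1)
    (hQ : Fintype.card E = (d * t + 1) ^ 2) (hd : 2 ≤ d) (f : E[X]) (hf : f.natDegree = m)
    (hcop : Nat.Coprime m d) (ht : d * m ^ 2 ≤ t) :
    d * (Finset.univ.filter fun x : E => (f.eval x) ^ (t * (d * t + 2)) = 1).card ≤
      (d * t + 1) ^ 2 + 2 * d * m * (d * t + 1) := by
  have hm : 1 ≤ m := by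
    rcases Nat.eq_zero_or_pos m with h | h
    · subst h; simp at hcop; omega
    · exact h
  have hmt : m < t := by nlinarith
  have hf0 : f ≠ 0 := by rintro rfl; simp at hf; omega
  obtain ⟨B, hB⟩ : ∃ B, t = m + (B + 1) := ⟨t - m - 1, by omega⟩
  set q := d * t + 1 with hqdef
  let ι := Fin d × Fin (t + m) × Fin (B + 1)
  let Ht : ι → E[X] := fun z => f ^ ((d - 1 - z.1) * t) * X ^ (q * z.2.2 + z.2.1)
  let D := (d - 1) * t * m + q * B + (t + m)
  have hHt : ∀ z : ι, Ht z ∈ degreeLT E D := by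
    intro z
    rw [mem_degreeLT]
    refine lt_of_le_of_lt degree_le_natDegree ?_
    rw [Nat.cast_lt]
    have h1 : (Ht z).natDegree ≤ (d - 1 - z.1) * t * m + (q * z.2.2 + z.2.1) := by
      refine natDegree_mul_le.trans ?_
      rw [natDegree_pow, hf, natDegree_X_pow]
    refine lt_of_le_of_lt h1 ?_
    have h2 : (d - 1 - z.1) * t * m ≤ (d - 1) * t * m := 
      Nat.mul_le_mul_right _ (Nat.mul_le_mul_right _ (Nat.sub_le _ _))
    have h3 : q * (z.2.2 : ℕ) ≤ q * B := by gcongr; omega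
    have h4 := z.2.1.2
    simp only [D]
    omega
  let Hm : (ι → E) →ₗ[E] degreeLT E D := Fintype.linearCombination E (fun z => (⟨Ht z, hHt z⟩ : degreeLT E D))
  have hker : LinearMap.ker Hm ≠ ⊥ := by
    apply LinearMap.ker_ne_bot_of_finrank_lt
    rw [(degreeLTEquiv E D).finrank_eq]
    simp only [Module.finrank_fintype_fun_eq_card, Fintype.card_fin, ι, Fintype.card_prod, D]
    obtain ⟨e, rfl⟩ : ∃ e, d = e + 2 := ⟨d - 2, by omega⟩
    simp only [hqdef]
    rw [hB] at ht ⊢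
    have : (e + 2 - 1) = e + 1 := by omega
    rw [this]
    nlinarith [Nat.zero_le (e * B), Nat.zero_le (e*m), mul_le_mul hm ht (Nat.zero_le _) (by omega)]
  obtain ⟨c, hcker, hc0⟩ := (Submodule.ne_bot_iff _).mp hker
  have hH0 : ∑ z, C (c z) * Ht z = 0 := by
    have := congrArg (Subtype.val) (LinearMap.mem_ker.mp hcker)
    simpa [Hm, Fintype.linearCombination_apply, smul_eq_C_mul] using this
  let Gt : ι → E[X] := fun z => C (c z ^ q) * (f ^ (z.1 * t) * X ^ (z.2.1 * q + z.2.2))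
  have hGt : ∀ z, c z ≠ 0 → (Gt z).natDegree = z.1 * t * m + z.2.1 * q + z.2.2 := by
    intro z hz
    simp only [Gt]
    rw [natDegree_C_mul (pow_ne_zero _ hz), natDegree_mul (pow_ne_zero _ hf0) (pow_ne_zero _ X_ne_zero),
      natDegree_pow, natDegree_X_pow, hf]
    ring
  have hGt0 : ∀ z, Gt z ≠ 0 ↔ c z ≠ 0 := by
    intro z
    simp [Gt, hf0, X_ne_zero, hqdef]
  have hG0 : ∑ z, Gt z ≠ 0 := by
    intro h0
    have h1 := degree_sum_eq_of_disjoint Gt Finset.univ (by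
      intro z hz z' hz' hne hdeg
      simp only [Set.mem_ofPred_eq, Finset.mem_univ, true_and, hGt0] at hz hz'
      apply hne
      have h2 := natDegree_eq_of_degree_eq hdeg
      rw [hGt z hz, hGt z' hz'] at h2
      have h3 := exponent_injOn hcop z.1.2 z'.1.2 (by have := z.2.2.2; omega) (by have := z'.2.2.2; omega) h2
      ext
      · exact h3.1
      · exact h3.2.1
      · exact h3.2.2)
    rw [h0, degree_zero] at h1
    apply hc0
    ext z
    by_contra hz
    have h2 := Finset.le_sup (f := fun i => (Gt i).degree) (Finset.mem_univ z)
    rw [← h1] at h2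
    exact (hGt0 z).mpr hz (degree_eq_bot.mp (le_bot_iff.mp h2))
  have hGdeg : (∑ z, Gt z).natDegree ≤ (d - 1) * t * m + (t + m - 1) * q + B := by
    apply natDegree_sum_le_of_forall_le
    intro z _
    by_cases hz : c z = 0
    · have : Gt z = 0 := by by_contra h; exact (hGt0 z).mp h hz
      simp [this]
    · rw [hGt z hz]
      have h1 := z.1.2
      have h2 := z.2.1.2
      have h3 := z.2.2.2
      gcongr <;> omega
  have hcard : ∀ x : E, x ^ (q * q) = x := by
    intro x
    have := FiniteField.pow_card x
    rwa [hQ, pow_two] at this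
  have aux : ∀ (u : E) (n j : ℕ), u * u ^ q = 1 → u ^ (n + j) * (u ^ j) ^ q = u ^ n := by
    intro u n j h
    rw [← pow_mul, mul_comm j q, pow_mul, pow_add, mul_assoc, ← mul_pow, h, one_pow, mul_one]
  have hroot : (Finset.univ.filter fun x : E => (f.eval x) ^ (t * (d * t + 2)) = 1).val ⊆
      (∑ z, Gt z).roots := by
    intro x hx
    simp only [Finset.mem_val, Finset.mem_filter, Finset.mem_univ, true_and] at hx
    rw [mem_roots hG0, IsRoot.def]
    set u := (f.eval x) ^ t with hu
    have huq : u * u ^ q = 1 := by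
      rw [← hx, hu, ← pow_succ', ← pow_mul]
    have hu0 : u ≠ 0 := by rintro h; rw [h] at huq; simp at huq
    have h1 : u ^ (d - 1) * (eval x (∑ z, Gt z)) ^ q = eval x (∑ z, C (c z) * Ht z) := by
      rw [eval_finsetSum, eval_finsetSum, ← hq, sum_pow_char_pow, hq, Finset.mul_sum]
      refine Finset.sum_congr rfl fun z _ => ?_
      simp only [Gt, Ht, eval_mul, eval_C, eval_pow, eval_X, mul_pow]
      have e1 : (c z ^ q) ^ q = c z := by rw [← pow_mul, hcard]
      have e2 : (x ^ ((z.2.1 : ℕ) * q + z.2.2)) ^ q = x ^ (q * (z.2.2 : ℕ) + z.2.1) := by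
        have : ((z.2.1 : ℕ) * q + z.2.2) * q = (q * q) * z.2.1 + q * z.2.2 := by ring
        rw [← pow_mul, this, pow_add, pow_mul, hcard, pow_add, mul_comm]
      have e3 : u ^ (d - 1) * ((eval x f) ^ ((z.1 : ℕ) * t)) ^ q = (eval x f) ^ ((d - 1 - z.1) * t) := by
        have a1 : (eval x f) ^ ((z.1 : ℕ) * t) = u ^ (z.1 : ℕ) := by rw [hu, ← pow_mul, mul_comm]
        have a2 : (eval x f) ^ ((d - 1 - z.1) * t) = u ^ (d - 1 - z.1) := by rw [hu, ← pow_mul, mul_comm]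
        have a3 : d - 1 = (d - 1 - z.1) + z.1 := by have := z.1.2; omega
        rw [a1, a2, ← aux u (d - 1 - z.1) z.1 huq, ← a3]
      rw [e1, e2]
      linear_combination (c z * x ^ (q * (z.2.2 : ℕ) + z.2.1)) * e3
    rw [hH0, eval_zero] at h1
    rcases mul_eq_zero.mp h1 with h | h
    · exact absurd (eq_zero_of_pow_eq_zero h) hu0
    · exact eq_zero_of_pow_eq_zero h
  have hcardle := Polynomial.card_le_degree_of_subset_roots hroot
  have h1 := hcardle.trans hGdeg
  obtain ⟨e, rfl⟩ : ∃ e, d = e + 2 := ⟨d - 2, by omega⟩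
  obtain ⟨n, rfl⟩ : ∃ n, m = n + 1 := ⟨m - 1, by omega⟩
  have h2 : t + (n + 1) - 1 = t + n := by omega
  have h3 : e + 2 - 1 = e + 1 := by omega
  rw [h2, h3] at h1
  refine (Nat.mul_le_mul_left _ h1).trans ?_
  have hB' : B ≤ t := by omega
  have h4 : (e + 2) * ((e + 1) * t * (n + 1) + (t + n) * q + B) ≤ (e + 2) * ((e + 1) * t * (n + 1) + (t + n) * q + t) := by gcongr
  refine h4.trans ?_
  rw [hqdef]
  nlinarith [Nat.zero_le (e * n * t), Nat.zero_le (e*n), Nat.zero_le (e * t), Nat.zero_le (n * t)]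

theorem exists_pow_eq_of_pow_eq_one {E : Type*} [Field E] [Fintype E] {d e : ℕ}
    (he : d * e = Fintype.card E - 1) {v : E} (hv : v ^ e = 1) : ∃ z, v = z ^ d := by
  classical
  have he0 : 0 < d * e := by rw [he]; have := Fintype.one_lt_card (α := E); omega
  have hv0 : v ≠ 0 := by
    rintro rfl
    rw [zero_pow (by rintro rfl; simp at he0)] at hv
    exact zero_ne_one hv
  obtain ⟨g, hg⟩ := IsCyclic.exists_generator (α := Eˣ)
  obtain ⟨i, hi⟩ := Submonoid.mem_powers_iff _ _ |>.mp
    ((mem_powers_iff_mem_zpowers).mpr (hg (Units.mk0 v hv0)))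
  have h1 : g ^ (i * e) = 1 := by
    rw [pow_mul, hi]; ext; simpa using hv
  have h2 : orderOf g ∣ i * e := orderOf_dvd_of_pow_eq_one h1
  rw [orderOf_eq_card_of_forall_mem_zpowers hg, Nat.card_eq_fintype_card, Fintype.card_units, ← he] at h2
  obtain ⟨j, hj⟩ : d ∣ i := Nat.dvd_of_mul_dvd_mul_right (by
    rcases Nat.eq_zero_or_pos e with h | h
    · subst h; simp at he0
    · exact h) h2
  refine ⟨(g ^ j : Eˣ), ?_⟩
  have := congrArg (Units.val) hi
  simp only [Units.val_mk0] at this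
  rw [← this, hj, mul_comm, pow_mul]
  simp

theorem card_le_mul_card_pow_eq_one {E : Type*} [Field E] [Fintype E] [DecidableEq E] {d e : ℕ}
    (hd : 0 < d) (he : d * e = Fintype.card E - 1) :
    Fintype.card E - 1 ≤ d * (Finset.univ.filter fun v : E => v ^ e = 1).card := by
  have h1 : (Finset.univ.filter fun v : E => v ≠ 0).card = Fintype.card E - 1 := by
    rw [Finset.filter_ne', Finset.card_erase_of_mem (Finset.mem_univ _), Finset.card_univ]
  rw [← h1]
  have h2 := Finset.card_le_mul_card_image (f := fun u : E => u ^ d)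
    (Finset.univ.filter fun v : E => v ≠ 0) d (by
      intro c _
      refine le_trans (Finset.card_le_card (t := (nthRoots d c).toFinset) ?_)
        ((Multiset.toFinset_card_le _).trans (card_nthRoots d c))
      intro u hu
      simp only [Finset.mem_filter] at hu
      simp [mem_nthRoots hd, hu.2])
  refine h2.trans (Nat.mul_le_mul_left _ (Finset.card_le_card ?_))
  intro c hc
  simp only [Finset.mem_image, Finset.mem_filter, Finset.mem_univ, true_and] at hc ⊢
  obtain ⟨u, hu, rfl⟩ := hc
  rw [← pow_mul, he]
  exact FiniteField.pow_card_sub_one_eq_one u hu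

theorem norm_sum_mulChar_comp_le {E : Type*} [Field E] [Fintype E] [DecidableEq E] {p a d t m : ℕ}
    [Fact p.Prime] [CharP E p] (hq : p ^ a = d * t + 1)
    (hQ : Fintype.card E = (d * t + 1) ^ 2) (hd : 2 ≤ d) (f : E[X]) (hf : f.natDegree = m)
    (hcop : Nat.Coprime m d) (ht : d * m ^ 2 ≤ t) (ψ : MulChar E ℂ) (hψ : ψ ≠ 1) (hψd : ψ ^ d = 1) :
    ‖∑ x, ψ (f.eval x)‖ ≤ (2 * d * m * (d * t + 1) + m : ℕ) := by
  have hf0 : f ≠ 0 := by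
    rintro rfl
    simp only [natDegree_zero] at hf
    subst hf
    simp at hcop; omega
  set e := t * (d * t + 2) with hedef
  have he : d * e = Fintype.card E - 1 := by
    rw [hQ, hedef]
    have : (d * t + 1) ^ 2 = d * (t * (d * t + 2)) + 1 := by ring
    omega
  have he0 : e ≠ 0 := by
    rintro h
    rw [h] at he
    have := Fintype.one_lt_card (α := E); omega
  set K := Finset.univ.filter fun v : E => v ^ e = 1 with hK
  have hKψ : ∀ v ∈ K, ψ⁻¹ v = 1 := by
    intro v hv
    simp only [hK, Finset.mem_filter, Finset.mem_univ, true_and] at hv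
    obtain ⟨z, rfl⟩ := exists_pow_eq_of_pow_eq_one he hv
    have hz : z ≠ 0 := by
      rintro rfl
      rw [zero_pow (by omega), zero_pow he0] at hv
      exact zero_ne_one hv
    have h1 : (ψ⁻¹) ^ d = 1 := by rw [inv_pow, hψd, inv_one]
    rw [map_pow, ← MulChar.pow_apply' _ (by omega), h1]
    exact MulChar.one_apply (isUnit_iff_ne_zero.mpr hz)
  let N : E → ℕ := fun u => (Finset.univ.filter fun x : E => (u * f.eval x) ^ e = 1).card
  have hN : ∀ u, u ≠ 0 → d * N u ≤ (d * t + 1) ^ 2 + 2 * d * m * (d * t + 1) := by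
    intro u hu
    have h1 := card_eval_pow_eq_one_le hq hQ hd (C u * f) (by rw [natDegree_C_mul hu, hf]) hcop ht
    simpa [N] using h1
  have hN0 : N 0 = 0 := by simp [N, he0]
  have hswap : ∀ (g : E → ℂ), (∀ v ∈ K, g v = 1) → (∀ x y, g (x * y) = g x * g y) →
      ∑ u, g u * (N u : ℂ) = K.card * ∑ x, if f.eval x = 0 then 0 else g (f.eval x)⁻¹ := by
    intro g hg hmul
    have h1 : ∀ u, g u * (N u : ℂ) = ∑ x, if (u * f.eval x) ^ e = 1 then g u else 0 := by
      intro u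
      rw [← Finset.sum_filter, Finset.sum_const, nsmul_eq_mul, mul_comm]
    simp_rw [h1]
    rw [Finset.sum_comm, Finset.mul_sum]
    refine Finset.sum_congr rfl fun x _ => ?_
    split_ifs with hx
    · simp [hx, he0]
    · rw [← Equiv.sum_comp (Equiv.mulRight₀ (f.eval x)⁻¹ (inv_ne_zero hx))]
      simp only [Equiv.mulRight₀_apply]
      have : ∀ v : E, v * (eval x f)⁻¹ * eval x f = v := fun v => by field_simp
      simp_rw [this]
      rw [← Finset.sum_filter, ← nsmul_eq_mul, ← Finset.sum_const]
      refine Finset.sum_congr rfl fun v hv => ?_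
      rw [hmul, hg v hv, one_mul]
  have hS := hswap (fun x => ψ⁻¹ x) hKψ (fun x y => map_mul _ x y)
  have hS' : ∑ u, ψ⁻¹ u * (N u : ℂ) = K.card * ∑ x, ψ (f.eval x) := by
    rw [hS]; congr 1
    refine Finset.sum_congr rfl fun x _ => ?_
    split_ifs with hx
    · rw [hx, MulChar.map_zero]
    · rw [MulChar.inv_apply', inv_inv]
  have hC := hswap (fun x => if x = 0 then 0 else 1) (by
    intro v hv
    simp only [hK, Finset.mem_filter, Finset.mem_univ, true_and] at hv
    rw [if_neg]; rintro rfl; rw [zero_pow he0] at hv; exact zero_ne_one hv) (by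
    intro x y; by_cases hx : x = 0 <;> by_cases hy : y = 0 <;> simp [hx, hy])
  have hCR : ∑ u ∈ Finset.univ.erase (0 : E), (N u : ℝ) = K.card * (Finset.univ.filter fun x => f.eval x ≠ 0).card := by
    have h1 : ∑ u, (if u = 0 then (0 : ℂ) else 1) * (N u : ℂ) = ∑ u ∈ Finset.univ.erase (0 : E), (N u : ℂ) := by
      rw [← Finset.filter_ne', Finset.sum_filter]
      refine Finset.sum_congr rfl fun u _ => ?_
      by_cases hu : u = 0 <;> simp [hu]
    have h2 : ∑ x, (if f.eval x = 0 then (0 : ℂ) else (if (f.eval x)⁻¹ = 0 then (0:ℂ) else 1)) =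
        (Finset.univ.filter fun x => f.eval x ≠ 0).card := by
      rw [Finset.card_eq_sum_ones, Finset.sum_filter]
      push_cast
      refine Finset.sum_congr rfl fun u _ => ?_
      by_cases hu : f.eval u = 0 <;> simp [hu]
    rw [h1, h2] at hC
    exact_mod_cast hC
  have hzeros : (Finset.univ.filter fun x => f.eval x = 0).card ≤ m := by
    rw [← hf]
    apply card_le_degree_of_subset_roots
    intro x hx
    simp only [Finset.mem_val, Finset.mem_filter, Finset.mem_univ, true_and] at hx
    rw [mem_roots hf0]; exact hx
  have hsplit : (Finset.univ.filter fun x => f.eval x = 0).card + (Finset.univ.filter fun x => f.eval x ≠ 0).card = (d * t + 1) ^ 2 := by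
    rw [Finset.card_filter_add_card_filter_not, Finset.card_univ, hQ]
  have hKcard := card_le_mul_card_pow_eq_one (E := E) (d := d) (e := e) (by omega) he
  have hKpos : (0 : ℝ) < K.card := by
    have h1 : (1 : E) ∈ K := by simp [hK]
    exact_mod_cast Finset.card_pos.mpr ⟨1, h1⟩
  have hd0 : (0 : ℝ) < d := by exact_mod_cast (by omega : 0 < d)
  set T : ℝ := ((d * t + 1 : ℕ) ^ 2 + 2 * d * m * (d * t + 1 : ℕ)) / d with hT
  have hNT : ∀ u, u ≠ 0 → (N u : ℝ) ≤ T := by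
    intro u hu
    rw [hT, le_div_iff₀ hd0]
    have := hN u hu
    rw [mul_comm]
    exact_mod_cast this
  have hψsum : ∑ u, ψ⁻¹ u = 0 := MulChar.sum_eq_zero_of_ne_one (inv_ne_one.mpr hψ)
  have hψsum' : ∑ u, ψ⁻¹ u * (N u : ℂ) = ∑ u ∈ Finset.univ.erase (0 : E), ψ⁻¹ u * ((N u : ℂ) - (T : ℂ)) := by
    have h1 : ∑ u, ψ⁻¹ u * (N u : ℂ) = ∑ u, ψ⁻¹ u * ((N u : ℂ) - T) := by
      simp_rw [mul_sub]
      rw [Finset.sum_sub_distrib, ← Finset.sum_mul, hψsum]; simp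
    rw [h1, ← Finset.add_sum_erase _ _ (Finset.mem_univ (0 : E)), MulChar.map_zero, zero_mul, zero_add]
  have hψnorm : ∀ u, ‖ψ⁻¹ u‖ ≤ 1 := fun u => by
    by_cases hu : u = 0
    · simp [hu, MulChar.map_zero]
    · have h1 : (ψ⁻¹ u) ^ d = 1 := by
        rw [← MulChar.pow_apply' _ (by omega), inv_pow, hψd, inv_one]
        exact MulChar.one_apply (isUnit_iff_ne_zero.mpr hu)
      exact (Complex.norm_eq_one_of_pow_eq_one h1 (by omega)).le
  have hmain : K.card * ‖∑ x, ψ (f.eval x)‖ ≤ (Fintype.card E - 1 : ℕ) * T - K.card * (Finset.univ.filter fun x => f.eval x ≠ 0).card := by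
    have h1 : (K.card : ℝ) * ‖∑ x, ψ (f.eval x)‖ = ‖∑ u, ψ⁻¹ u * (N u : ℂ)‖ := by
      rw [hS', norm_mul]; simp
    rw [h1, hψsum', ← hCR]
    refine (norm_sum_le _ _).trans ?_
    have h2 : ∀ u ∈ Finset.univ.erase (0 : E), ‖ψ⁻¹ u * ((N u : ℂ) - (T : ℂ))‖ ≤ T - N u := by
      intro u hu
      rw [norm_mul]
      have h3 := hNT u (Finset.ne_of_mem_erase hu)
      have h4 : ‖(N u : ℂ) - (T : ℂ)‖ = T - N u := by
        rw [show (N u : ℂ) - (T : ℂ) = ((N u - T : ℝ) : ℂ) by push_cast; ring, Complex.norm_real, Real.norm_eq_abs,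
          abs_sub_comm, abs_of_nonneg (by linarith)]
      rw [h4]
      exact mul_le_of_le_one_left (by linarith) (hψnorm u)
    refine (Finset.sum_le_sum h2).trans ?_
    rw [Finset.sum_sub_distrib, Finset.sum_const, Finset.card_erase_of_mem (Finset.mem_univ _), Finset.card_univ, nsmul_eq_mul]
  have hT0 : 0 ≤ T := by positivity
  have h5 : ((Fintype.card E - 1 : ℕ) : ℝ) * T ≤ K.card * (d * T) := by
    have : ((Fintype.card E - 1 : ℕ) : ℝ) ≤ d * K.card := by exact_mod_cast hKcard
    nlinarith
  have h6 : (d : ℝ) * T = (d * t + 1 : ℕ) ^ 2 + 2 * d * m * (d * t + 1 : ℕ) := by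
    rw [hT]; field_simp
  have h7 : K.card * ‖∑ x, ψ (f.eval x)‖ ≤ K.card * (d * T - (Finset.univ.filter fun x => f.eval x ≠ 0).card) := by
    rw [mul_sub]; linarith
  have h8 := le_of_mul_le_mul_left h7 hKpos
  refine h8.trans ?_
  rw [h6]
  have h9 : ((Finset.univ.filter fun x => f.eval x = 0).card : ℝ) + (Finset.univ.filter fun x => f.eval x ≠ 0).card = (d * t + 1 : ℕ) ^ 2 := by
    exact_mod_cast hsplit
  have h10 : ((Finset.univ.filter fun x => f.eval x = 0).card : ℝ) ≤ m := by exact_mod_cast hzeros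
  push_cast at *
  linarith

theorem norm_algebraMap_sub_eq_eval_minpoly_pow {F L : Type*} [Field F] [Field L] [Algebra F L]
    [FiniteDimensional F L] (x : L) (a : F) :
    Algebra.norm F (algebraMap F L a - x) =
      (minpoly F x).eval a ^ (Module.finrank F L / (minpoly F x).natDegree) := by
  have hx : IsIntegral F x := IsIntegral.of_finite F x
  set K := IntermediateField.adjoin F {x}
  let pb := IntermediateField.adjoin.powerBasis hx
  have hgen : algebraMap K L pb.gen = x := rfl
  have h1 : Algebra.norm F (algebraMap F K a - pb.gen) = (minpoly F x).eval a := by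
    rw [Algebra.norm_eq_matrix_det pb.basis, map_sub]
    have h2 := charpoly_leftMulMatrix pb
    have h3 : minpoly F pb.gen = minpoly F x := by
      exact (minpoly.algebraMap_eq (algebraMap K L).injective pb.gen).symm
    rw [← h3, ← h2, Matrix.eval_charpoly]
    congr 1
    rw [AlgHom.commutes]
    simp [Matrix.algebraMap_eq_diagonal, Matrix.scalar_apply]
  have h4 : algebraMap F L a - x = algebraMap K L (algebraMap F K a - pb.gen) := by
    rw [map_sub, hgen, ← IsScalarTower.algebraMap_apply]
  rw [h4, ← Algebra.norm_norm (S := K), Algebra.norm_algebraMap, map_pow, h1]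
  congr 1
  rw [← Module.finrank_mul_finrank F K L, IntermediateField.adjoin.finrank hx,
    Nat.mul_div_cancel_left _ (minpoly.natDegree_pos hx)]

theorem natDegree_minpoly_dvd_finrank {F L : Type*} [Field F] [Field L] [Algebra F L]
    [FiniteDimensional F L] (x : L) : (minpoly F x).natDegree ∣ Module.finrank F L := by
  rw [← IntermediateField.adjoin.finrank (IsIntegral.of_finite F x)]
  exact ⟨_, (Module.finrank_mul_finrank F _ L).symm⟩

/-- The characteristic polynomial of `x` in the finite extension `L / F`. -/
noncomputable def minpolyPow (F : Type*) {L : Type*} [Field F] [Field L] [Algebra F L] (x : L) : F[X] :=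
  minpoly F x ^ (Module.finrank F L / (minpoly F x).natDegree)

section
variable {F L : Type*} [Field F] [Field L] [Algebra F L] [FiniteDimensional F L]

theorem minpolyPow_monic (x : L) : (minpolyPow F x).Monic :=
  (minpoly.monic (IsIntegral.of_finite F x)).pow _

theorem natDegree_minpolyPow (x : L) : (minpolyPow F x).natDegree = Module.finrank F L := by
  rw [minpolyPow, natDegree_pow, Nat.div_mul_cancel (natDegree_minpoly_dvd_finrank x)]

theorem card_minpoly_eq [Finite F] [Fintype L] [DecidableEq F] {P : F[X]} (hP : Irreducible P) (hm : P.Monic) :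
    (Finset.univ.filter fun x : L => minpoly F x = P).card =
      if P.natDegree ∣ Module.finrank F L then P.natDegree else 0 := by
  split_ifs with h
  · have h1 := (hP.natDegree_dvd_iff_dvd_X_pow_card_pow_sub_X).mp h
    have h0 : Nat.card F ^ Module.finrank F L = Nat.card L := Module.natCard_eq_pow_finrank.symm
    rw [h0, Nat.card_eq_fintype_card] at h1
    have hsp : ((X ^ Fintype.card L - X : F[X]).map (algebraMap F L)).Splits := by
      have := Fintype.ofFinite F
      exact (FiniteField.isSplittingField_sub L F).splits
    have hs : (P.map (algebraMap F L)).Splits := hsp.of_dvd (by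
      rw [Polynomial.map_ne_zero_iff (algebraMap F L).injective]
      exact FiniteField.X_pow_card_sub_X_ne_zero _ Fintype.one_lt_card) (Polynomial.map_dvd _ h1)
    have hsep : P.Separable := by
      have := PerfectField.separable_of_irreducible hP
      exact this
    have := card_rootSet_eq_natDegree hsep hs
    rw [← this, ← Set.toFinset_card]
    congr 1
    ext x
    simp only [Finset.mem_filter, Finset.mem_univ, true_and, Set.mem_toFinset, mem_rootSet, ne_eq, hP.ne_zero, not_false_eq_true]
    constructor
    · rintro rfl; exact minpoly.aeval F x
    · intro hx; exact (minpoly.eq_of_irreducible_of_monic hP hx hm).symm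
  · rw [Finset.card_eq_zero, Finset.filter_eq_empty_iff]
    rintro x _ rfl
    exact h (natDegree_minpoly_dvd_finrank x)

end

theorem sum_card_minpolyPow_dvd {F : Type*} [Field F] [Finite F] [DecidableEq F] (E : ℕ → Type*) [∀ l, Field (E l)]
    [∀ l, Algebra F (E l)] [∀ l, FiniteDimensional F (E l)] [∀ l, Fintype (E l)]
    [∀ l, DecidableEq (E l)] [∀ (l) (g : F[X]), DecidablePred fun x : E l => minpolyPow F x ∣ g]
    (hE : ∀ l, l ≠ 0 → Module.finrank F (E l) = l) (g : F[X]) (hg : g ≠ 0) :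
    ∀ n, g.natDegree ≤ n →
      ∑ l ∈ Finset.Icc 1 n, (Finset.univ.filter fun x : E l => minpolyPow F x ∣ g).card = g.natDegree := by
  have hdeg : ∀ l, l ≠ 0 → ∀ x : E l, (minpolyPow F x).natDegree = l := fun l hl x => by
    rw [natDegree_minpolyPow, hE l hl]
  have hirr : ∀ l, ∀ x : E l, Irreducible (minpoly F x) := fun l x =>
    minpoly.irreducible (IsIntegral.of_finite F x)
  revert hg
  refine UniqueFactorizationMonoid.induction_on_coprime
    (P := fun g => g ≠ 0 → ∀ n, g.natDegree ≤ n →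
      ∑ l ∈ Finset.Icc 1 n, (Finset.univ.filter fun x : E l => minpolyPow F x ∣ g).card = g.natDegree)
    g (fun h => (h rfl).elim) ?_ ?_ ?_
  · intro u hu _ n _
    rw [natDegree_eq_zero_of_isUnit hu]
    refine Finset.sum_eq_zero fun l hl => ?_
    rw [Finset.card_eq_zero, Finset.filter_eq_empty_iff]
    intro x _ hx
    have h1 := natDegree_eq_zero_of_isUnit (isUnit_of_dvd_unit hx hu)
    rw [hdeg l (by simp at hl; omega)] at h1
    simp at hl; omega
  · intro P i hP h0 n hn
    have hPi := hP.irreducible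
    have hP0 := hP.ne_zero
    have hd := hPi.natDegree_pos
    set d := P.natDegree with hd_def
    have key : ∀ l ∈ Finset.Icc 1 n, (Finset.univ.filter fun x : E l => minpolyPow F x ∣ P ^ i).card =
        if d ∣ l ∧ l ≤ i * d then d else 0 := by
      intro l hl
      simp only [Finset.mem_Icc] at hl
      have hl0 : l ≠ 0 := by omega
      have hN : Irreducible (normalize P) := (normalize_associated P).symm.irreducible hPi
      have hM : (normalize P).Monic := monic_normalize hP0
      have hND : (normalize P).natDegree = d := natDegree_eq_of_degree_eq degree_normalize
      have h1 := card_minpoly_eq (L := E l) hN hM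
      rw [hND, hE l hl0] at h1
      by_cases hli : l ≤ i * d
      · simp only [hli, and_true]
        rw [← h1]
        congr 1
        ext x
        simp only [Finset.mem_filter, Finset.mem_univ, true_and]
        have hdv := natDegree_minpoly_dvd_finrank (F := F) x
        rw [hE l hl0] at hdv
        have hpos := (hirr l x).natDegree_pos
        constructor
        · intro h
          have h2 : minpoly F x ∣ P := by
            refine (hirr l x).prime.dvd_of_dvd_pow ((dvd_pow_self _ ?_).trans h)
            rw [hE l hl0]
            exact (Nat.div_pos (Nat.le_of_dvd (by omega) hdv) hpos).ne'
          have h3 := (hirr l x).associated_of_dvd hPi h2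
          have h4 := minpoly.monic (IsIntegral.of_finite F x)
          rw [← h4.normalize_eq_self]
          exact (normalize_eq_normalize_iff_associated).mpr h3
        · intro h
          have h3 : Associated (minpoly F x) P := by rw [h]; exact normalize_associated P
          rw [minpolyPow, hE l hl0, h, hND]
          refine (pow_dvd_pow_of_dvd (normalize_dvd_iff.mpr dvd_rfl) _).trans (pow_dvd_pow _ ?_)
          exact Nat.div_le_of_le_mul (by rw [mul_comm]; exact hli)
      · simp only [hli, and_false, if_false]
        rw [Finset.card_eq_zero, Finset.filter_eq_empty_iff]
        intro x _ hx
        have := natDegree_le_of_dvd hx h0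
        rw [hdeg l hl0, natDegree_pow] at this
        exact hli this
    rw [Finset.sum_congr rfl key, natDegree_pow, ← Finset.sum_filter, Finset.sum_const, smul_eq_mul]
    congr 1
    rw [natDegree_pow] at hn
    have : (Finset.Icc 1 n).filter (fun l => d ∣ l ∧ l ≤ i * d) = (Finset.Icc 1 i).image (fun j => j * d) := by
      ext l
      simp only [Finset.mem_filter, Finset.mem_Icc, Finset.mem_image]
      constructor
      · rintro ⟨⟨h1, h2⟩, ⟨j, rfl⟩, h4⟩
        refine ⟨j, ⟨?_, ?_⟩, mul_comm _ _⟩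
        · rcases Nat.eq_zero_or_pos j with h | h
          · subst h; simp at h1
          · exact h
        · rw [mul_comm] at h4; exact Nat.le_of_mul_le_mul_right h4 hd
      · rintro ⟨j, ⟨h1, h2⟩, rfl⟩
        have h3 : j * d ≤ i * d := Nat.mul_le_mul_right _ h2
        exact ⟨⟨Nat.mul_pos h1 hd, h3.trans hn⟩, Dvd.intro_left _ rfl, h3⟩
    rw [this, Finset.card_image_of_injective _ (fun a b h => Nat.eq_of_mul_eq_mul_right hd h)]
    simp
  · intro x y hxy ihx ihy h0 n hn
    have hx0 : x ≠ 0 := left_ne_zero_of_mul h0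
    have hy0 : y ≠ 0 := right_ne_zero_of_mul h0
    rw [natDegree_mul hx0 hy0] at hn ⊢
    rw [← ihx hx0 n (by omega), ← ihy hy0 n (by omega), ← Finset.sum_add_distrib]
    refine Finset.sum_congr rfl fun l hl => ?_
    simp only [Finset.mem_Icc] at hl
    rw [← Finset.card_union_of_disjoint]
    · congr 1
      ext z
      simp only [Finset.mem_filter, Finset.mem_univ, true_and, Finset.mem_union]
      constructor
      · intro h
        by_cases hz : minpoly F z ∣ x
        · left
          have h1 : IsCoprime (minpoly F z) y := by
            refine ((hirr l z).coprime_iff_not_dvd).mpr fun h2 => (hirr l z).not_isUnit (hxy hz h2)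
          exact IsCoprime.dvd_of_dvd_mul_right (IsCoprime.pow_left h1) h
        · right
          exact IsCoprime.dvd_of_dvd_mul_left (IsCoprime.pow_left (((hirr l z).coprime_iff_not_dvd).mpr hz)) h
      · rintro (h | h)
        · exact h.mul_right _
        · exact h.mul_left _
    · rw [Finset.disjoint_left]
      intro z hz1 hz2
      simp only [Finset.mem_filter, Finset.mem_univ, true_and] at hz1 hz2
      have := natDegree_eq_zero_of_isUnit (hxy hz1 hz2)
      rw [hdeg l (by omega)] at this
      omega

theorem newton_recursion_multiset (W : Multiset ℂ) (n : ℕ) :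
    (n : ℂ) * ((W.map fun ω => (1 - C ω * X : ℂ[X])).prod).coeff n =
      ∑ l ∈ Finset.Icc 1 n, (-(W.map fun ω => ω ^ l).sum) *
        ((W.map fun ω => (1 - C ω * X : ℂ[X])).prod).coeff (n - l) := by
  induction W using Multiset.induction generalizing n with
  | empty =>
    simp [coeff_one]
  | cons a W ih =>
    set Q := (W.map fun ω => (1 - C ω * X : ℂ[X])).prod with hQ
    rw [Multiset.map_cons, Multiset.prod_cons]
    set R := (1 - C a * X) * Q with hR
    have hc0 : R.coeff 0 = Q.coeff 0 := by simp [hR, sub_mul, mul_assoc]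
    have hcs : ∀ k, R.coeff (k + 1) = Q.coeff (k + 1) - a * Q.coeff k := by
      intro k
      rw [hR, sub_mul, one_mul, mul_assoc, coeff_sub, coeff_C_mul, coeff_X_mul]
    simp only [Multiset.map_cons, Multiset.sum_cons, neg_add, add_mul, Finset.sum_add_distrib]
    have h1 : ∀ n, ∑ l ∈ Finset.Icc 1 n, a ^ l * R.coeff (n - l) = if n = 0 then 0 else a * Q.coeff (n - 1) := by
      intro n
      induction n with
      | zero => simp
      | succ m ihm =>
        rw [← Finset.insert_Icc_add_one_left_eq_Icc (by omega : 1 ≤ m + 1), Finset.sum_insert (by simp)]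
        have : ∑ l ∈ Finset.Icc (1 + 1) (m + 1), a ^ l * R.coeff (m + 1 - l) =
            a * ∑ l ∈ Finset.Icc 1 m, a ^ l * R.coeff (m - l) := by
          rw [Finset.mul_sum, ← Finset.map_add_right_Icc 1 m 1, Finset.sum_map]
          refine Finset.sum_congr rfl fun l _ => ?_
          simp only [addRightEmbedding_apply, Nat.add_sub_add_right]
          ring
        rw [this, ihm]
        rcases m with _ | m
        · simp [hc0]
        · simp [hcs]
          ring
    have h2 : ∀ n, ∑ l ∈ Finset.Icc 1 n, (-(W.map fun ω => ω ^ l).sum) * R.coeff (n - l) =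
        (n : ℂ) * Q.coeff n - (if n = 0 then 0 else a * (((n - 1 : ℕ) : ℂ) * Q.coeff (n - 1))) := by
      intro n
      rcases n with _ | m
      · simp
      · rw [ih (m + 1), Nat.add_sub_cancel, ih m]
        simp only [Nat.add_eq_zero_iff, one_ne_zero, and_false, if_false]
        rw [Finset.sum_Icc_succ_top (by omega), Finset.sum_Icc_succ_top (by omega), Finset.mul_sum,
          add_sub_right_comm, ← Finset.sum_sub_distrib]
        simp only [Nat.sub_self, hc0]
        congr 1
        refine Finset.sum_congr rfl fun l hl => ?_
        simp only [Finset.mem_Icc] at hl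
        obtain ⟨k, rfl⟩ := Nat.exists_eq_add_of_le hl.2
        rw [show l + k + 1 - l = k + 1 by omega, hcs, show l + k - l = k by omega]
        ring
    rw [h2]
    have h3 : ∑ l ∈ Finset.Icc 1 n, -a ^ l * R.coeff (n - l) = - if n = 0 then 0 else a * Q.coeff (n - 1) := by
      rw [← h1, ← Finset.sum_neg_distrib]
      refine Finset.sum_congr rfl fun l _ => by ring
    rw [h3]
    rcases n with _ | m
    · simp
    · simp [hcs]; ring

theorem exists_multiset_power_sums {c S : ℕ → ℂ} {D : ℕ} (h0 : c 0 = 1) (hD : ∀ n, D < n → c n = 0)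
    (hrec : ∀ n : ℕ, (n : ℂ) * c n = ∑ l ∈ Finset.Icc 1 n, S l * c (n - l)) :
    ∃ W : Multiset ℂ, W.card ≤ D ∧ ∀ l, 1 ≤ l → S l = -(W.map fun ω => ω ^ l).sum := by
  let P : ℂ[X] := ∑ i ∈ Finset.range (D + 1), C (c i) * X ^ i
  have hPc : ∀ n, P.coeff n = c n := by
    intro n
    simp only [P, finsetSum_coeff, coeff_C_mul, coeff_X_pow]
    simp
    intro h; exact (hD n (by omega)).symm
  have hP0 : P ≠ 0 := by
    intro h
    have := hPc 0
    rw [h, h0] at this; simp at this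
  have hroots : ∀ r ∈ P.roots, r ≠ 0 := by
    rintro r hr rfl
    have := (mem_roots hP0).mp hr
    rw [IsRoot.def, ← coeff_zero_eq_eval_zero, hPc, h0] at this
    exact one_ne_zero this
  have hsplit := (IsAlgClosed.splits P).eq_prod_roots
  have hfac : ∀ R : Multiset ℂ, (∀ r ∈ R, r ≠ 0) → ∃ k : ℂ, (R.map fun r => (X - C r : ℂ[X])).prod =
      C k * ((R.map fun r => r⁻¹).map fun ω => (1 - C ω * X : ℂ[X])).prod := by
    intro R
    induction R using Multiset.induction with
    | empty => intro _; exact ⟨1, by simp⟩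
    | cons a R ih =>
      intro h
      obtain ⟨k, hk⟩ := ih (fun r hr => h r (Multiset.mem_cons_of_mem hr))
      have ha := h a (Multiset.mem_cons_self _ _)
      refine ⟨-a * k, ?_⟩
      simp only [Multiset.map_cons, Multiset.prod_cons]
      rw [hk]
      have : (X - C a : ℂ[X]) = C (-a) * (1 - C a⁻¹ * X) := by
        rw [mul_sub, ← mul_assoc, ← C_mul]
        simp [ha]; ring
      rw [this, C_mul]; ring
  obtain ⟨k, hk⟩ := hfac P.roots hroots
  set W := P.roots.map fun r => r⁻¹ with hW
  set Q := (W.map fun ω => (1 - C ω * X : ℂ[X])).prod with hQ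
  have hQ0 : Q.coeff 0 = 1 := by
    rw [coeff_zero_eq_eval_zero, hQ, eval_multiset_prod, Multiset.map_map]
    simp
  have hPQ : P = C (P.leadingCoeff * k) * Q := by
    rw [hk, ← mul_assoc, ← C_mul] at hsplit
    exact hsplit
  have hlead : P.leadingCoeff * k = 1 := by
    have := congrArg (fun f => coeff f 0) hPQ
    simp only [hPc, h0, coeff_C_mul, hQ0, mul_one] at this
    exact this.symm
  rw [hlead, C_1, one_mul] at hPQ
  refine ⟨W, ?_, ?_⟩
  · rw [hW, Multiset.card_map]
    refine (card_roots' P).trans ?_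
    refine natDegree_le_iff_coeff_eq_zero.mpr fun n hn => ?_
    rw [hPc, hD n hn]
  · intro l
    induction l using Nat.strong_induction_on with
    | _ l ih =>
      intro hl
      have h1 := hrec l
      have h2 := newton_recursion_multiset W l
      rw [← hQ, ← hPQ] at h2
      simp only [hPc] at h2
      rw [h1] at h2
      obtain ⟨m, rfl⟩ := Nat.exists_eq_add_of_le hl
      rw [add_comm 1 m, Finset.sum_Icc_succ_top (by omega), Finset.sum_Icc_succ_top (by omega)] at h2
      rw [Finset.sum_congr rfl (fun i hi => by
        simp only [Finset.mem_Icc] at hi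
        rw [ih i (by omega) hi.1])] at h2
      have h3 := add_left_cancel h2
      simp only [Nat.sub_self, h0, mul_one] at h3
      rw [add_comm 1 m]; exact h3

theorem norm_le_of_norm_sum_pow_le {W : Multiset ℂ} {B K : ℝ} (hB : 0 < B) {n₀ : ℕ}
    (h : ∀ n, n₀ ≤ n → ‖(W.map fun z => z ^ n).sum‖ ≤ K * B ^ n) {z : ℂ} (hz : z ∈ W) : ‖z‖ ≤ B := by
  classical
  let T := W.toFinset.erase z
  let Q : ℂ[X] := ∏ w ∈ T, (X - C w)
  have hQz : Q.eval z ≠ 0 := by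
    simp only [Q, eval_prod, eval_sub, eval_X, eval_C]
    rw [Finset.prod_ne_zero_iff]
    intro w hw
    exact sub_ne_zero.mpr (Finset.ne_of_mem_erase hw).symm
  have hQw : ∀ w ∈ W, w ≠ z → Q.eval w = 0 := by
    intro w hw hwz
    simp only [Q, eval_prod, eval_sub, eval_X, eval_C]
    exact Finset.prod_eq_zero (i := w) (Finset.mem_erase.mpr ⟨hwz, Multiset.mem_toFinset.mpr hw⟩) (sub_self _)
  have hsum : ∀ n, ∑ k ∈ Finset.range (Q.natDegree + 1), Q.coeff k * (W.map fun w => w ^ (n + k)).sum =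
      (W.count z) * z ^ n * Q.eval z := by
    intro n
    have h1 : ∀ V : Multiset ℂ, ∑ k ∈ Finset.range (Q.natDegree + 1), Q.coeff k * (V.map fun w => w ^ (n + k)).sum =
        (V.map fun w => w ^ n * Q.eval w).sum := by
      intro V
      induction V using Multiset.induction with
      | empty => simp
      | cons a V ih =>
        simp only [Multiset.map_cons, Multiset.sum_cons, mul_add, Finset.sum_add_distrib, ih]
        congr 1
        rw [eval_eq_sum_range, Finset.mul_sum]
        exact Finset.sum_congr rfl fun k _ => by ring
    rw [h1, Finset.sum_multiset_map_count, Finset.sum_eq_single z]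
    · simp; ring
    · intro w hw hwz
      rw [hQw w (Multiset.mem_toFinset.mp hw) hwz]; simp
    · intro hh; exact (hh (Multiset.mem_toFinset.mpr hz)).elim
  have hcount : (1 : ℝ) ≤ W.count z := by exact_mod_cast Multiset.one_le_count_iff_mem.mpr hz
  let K' := ∑ k ∈ Finset.range (Q.natDegree + 1), ‖Q.coeff k‖ * (K * B ^ k)
  have hbound : ∀ n, n₀ ≤ n → ‖z‖ ^ n * ‖Q.eval z‖ ≤ K' * B ^ n := by
    intro n hn
    have h2 : ‖z‖ ^ n * ‖Q.eval z‖ ≤ ‖(W.count z : ℂ) * z ^ n * Q.eval z‖ := by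
      rw [norm_mul, norm_mul, norm_pow, Complex.norm_natCast, mul_assoc]
      exact le_mul_of_one_le_left (by positivity) hcount
    refine h2.trans ?_
    rw [← hsum, Finset.sum_mul]
    refine (norm_sum_le _ _).trans (Finset.sum_le_sum fun k _ => ?_)
    rw [norm_mul, mul_assoc, mul_assoc, ← pow_add, add_comm k n]
    exact mul_le_mul_of_nonneg_left (h _ (by omega)) (norm_nonneg _)
  by_contra hlt
  push Not at hlt
  have hr : 1 < ‖z‖ / B := (one_lt_div hB).mpr hlt
  have hQpos : 0 < ‖Q.eval z‖ := norm_pos_iff.mpr hQz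
  obtain ⟨n, hn⟩ := pow_unbounded_of_one_lt (K' / ‖Q.eval z‖) hr
  have h3 := hbound (max n n₀) (le_max_right _ _)
  have h4 : (‖z‖ / B) ^ n ≤ (‖z‖ / B) ^ (max n n₀) := pow_le_pow_right₀ hr.le (le_max_left _ _)
  have h5 := hn.trans_le h4
  rw [div_pow, div_lt_div_iff₀ hQpos (by positivity)] at h5
  linarith

section
variable {F : Type*} [Field F] [Fintype F] [DecidableEq F]

/-- The finite set of monic polynomials of degree `n` over a finite field. -/
noncomputable def monicsOfDegree (F : Type*) [Field F] [Fintype F] [DecidableEq F] (n : ℕ) : Finset F[X] :=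
  Finset.univ.image fun v : Fin n → F => X ^ n + ∑ i : Fin n, C (v i) * X ^ (i : ℕ)

theorem mem_monicsOfDegree {n : ℕ} {g : F[X]} : g ∈ monicsOfDegree F n ↔ g.Monic ∧ g.natDegree = n := by
  simp only [monicsOfDegree, Finset.mem_image, Finset.mem_univ, true_and]
  constructor
  · rintro ⟨v, rfl⟩
    have h : (∑ i : Fin n, C (v i) * X ^ (i : ℕ)).degree < (n : WithBot ℕ) := by
      refine (degree_sum_le _ _).trans_lt ((Finset.sup_lt_iff (WithBot.bot_lt_coe _)).mpr fun i _ => ?_)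
      exact (degree_C_mul_X_pow_le _ _).trans_lt (by exact_mod_cast i.2)
    have hm := monic_X_pow_add h
    refine ⟨hm, ?_⟩
    refine natDegree_eq_of_degree_eq_some ?_
    rw [degree_add_eq_left_of_degree_lt (by rw [degree_X_pow]; exact h), degree_X_pow]
  · rintro ⟨hg, rfl⟩
    refine ⟨fun i => g.coeff i, ?_⟩
    rw [Fin.sum_univ_eq_sum_range (fun i => C (g.coeff i) * X ^ i)]
    exact hg.as_sum.symm

theorem monicsOfDegree_zero : monicsOfDegree F 0 = {1} := by
  ext g
  rw [mem_monicsOfDegree, Finset.mem_singleton]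
  constructor
  · rintro ⟨h1, h2⟩; exact h1.natDegree_eq_zero.mp h2
  · rintro rfl; simp

theorem sum_monicsOfDegree_one (G : F[X] → ℂ) :
    ∑ g ∈ monicsOfDegree F 1, G g = ∑ b, G (X + C b) := by
  symm
  refine Finset.sum_nbij' (fun b => X + C b) (fun g => g.coeff 0) ?_ ?_ ?_ ?_ ?_
  · intro b _; rw [mem_monicsOfDegree]; exact ⟨monic_X_add_C b, natDegree_X_add_C b⟩
  · intro g _; exact Finset.mem_univ _
  · intro b _; simp
  · intro g hg
    rw [mem_monicsOfDegree] at hg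
    exact (hg.1.eq_X_add_C hg.2).symm
  · intro b _; rfl

/-- The multiplicative weight attached to a polynomial by values of a character. -/
noncomputable def polyWeight (χ : MulChar F ℂ) (S : Finset F) (e : F → ℕ) (g : F[X]) : ℂ :=
  ∏ a ∈ S, χ (g.eval a) ^ e a

theorem polyWeight_mul (χ : MulChar F ℂ) (S : Finset F) (e : F → ℕ) (g h : F[X]) :
    polyWeight χ S e (g * h) = polyWeight χ S e g * polyWeight χ S e h := by
  simp only [polyWeight, eval_mul, map_mul, mul_pow, Finset.prod_mul_distrib]

theorem sum_polyWeight_eq_zero {χ : MulChar F ℂ} {S : Finset F} {e : F → ℕ} {a : F} (ha : a ∈ S)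
    {u : F} (hu : u ≠ 0) (hχu : χ u ^ e a ≠ 1) {n : ℕ} (hn : S.card ≤ n) :
    ∑ g ∈ monicsOfDegree F n, polyWeight χ S e g = 0 := by
  let ℓ : F[X] := Lagrange.basis S id a
  have hℓa : ℓ.eval a = 1 := Lagrange.eval_basis_self (v := id) Function.injective_id.injOn ha
  have hℓb : ∀ b ∈ S, b ≠ a → ℓ.eval b = 0 := fun b hb hba =>
    Lagrange.eval_basis_of_ne (v := id) hba.symm hb
  have hℓd : ℓ.degree < n := by
    have := Lagrange.degree_basis (v := id) Function.injective_id.injOn ha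
    rw [show ℓ.degree = ((S.card - 1 : ℕ) : WithBot ℕ) from this]
    have : 0 < S.card := Finset.card_pos.mpr ⟨a, ha⟩
    exact_mod_cast (by omega : S.card - 1 < n)
  let T : F[X] → F[X] := fun g => g + C ((u - 1) * g.eval a) * ℓ
  have hTa : ∀ g, (T g).eval a = u * g.eval a := by
    intro g; simp only [T, eval_add, eval_mul, eval_C, hℓa]; ring
  have hTb : ∀ g, ∀ b ∈ S, b ≠ a → (T g).eval b = g.eval b := by
    intro g b hb hba; simp only [T, eval_add, eval_mul, eval_C, hℓb b hb hba]; ring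
  have hTm : ∀ g ∈ monicsOfDegree F n, T g ∈ monicsOfDegree F n := by
    intro g hg
    rw [mem_monicsOfDegree] at hg ⊢
    have h1 : (C ((u - 1) * g.eval a) * ℓ).degree < g.degree := by
      rw [degree_eq_natDegree hg.1.ne_zero, hg.2]
      refine lt_of_le_of_lt ?_ hℓd
      refine (degree_mul_le _ _).trans ?_
      calc (C ((u - 1) * g.eval a)).degree + ℓ.degree ≤ 0 + ℓ.degree := by gcongr; exact degree_C_le
        _ = _ := zero_add _
    exact ⟨hg.1.add_of_left h1, by rw [← hg.2]; exact natDegree_add_eq_left_of_degree_lt h1⟩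
  have hTinj : Set.InjOn T (monicsOfDegree F n) := by
    intro g _ h _ hgh
    have h1 : u * g.eval a = u * h.eval a := by rw [← hTa, ← hTa, hgh]
    have h2 := mul_left_cancel₀ hu h1
    simp only [T, h2] at hgh
    exact add_right_cancel hgh
  have hTimg : (monicsOfDegree F n).image T = monicsOfDegree F n :=
    Finset.eq_of_subset_of_card_le (Finset.image_subset_iff.mpr hTm)
      (by rw [Finset.card_image_of_injOn hTinj])
  have hTw : ∀ g, polyWeight χ S e (T g) = χ u ^ e a * polyWeight χ S e g := by
    intro g
    rw [polyWeight, polyWeight, ← Finset.mul_prod_erase S _ ha, ← Finset.mul_prod_erase S _ ha, hTa, map_mul, mul_pow,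
      mul_assoc]
    congr 2
    refine Finset.prod_congr rfl fun b hb => ?_
    rw [hTb g b (Finset.mem_of_mem_erase hb) (Finset.ne_of_mem_erase hb)]
  have h1 : ∑ g ∈ monicsOfDegree F n, polyWeight χ S e g =
      χ u ^ e a * ∑ g ∈ monicsOfDegree F n, polyWeight χ S e g := by
    conv_lhs => rw [← hTimg, Finset.sum_image hTinj]
    simp_rw [hTw, ← Finset.mul_sum]
  have h2 : (χ u ^ e a - 1) * ∑ g ∈ monicsOfDegree F n, polyWeight χ S e g = 0 := by
    rw [sub_mul, ← h1]; ring
  exact (mul_eq_zero.mp h2).resolve_left (sub_ne_zero.mpr hχu)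

theorem newton_recursion_polyWeight (χ : MulChar F ℂ) (S : Finset F) (e : F → ℕ)
    (E : ℕ → Type*) [∀ l, Field (E l)]
    [∀ l, Algebra F (E l)] [∀ l, FiniteDimensional F (E l)] [∀ l, Fintype (E l)]
    (hE : ∀ l, l ≠ 0 → Module.finrank F (E l) = l) (n : ℕ) :
    (n : ℂ) * ∑ g ∈ monicsOfDegree F n, polyWeight χ S e g =
      ∑ l ∈ Finset.Icc 1 n, (∑ x : E l, polyWeight χ S e (minpolyPow F x)) *
        ∑ g ∈ monicsOfDegree F (n - l), polyWeight χ S e g := by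
  classical
  have h1 : ∀ l ∈ Finset.Icc 1 n, (∑ x : E l, polyWeight χ S e (minpolyPow F x)) *
        ∑ g ∈ monicsOfDegree F (n - l), polyWeight χ S e g =
      ∑ g ∈ monicsOfDegree F n, ((Finset.univ.filter fun x : E l => minpolyPow F x ∣ g).card : ℂ) * polyWeight χ S e g := by
    intro l hl
    simp only [Finset.mem_Icc] at hl
    rw [Finset.sum_mul]
    have h2 : ∀ x : E l, polyWeight χ S e (minpolyPow F x) * ∑ g ∈ monicsOfDegree F (n - l), polyWeight χ S e g =
        ∑ g ∈ monicsOfDegree F n, if minpolyPow F x ∣ g then polyWeight χ S e g else 0 := by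
      intro x
      rw [Finset.mul_sum, ← Finset.sum_filter]
      simp_rw [← polyWeight_mul]
      have hm := minpolyPow_monic (F := F) x
      have hdg : (minpolyPow F x).natDegree = l := by rw [natDegree_minpolyPow, hE l (by omega)]
      refine Finset.sum_nbij (fun g => minpolyPow F x * g) ?_ ?_ ?_ ?_
      · intro g hg
        rw [mem_monicsOfDegree] at hg
        rw [Finset.mem_filter, mem_monicsOfDegree]
        refine ⟨⟨hm.mul hg.1, ?_⟩, dvd_mul_right _ _⟩
        rw [hm.natDegree_mul hg.1, hdg, hg.2]; omega
      · intro g _ h _ hgh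
        exact mul_left_cancel₀ hm.ne_zero hgh
      · intro g hg
        rw [Finset.mem_coe, Finset.mem_filter, mem_monicsOfDegree] at hg
        obtain ⟨⟨h3, h4⟩, k, rfl⟩ := hg
        have hk := hm.of_mul_monic_left h3
        rw [hm.natDegree_mul hk, hdg] at h4
        exact ⟨k, by rw [Finset.mem_coe, mem_monicsOfDegree]; exact ⟨hk, by omega⟩, rfl⟩
      · intro g _; rfl
    simp_rw [h2]
    rw [Finset.sum_comm]
    refine Finset.sum_congr rfl fun g _ => ?_
    rw [← Finset.sum_filter, Finset.sum_const, nsmul_eq_mul]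
  rw [Finset.sum_congr rfl h1, Finset.sum_comm, Finset.mul_sum]
  refine Finset.sum_congr rfl fun g hg => ?_
  rw [mem_monicsOfDegree] at hg
  rw [← Finset.sum_mul]
  congr 1
  have := sum_card_minpolyPow_dvd E hE g hg.1.ne_zero n hg.2.le
  rw [hg.2] at this
  exact_mod_cast this.symm

end

/-- The composition of a multiplicative character with the norm of a finite field extension. -/
noncomputable def mulCharNorm {F : Type*} (L : Type*) [Field F] [Field L] [Algebra F L] [FiniteDimensional F L]
    (χ : MulChar F ℂ) : MulChar L ℂ where
  toFun x := χ (Algebra.norm F x)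
  map_one' := by simp
  map_mul' x y := by simp
  map_nonunit' x hx := by
    have : x = 0 := by simpa [isUnit_iff_ne_zero] using hx
    rw [this, Algebra.norm_zero]; exact MulChar.map_zero χ

theorem mulCharNorm_apply {F L : Type*} [Field F] [Field L] [Algebra F L] [FiniteDimensional F L]
    (χ : MulChar F ℂ) (x : L) : mulCharNorm L χ x = χ (Algebra.norm F x) := rfl

section weil
variable {p : ℕ} [Fact p.Prime]

theorem polyWeight_minpolyPow {F L : Type*} [Field F] [Fintype F] [DecidableEq F] [Field L] [Algebra F L] [FiniteDimensional F L]
    (χ : MulChar F ℂ) (S : Finset F) (e : F → ℕ) (x : L) :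
    polyWeight χ S e (minpolyPow F x) =
      mulCharNorm L χ ((∏ a ∈ S, (C (algebraMap F L a) - X) ^ e a).eval x) := by
  simp only [polyWeight, mulCharNorm_apply, eval_prod, eval_pow, eval_sub, eval_C, eval_X, map_prod, map_pow]
  refine Finset.prod_congr rfl fun a _ => ?_
  rw [minpolyPow, eval_pow, norm_algebraMap_sub_eq_eval_minpoly_pow]

theorem natDegree_prod_C_sub_X {L ι : Type*} [Field L] (S : Finset ι) (b : ι → L) (e : ι → ℕ) :
    (∏ a ∈ S, (C (b a) - X) ^ e a).natDegree = ∑ a ∈ S, e a := by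
  have h1 : ∀ a, (C (b a) - X : L[X]).natDegree = 1 := fun a => by
    rw [← neg_sub, natDegree_neg, natDegree_X_sub_C]
  have h2 : ∀ a, (C (b a) - X : L[X]) ≠ 0 := fun a h => by
    have := h1 a; rw [h] at this; simp at this
  rw [natDegree_prod _ _ fun a _ => pow_ne_zero _ (h2 a)]
  refine Finset.sum_congr rfl fun a _ => ?_
  rw [natDegree_pow, h1, mul_one]

/-- Weil's bound for sums of products of powers of one multiplicative character. -/
theorem norm_sum_prod_mulChar_le (χ : MulChar (ZMod p) ℂ) {d : ℕ} (hd : 2 ≤ d) (hχ : orderOf χ = d)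
    (S : Finset (ZMod p)) (e : ZMod p → ℕ) (hcop : Nat.Coprime (∑ a ∈ S, e a) d) :
    ‖∑ x, ∏ a ∈ S, χ (x + a) ^ e a‖ ≤ S.card * Real.sqrt p := by
  classical
  have hp := (Fact.out : p.Prime)
  obtain ⟨a, ha, hda⟩ : ∃ a ∈ S, ¬ d ∣ e a := by
    by_contra! h
    have h1 : d ∣ ∑ a ∈ S, e a := Finset.dvd_sum h
    have := Nat.dvd_gcd h1 dvd_rfl
    rw [hcop] at this
    have := Nat.le_of_dvd one_pos this
    omega
  have hea : e a ≠ 0 := by intro h; rw [h] at hda; exact hda (dvd_zero _)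
  have hne : χ ^ e a ≠ 1 := fun h => hda (hχ ▸ orderOf_dvd_of_pow_eq_one h)
  obtain ⟨u, hu⟩ := MulChar.ne_one_iff.mp hne
  rw [MulChar.pow_apply' _ hea] at hu
  have hcard : 1 ≤ S.card := Finset.card_pos.mpr ⟨a, ha⟩
  let E : ℕ → Type := fun l => GaloisField p l
  let _ : ∀ l, Fintype (E l) := fun l => Fintype.ofFinite _
  have hE : ∀ l, l ≠ 0 → Module.finrank (ZMod p) (E l) = l := fun l hl => GaloisField.finrank p hl
  let c : ℕ → ℂ := fun n => ∑ g ∈ monicsOfDegree (ZMod p) n, polyWeight χ S e g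
  let s : ℕ → ℂ := fun l => ∑ x : E l, polyWeight χ S e (minpolyPow (ZMod p) x)
  have hc0 : c 0 = 1 := by simp [c, monicsOfDegree_zero, polyWeight]
  have hcD : ∀ n, S.card - 1 < n → c n = 0 := fun n hn =>
    sum_polyWeight_eq_zero ha u.ne_zero hu (by omega)
  have hrec : ∀ n : ℕ, (n : ℂ) * c n = ∑ l ∈ Finset.Icc 1 n, s l * c (n - l) :=
    newton_recursion_polyWeight χ S e E hE
  obtain ⟨W, hW, hsW⟩ := exists_multiset_power_sums hc0 hcD hrec
  have hc1 : c 1 = ∑ x, ∏ a ∈ S, χ (x + a) ^ e a := by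
    simp only [c, sum_monicsOfDegree_one, polyWeight, eval_add, eval_X, eval_C]
    exact Finset.sum_congr rfl fun x _ => Finset.prod_congr rfl fun a _ => by rw [add_comm]
  have hcs : c 1 = -(W.map fun ω => ω).sum := by
    have := hrec 1
    simp only [Nat.cast_one, one_mul, Finset.Icc_self, Finset.sum_singleton, Nat.sub_self, hc0, mul_one] at this
    rw [this, hsW 1 le_rfl]; simp
  set m := ∑ a ∈ S, e a with hm
  have hp1 : 1 < p := hp.one_lt
  have hdp : d ∣ p - 1 := by
    rw [← hχ]
    have := MulChar.orderOf_dvd_card_sub_one (ZMod p) χ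
    rwa [ZMod.card] at this
  have hbound : ∀ n, d * (d * m ^ 2) + 1 ≤ n →
      ‖((W.map fun ω => ω ^ 2).map fun z => z ^ n).sum‖ ≤ (2 * d * m + m : ℕ) * (p : ℝ) ^ n := by
    intro n hn
    have hn0 : 2 * n ≠ 0 := by omega
    have h1 : ((W.map fun ω => ω ^ 2).map fun z => z ^ n).sum = - s (2 * n) := by
      rw [hsW (2 * n) (by omega), neg_neg, Multiset.map_map]
      simp only [Function.comp_def, ← pow_mul]
    rw [h1, norm_neg]
    obtain ⟨t, ht⟩ : d ∣ p ^ n - 1 := hdp.trans (by simpa using Nat.sub_dvd_pow_sub_pow p 1 n)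
    have hpn : n < p ^ n := Nat.lt_pow_self hp1
    have hq : p ^ n = d * t + 1 := by omega
    have hQ : Fintype.card (E (2 * n)) = (d * t + 1) ^ 2 := by
      rw [← Nat.card_eq_fintype_card, GaloisField.card p _ hn0, ← hq]; ring
    have htm : d * m ^ 2 ≤ t := by
      have : d * (d * m ^ 2) ≤ d * t := by omega
      exact Nat.le_of_mul_le_mul_left this (by omega)
    let ψ := mulCharNorm (E (2 * n)) χ
    have hψ1 : ψ ≠ 1 := by
      obtain ⟨x, hx⟩ := FiniteField.norm_surjective (ZMod p) (E (2 * n)) (u : ZMod p)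
      intro h
      have h2 : ψ x = χ u := by rw [← hx]; rfl
      have hx0 : x ≠ 0 := by
        rintro rfl
        rw [Algebra.norm_zero] at hx; exact u.ne_zero hx.symm
      rw [h, MulChar.one_apply (isUnit_iff_ne_zero.mpr hx0)] at h2
      rw [← h2, one_pow] at hu
      exact hu rfl
    have hψd : ψ ^ d = 1 := by
      ext x
      rw [MulChar.pow_apply_coe, MulChar.one_apply_coe]
      have hxu : IsUnit (Algebra.norm (ZMod p) (x : E (2 * n))) := x.isUnit.map _
      change χ (Algebra.norm (ZMod p) (x : E (2 * n))) ^ d = 1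
      rw [← MulChar.pow_apply' _ (by omega), ← hχ, pow_orderOf_eq_one, MulChar.one_apply hxu]
    have h3 := norm_sum_mulChar_comp_le (E := E (2 * n)) hq hQ hd
      (∏ a ∈ S, (C (algebraMap (ZMod p) (E (2 * n)) a) - X) ^ e a) (natDegree_prod_C_sub_X _ _ _) hcop htm ψ hψ1 hψd
    have h4 : s (2 * n) = ∑ x, ψ ((∏ a ∈ S, (C (algebraMap (ZMod p) (E (2 * n)) a) - X) ^ e a).eval x) :=
      Finset.sum_congr rfl fun x _ => polyWeight_minpolyPow χ S e x
    rw [h4]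
    refine h3.trans ?_
    rw [show (p : ℝ) ^ n = ((p ^ n : ℕ) : ℝ) by push_cast; rfl, hq]
    norm_cast
    rw [← hm, add_mul]
    exact Nat.add_le_add_left (Nat.le_mul_of_pos_right _ (Nat.succ_pos _)) _
  have hω : ∀ ω ∈ W, ‖ω‖ ≤ Real.sqrt p := by
    intro ω hω
    have h1 := norm_le_of_norm_sum_pow_le (B := p) (by exact_mod_cast hp.pos) hbound
      (Multiset.mem_map_of_mem (fun ω : ℂ => ω ^ 2) hω)
    rw [norm_pow] at h1
    exact Real.le_sqrt_of_sq_le h1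
  rw [← hc1, hcs, norm_neg, Multiset.map_id']
  have h5 : ∀ V : Multiset ℂ, (∀ ω ∈ V, ‖ω‖ ≤ Real.sqrt p) → ‖V.sum‖ ≤ V.card * Real.sqrt p := by
    intro V
    induction V using Multiset.induction with
    | empty => simp
    | cons a V ih =>
      intro h
      rw [Multiset.sum_cons, Multiset.card_cons]
      push_cast
      have := ih fun ω hω => h ω (Multiset.mem_cons_of_mem hω)
      have := h a (Multiset.mem_cons_self _ _)
      have := norm_add_le a V.sum
      linarith
  refine (h5 W hω).trans ?_
  gcongr
  omega

end weil

theorem norm_mulChar_apply_le_one {R : Type*} [CommMonoid R] [Finite Rˣ] (χ : MulChar R ℂ) (x : R) : ‖χ x‖ ≤ 1 := by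
  by_cases hx : IsUnit x
  · obtain ⟨u, rfl⟩ := hx
    have h1 : χ u ^ Nat.card Rˣ = 1 := by
      rw [← map_pow, ← Units.val_pow_eq_pow_val, pow_card_eq_one']; simp
    exact (Complex.norm_eq_one_of_pow_eq_one h1 Nat.card_pos.ne').le
  · rw [MulChar.map_nonunit χ hx]; simp

section
variable {p : ℕ} [Fact p.Prime] {ι : Type*} [Fintype ι] [DecidableEq ι]

theorem norm_sum_prod_mulChar_index_le (χ : MulChar (ZMod p) ℂ) {d : ℕ} (hd : 2 ≤ d) (hχ : orderOf χ = d)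
    (b : ι → ZMod p) (e : ι → ℕ) (hcop : Nat.Coprime (∑ i, e i) d) :
    ‖∑ x, ∏ i, χ (x + b i) ^ e i‖ ≤ Fintype.card ι * Real.sqrt p := by
  classical
  let S := Finset.univ.image b
  let e' : ZMod p → ℕ := fun a => ∑ i with b i = a, e i
  have h1 : ∀ x, ∏ i, χ (x + b i) ^ e i = ∏ a ∈ S, χ (x + a) ^ e' a := by
    intro x
    rw [← Finset.prod_fiberwise_of_maps_to (s := Finset.univ) (t := S) (g := b) (fun i _ => Finset.mem_image_of_mem _ (Finset.mem_univ _))]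
    refine Finset.prod_congr rfl fun a _ => ?_
    rw [← Finset.prod_pow_eq_pow_sum]
    refine Finset.prod_congr rfl fun i hi => ?_
    rw [(Finset.mem_filter.mp hi).2]
  have h2 : ∑ a ∈ S, e' a = ∑ i, e i :=
    Finset.sum_fiberwise_of_maps_to (fun i _ => Finset.mem_image_of_mem _ (Finset.mem_univ _)) _
  simp_rw [h1]
  refine (norm_sum_prod_mulChar_le χ hd hχ S e' (by rw [h2]; exact hcop)).trans ?_
  gcongr
  exact Finset.card_image_le

theorem norm_sum_prod_signed_mulChar_le (χ : MulChar (ZMod p) ℂ) (hχ : χ ≠ 1) (n : ι → ZMod p) (σ : ι → Bool) (i₀ : ι)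
    (hn : ∀ i, i ≠ i₀ → n i ≠ n i₀) :
    ‖∑ x, ∏ i, (if σ i then χ else χ⁻¹) (x + n i)‖ ≤ Fintype.card ι * Real.sqrt p := by
  set d := orderOf χ with hd
  have hdpos : 0 < d := MulChar.orderOf_pos χ
  have hd2 : 2 ≤ d := by
    have : d ≠ 1 := by rw [hd, Ne, orderOf_eq_one_iff]; exact hχ
    omega
  have hχd : ∀ y : ZMod p, y ≠ 0 → χ y ^ d = 1 := by
    intro y hy
    rw [← MulChar.pow_apply' _ (by omega), hd, pow_orderOf_eq_one, MulChar.one_apply (isUnit_iff_ne_zero.mpr hy)]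
  have hinv : ∀ y : ZMod p, χ y⁻¹ = χ y ^ (d - 1) := by
    intro y
    by_cases hy : y = 0
    · rw [hy, inv_zero, MulChar.map_zero, zero_pow (by omega)]
    · have h1 : χ y * χ y⁻¹ = 1 := by rw [← map_mul, mul_inv_cancel₀ hy, map_one]
      have h2 : χ y * χ y ^ (d - 1) = 1 := by rw [← pow_succ', Nat.sub_add_cancel hdpos, hχd y hy]
      have h3 : χ y ≠ 0 := left_ne_zero_of_mul_eq_one h1
      exact mul_left_cancel₀ h3 (h1.trans h2.symm)
  let e : ι → ℕ := fun i => if σ i then 1 else d - 1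
  have he1 : ∀ i, 1 ≤ e i := by intro i; simp only [e]; split_ifs <;> omega
  have hecop : ∀ i, Nat.Coprime (e i) d := by
    intro i; simp only [e]; split_ifs
    · exact Nat.coprime_one_left d
    · exact ((Nat.coprime_self_sub_right (m := 1) (n := d) hdpos).mpr (Nat.coprime_one_right d)).symm
  have hχe : ∀ i y, (if σ i then χ else χ⁻¹) y = χ y ^ e i := by
    intro i y
    simp only [e]; split_ifs
    · rw [pow_one]
    · rw [MulChar.inv_apply', hinv]
  simp_rw [hχe]
  let E := (d - 1) * ∑ i, e i
  have hsum1 : 1 ≤ ∑ i, e i := (he1 i₀).trans (Finset.single_le_sum (f := e) (fun _ _ => Nat.zero_le _) (Finset.mem_univ i₀))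
  have hE : E ≠ 0 := Nat.mul_ne_zero (by omega) (by omega)
  let β : ι → ZMod p := fun i => if i = i₀ then 0 else (n i - n i₀)⁻¹
  let e' : ι → ℕ := fun i => if i = i₀ then E else e i
  let K : ℂ := ∏ i ∈ Finset.univ.erase i₀, χ (n i - n i₀) ^ e i
  have hK : ‖K‖ ≤ 1 := by
    rw [norm_prod]
    refine Finset.prod_le_one (fun _ _ => norm_nonneg _) fun i _ => ?_
    rw [norm_pow]
    exact pow_le_one₀ (norm_nonneg _) (norm_mulChar_apply_le_one χ _)
  have hterm : ∀ t : ZMod p, ∏ i, χ (-n i₀ + t⁻¹ + n i) ^ e i = K * ∏ i, χ (t + β i) ^ e' i := by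
    intro t
    rw [← Finset.mul_prod_erase _ _ (Finset.mem_univ i₀), ← Finset.mul_prod_erase _ (fun i => χ (t + β i) ^ e' i) (Finset.mem_univ i₀)]
    by_cases ht : t = 0
    · subst ht
      have h0 : χ (0 : ZMod p) = 0 := MulChar.map_zero χ
      have h1 := he1 i₀
      have h2 : χ (-n i₀ + (0 : ZMod p)⁻¹ + n i₀) ^ e i₀ = 0 := by
        rw [inv_zero, add_zero, neg_add_cancel, h0, zero_pow (by omega)]
      have h3 : χ (0 + β i₀) ^ e' i₀ = 0 := by
        simp only [β, e', if_true, add_zero, h0, zero_pow hE]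
      rw [h2, h3, zero_mul, zero_mul, mul_zero]
    · have h1 : ∀ i ∈ Finset.univ.erase i₀, χ (-n i₀ + t⁻¹ + n i) ^ e i =
          (χ t ^ (d - 1)) ^ e i * χ (n i - n i₀) ^ e i * χ (t + β i) ^ e' i := by
        intro i hi
        have hne := Finset.ne_of_mem_erase hi
        have hb : n i - n i₀ ≠ 0 := sub_ne_zero.mpr (hn i hne)
        simp only [β, e', if_neg hne]
        rw [← hinv, ← mul_pow, ← mul_pow, ← map_mul, ← map_mul]
        congr 2
        field_simp
        ring
      rw [Finset.prod_congr rfl h1, Finset.prod_mul_distrib, Finset.prod_mul_distrib, Finset.prod_pow_eq_pow_sum]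
      have h2 : (∑ i, e i) = e i₀ + ∑ i ∈ Finset.univ.erase i₀, e i := (Finset.add_sum_erase _ _ (Finset.mem_univ _)).symm
      simp only [β, e', if_true, E, h2]
      rw [show -n i₀ + t⁻¹ + n i₀ = t⁻¹ by ring, hinv, add_zero, pow_mul (χ t), pow_add]
      ring
  let T : ZMod p ≃ ZMod p := (Equiv.inv (ZMod p)).trans (Equiv.addLeft (-n i₀))
  have hT : ∑ x, ∏ i, χ (x + n i) ^ e i = ∑ t, ∏ i, χ (-n i₀ + t⁻¹ + n i) ^ e i :=
    (Equiv.sum_comp T (fun x => ∏ i, χ (x + n i) ^ e i)).symm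
  rw [hT]
  simp_rw [hterm]
  rw [← Finset.mul_sum, norm_mul]
  refine (mul_le_of_le_one_left (norm_nonneg _) hK).trans ?_
  refine norm_sum_prod_mulChar_index_le χ hd2 rfl β e' ?_
  have h3 : ∑ i, e' i + e i₀ = d * ∑ i, e i := by
    rw [← Finset.add_sum_erase _ _ (Finset.mem_univ i₀), ← Finset.add_sum_erase _ e (Finset.mem_univ i₀)]
    have h4 : ∑ i ∈ Finset.univ.erase i₀, e' i = ∑ i ∈ Finset.univ.erase i₀, e i :=
      Finset.sum_congr rfl fun i hi => if_neg (Finset.ne_of_mem_erase hi)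
    rw [h4]
    simp only [e', if_true, E]
    rw [← Finset.add_sum_erase _ e (Finset.mem_univ i₀)]
    obtain ⟨k, hk⟩ : ∃ k, d = k + 1 := ⟨d - 1, by omega⟩
    rw [hk, Nat.add_sub_cancel]; ring
  refine Nat.Coprime.symm (Nat.coprime_of_dvd fun r hr hrd hrs => ?_)
  have h5 : r ∣ e i₀ := (Nat.dvd_add_right hrs).mp (h3 ▸ hrd.mul_right _)
  have := Nat.dvd_gcd h5 hrd
  rw [hecop] at this
  exact hr.one_lt.ne' (Nat.dvd_one.mp this)

end

section
variable {p : ℕ} [Fact p.Prime] {ι : Type*} [Fintype ι] [DecidableEq ι]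

theorem isUnit_zmod_sq_iff (x : ZMod (p ^ 2)) :
    IsUnit x ↔ ZMod.castHom (dvd_pow_self p two_ne_zero) (ZMod p) x ≠ 0 := by
  have hp := (Fact.out : p.Prime)
  obtain ⟨k, rfl⟩ := ZMod.natCast_zmod_surjective x
  rw [ZMod.isUnit_iff_coprime, map_natCast, Ne, ZMod.natCast_eq_zero_iff, Nat.coprime_pow_right_iff (by norm_num),
    Nat.coprime_comm, hp.coprime_iff_not_dvd]

theorem zmod_sq_mul_self : (p : ZMod (p ^ 2)) * p = 0 := by
  have := ZMod.natCast_self (p ^ 2)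
  rw [pow_two] at this ⊢
  exact_mod_cast this

theorem card_filter_castHom_le (P : ZMod p → Prop) [DecidablePred P] :
    (Finset.univ.filter fun x : ZMod (p ^ 2) => P (ZMod.castHom (dvd_pow_self p two_ne_zero) (ZMod p) x)).card ≤
      (Finset.univ.filter P).card * p := by
  have hp := (Fact.out : p.Prime)
  have h0 : (Finset.univ.filter P).card * p = ((Finset.univ.filter P) ×ˢ Finset.range p).card := by
    rw [Finset.card_product, Finset.card_range]
  rw [h0]
  refine Finset.card_le_card_of_injOn
    (fun x => (ZMod.castHom (dvd_pow_self p two_ne_zero) (ZMod p) x, x.val / p)) ?_ ?_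
  · intro x hx
    simp only [Finset.coe_filter, Finset.mem_univ, true_and, Set.mem_ofPred_eq, Finset.coe_product, Set.mem_prod,
      Finset.mem_coe, Finset.mem_range] at hx ⊢
    refine ⟨hx, ?_⟩
    rw [Nat.div_lt_iff_lt_mul hp.pos, ← pow_two]
    exact ZMod.val_lt x
  · intro x _ y _ hxy
    simp only [Prod.mk.injEq] at hxy
    obtain ⟨h1, h2⟩ := hxy
    apply ZMod.val_injective
    have h3 : x.val % p = y.val % p := by
      have h4 : ∀ z : ZMod (p ^ 2), ZMod.castHom (dvd_pow_self p two_ne_zero) (ZMod p) z = (z.val : ZMod p) := by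
        intro z
        conv_lhs => rw [← ZMod.natCast_zmod_val z]
        rw [map_natCast]
      rw [h4, h4, ZMod.natCast_eq_natCast_iff] at h1
      exact h1
    rw [← Nat.div_add_mod x.val p, ← Nat.div_add_mod y.val p, h2, h3]

theorem card_roots_signed_le (n : ι → ZMod p) (ε : ι → ZMod p) (i₀ : ι) (hε : ε i₀ ≠ 0) (hn : ∀ i, i ≠ i₀ → n i ≠ n i₀) :
    (Finset.univ.filter fun u : ZMod p => ∑ i, ε i * ∏ j ∈ Finset.univ.erase i, (u + n j) = 0).card ≤ Fintype.card ι := by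
  let Q : (ZMod p)[X] := ∑ i, C (ε i) * ∏ j ∈ Finset.univ.erase i, (X + C (n j))
  have hQe : ∀ u, Q.eval u = ∑ i, ε i * ∏ j ∈ Finset.univ.erase i, (u + n j) := by
    intro u; simp [Q, eval_finsetSum, eval_prod]
  have hQ0 : Q ≠ 0 := by
    intro h
    have h1 := hQe (-n i₀)
    rw [h, eval_zero, Finset.sum_eq_single i₀] at h1
    · have h2 := (mul_eq_zero.mp h1.symm).resolve_left hε
      obtain ⟨j, hj, hj0⟩ := Finset.prod_eq_zero_iff.mp h2
      exact hn j (Finset.ne_of_mem_erase hj) (neg_add_eq_zero.mp hj0).symm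
    · intro i _ hi
      rw [Finset.prod_eq_zero (i := i₀) (Finset.mem_erase.mpr ⟨hi.symm, Finset.mem_univ _⟩) (neg_add_cancel _), mul_zero]
    · intro h3; exact (h3 (Finset.mem_univ _)).elim
  have hdeg : Q.natDegree ≤ Fintype.card ι := by
    refine natDegree_sum_le_of_forall_le _ _ fun i _ => ?_
    refine (natDegree_C_mul_le _ _).trans ((natDegree_prod_le _ _).trans ?_)
    simp only [natDegree_X_add_C, Finset.sum_const, smul_eq_mul, mul_one]
    exact (Finset.card_le_univ _)
  refine le_trans ?_ hdeg
  apply card_le_degree_of_subset_roots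
  intro u hu
  simp only [Finset.mem_val, Finset.mem_filter, Finset.mem_univ, true_and] at hu
  rw [mem_roots hQ0, IsRoot.def, hQe, hu]

theorem norm_sum_prod_signed_mulChar_sq_le (χ : MulChar (ZMod (p ^ 2)) ℂ)
    (hχ : ∃ z : ZMod (p ^ 2), χ (1 + (p : ZMod (p ^ 2)) * z) ≠ 1) (n : ι → ZMod (p ^ 2)) (σ : ι → Bool) (i₀ : ι)
    (hn : ∀ i, i ≠ i₀ → IsUnit (n i - n i₀)) :
    ‖∑ x, ∏ i, (if σ i then χ else χ⁻¹) (x + n i)‖ ≤ Fintype.card ι * p := by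
  have hp := (Fact.out : p.Prime)
  have hπ := zmod_sq_mul_self (p := p)
  set φ := ZMod.castHom (dvd_pow_self p two_ne_zero) (ZMod p) with hφ
  have hφp : φ (p : ZMod (p ^ 2)) = 0 := by rw [map_natCast, ZMod.natCast_self]
  let χs : ι → MulChar (ZMod (p ^ 2)) ℂ := fun i => if σ i then χ else χ⁻¹
  let ε : ι → ZMod (p ^ 2) := fun i => if σ i then 1 else -1
  let η : ZMod (p ^ 2) → ℂ := fun z => χ (1 + p * z)
  have hη0 : η 0 = 1 := by simp [η]
  have hηadd : ∀ z w, η (z + w) = η z * η w := by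
    intro z w
    simp only [η]
    rw [← map_mul]
    congr 1
    linear_combination (-(z * w)) * hπ
  have hηneg : ∀ z, η (-z) = (η z)⁻¹ := by
    intro z
    have h1 := hηadd (-z) z
    rw [neg_add_cancel, hη0] at h1
    exact eq_inv_of_mul_eq_one_left h1.symm
  have hηsum : ∀ (s : Finset ι) (w : ι → ZMod (p ^ 2)), η (∑ i ∈ s, w i) = ∏ i ∈ s, η (w i) := by
    intro s w
    induction s using Finset.induction_on with
    | empty => simp [hη0]
    | insert a s ha ih => rw [Finset.sum_insert ha, Finset.prod_insert ha, hηadd, ih]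
  have hηnat : ∀ (k : ℕ) z, η (k * z) = η z ^ k := by
    intro k z
    induction k with
    | zero => simp [hη0]
    | succ k ih => push_cast; rw [add_mul, one_mul, hηadd, ih, pow_succ]
  have hχsη : ∀ i z, (χs i) (1 + p * z) = η (ε i * z) := by
    intro i z
    simp only [χs, ε]
    split_ifs
    · simp [η]
    · rw [neg_one_mul, hηneg]
      exact MulChar.inv_apply_eq_inv' χ _
  let f : ZMod (p ^ 2) → ℂ := fun x => ∏ i, (χs i) (x + n i)
  have hf1 : ∀ x, ‖f x‖ ≤ 1 := by
    intro x
    simp only [f]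
    rw [norm_prod]
    exact Finset.prod_le_one (fun _ _ => norm_nonneg _) fun i _ => norm_mulChar_apply_le_one _ _
  let G : ZMod (p ^ 2) → ℂ := fun x => ∑ v ∈ Finset.range p, f (x + p * v)
  have havg : (p : ℂ) * ∑ x, f x = ∑ x, G x := by
    simp only [G]
    rw [Finset.sum_comm]
    have : ∀ v ∈ Finset.range p, ∑ x, f (x + p * v) = ∑ x, f x := fun v _ =>
      Equiv.sum_comp (Equiv.addRight ((p : ZMod (p ^ 2)) * v)) f
    rw [Finset.sum_congr rfl this, Finset.sum_const, Finset.card_range, nsmul_eq_mul]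
  have hGp : ∀ x, ‖G x‖ ≤ p := by
    intro x
    refine (norm_sum_le _ _).trans ((Finset.sum_le_sum fun v _ => hf1 _).trans ?_)
    simp
  let good : ZMod p → Prop := fun u => ∑ i, φ (ε i) * ∏ j ∈ Finset.univ.erase i, (u + φ (n j)) = 0
  classical
  have hG0 : ∀ x, ¬ good (φ x) → G x = 0 := by
    intro x hx
    by_cases hu : ∀ i, IsUnit (x + n i)
    · choose w hw using fun i => (hu i).exists_right_inv
      have hfx : ∀ v : ℕ, f (x + p * v) = f x * η (∑ i, ε i * w i) ^ v := by
        intro v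
        rw [← hηnat, Finset.mul_sum, hηsum]
        simp only [f]
        rw [← Finset.prod_mul_distrib]
        refine Finset.prod_congr rfl fun i _ => ?_
        rw [show (v : ZMod (p ^ 2)) * (ε i * w i) = ε i * (v * w i) by ring, ← hχsη, ← map_mul]
        congr 1
        linear_combination (-(p * (v : ZMod (p ^ 2)))) * hw i
      have hW : φ (∑ i, ε i * w i) ≠ 0 := by
        intro h
        apply hx
        have h1 : ∀ i, ∏ j ∈ Finset.univ.erase i, (φ x + φ (n j)) = φ (w i) * ∏ j, (φ x + φ (n j)) := by
          intro i
          rw [← Finset.mul_prod_erase _ _ (Finset.mem_univ i), ← mul_assoc, ← map_add, ← map_mul,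
            mul_comm (w i), hw, map_one, one_mul]
        simp only [good, h1]
        simp_rw [← mul_assoc, ← map_mul]
        rw [← Finset.sum_mul, ← map_sum, h, zero_mul]
      have hη1 : η (∑ i, ε i * w i) ≠ 1 := by
        intro h
        obtain ⟨z, hz⟩ := hχ
        obtain ⟨y, hy⟩ := ((isUnit_zmod_sq_iff _).mpr hW).exists_left_inv
        obtain ⟨k, hk⟩ := ZMod.natCast_zmod_surjective (z * y)
        apply hz
        have h1 := hηnat k (∑ i, ε i * w i)
        rw [h, one_pow, hk, mul_assoc, hy, mul_one] at h1
        exact h1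
      have hηp : η (∑ i, ε i * w i) ^ p = 1 := by
        rw [← hηnat]
        simp only [η]
        rw [← mul_assoc, hπ, zero_mul, add_zero, map_one]
      simp only [G, hfx]
      rw [← Finset.mul_sum, geom_sum_eq hη1, hηp, sub_self, zero_div, mul_zero]
    · push Not at hu
      obtain ⟨i, hi⟩ := hu
      refine Finset.sum_eq_zero fun v _ => Finset.prod_eq_zero (Finset.mem_univ i) ?_
      refine MulChar.map_nonunit _ ?_
      rw [isUnit_zmod_sq_iff, not_not] at hi ⊢
      rw [← hi, ← hφ, map_add, map_add, map_mul, hφp, map_add]; ring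
  have hcard : (Finset.univ.filter fun x => good (φ x)).card ≤ Fintype.card ι * p := by
    refine (card_filter_castHom_le good).trans (Nat.mul_le_mul_right _ ?_)
    refine card_roots_signed_le (fun i => φ (n i)) (fun i => φ (ε i)) i₀ ?_ ?_
    · simp only [ε]; split_ifs <;> simp
    · intro i hi
      have := (isUnit_zmod_sq_iff _).mp (hn i hi)
      rw [← hφ, map_sub] at this
      exact sub_ne_zero.mp this
  have hp0 : (0 : ℝ) < p := by exact_mod_cast hp.pos
  have h1 : (p : ℝ) * ‖∑ x, f x‖ ≤ p * (Fintype.card ι * p) := by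
    have h2 : (p : ℝ) * ‖∑ x, f x‖ = ‖∑ x, G x‖ := by rw [← havg, norm_mul, Complex.norm_natCast]
    rw [h2]
    have h3 : ∑ x, G x = ∑ x with good (φ x), G x := by
      rw [Finset.sum_filter]
      refine Finset.sum_congr rfl fun x _ => ?_
      split_ifs with hx
      · rfl
      · exact hG0 x hx
    rw [h3]
    refine (norm_sum_le _ _).trans ((Finset.sum_le_sum fun v _ => hGp _).trans ?_)
    rw [Finset.sum_const, nsmul_eq_mul, mul_comm]
    gcongr
    exact_mod_cast hcard
  exact le_of_mul_le_mul_left h1 hp0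

end

end Polynomials

/-- A character modulo `q` that is nontrivial on the units congruent to `1` modulo `q / p`
for every prime `p ∣ q`. -/
def IsLocallyPrimitive {q : ℕ} (χ : MulChar (ZMod q) ℂ) : Prop :=
  ∀ p : ℕ, p.Prime → p ∣ q → ∃ z : ZMod q,
    IsUnit (1 + ((q / p : ℕ) : ZMod q) * z) ∧ χ (1 + ((q / p : ℕ) : ZMod q) * z) ≠ 1

theorem DirichletCharacter.IsPrimitive.isLocallyPrimitive {q : ℕ} [NeZero q] {χ : DirichletCharacter ℂ q}
    (hχ : χ.IsPrimitive) : IsLocallyPrimitive χ := by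
  intro p hp hpq
  by_contra! h
  have hd : q / p ∣ q := Nat.div_dvd_of_dvd hpq
  have hq0 : q ≠ 0 := NeZero.ne q
  have h1 : χ.FactorsThrough (q / p) := by
    rw [DirichletCharacter.factorsThrough_iff_ker_unitsMap hd]
    intro u hu
    rw [MonoidHom.mem_ker] at hu ⊢
    have h2 : ZMod.castHom hd (ZMod (q / p)) (u : ZMod q) = 1 := by
      have := congrArg Units.val hu
      simpa [ZMod.unitsMap] using this
    obtain ⟨z, hz⟩ : ∃ z, (u : ZMod q) = 1 + ((q / p : ℕ) : ZMod q) * z := by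
      obtain ⟨k, hk⟩ := ZMod.natCast_zmod_surjective ((u : ZMod q) - 1)
      have h3 : ((k : ℕ) : ZMod (q / p)) = 0 := by
        have := congrArg (ZMod.castHom hd (ZMod (q / p))) hk
        rw [map_natCast, map_sub, h2, map_one, sub_self] at this
        exact this
      rw [ZMod.natCast_eq_zero_iff] at h3
      obtain ⟨j, rfl⟩ := h3
      refine ⟨j, ?_⟩
      rw [← sub_eq_iff_eq_add', ← hk]; push_cast; rfl
    have h4 := h z (hz ▸ u.isUnit)
    rw [← hz] at h4
    ext
    simpa using h4
  have h5 := Nat.sInf_le (s := χ.conductorSet) h1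
  have h6 : sInf χ.conductorSet = q := hχ
  rw [h6] at h5
  have := Nat.div_lt_self (Nat.pos_of_ne_zero hq0) hp.one_lt
  omega

section
variable {a b : ℕ}

/-- The component at `a` of a character modulo `a * b`. -/
noncomputable def crtLeft (h : Nat.Coprime a b) (χ : MulChar (ZMod (a * b)) ℂ) : MulChar (ZMod a) ℂ where
  toFun x := χ ((ZMod.chineseRemainder h).symm (x, 1))
  map_one' := by rw [← Prod.one_eq_mk, map_one, map_one]
  map_mul' x y := by rw [← map_mul, ← map_mul, Prod.mk_mul_mk, one_mul]
  map_nonunit' x hx := by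
    apply MulChar.map_nonunit
    rw [isUnit_map_iff, Prod.isUnit_iff]
    exact fun h => hx h.1

/-- The component at `b` of a character modulo `a * b`. -/
noncomputable def crtRight (h : Nat.Coprime a b) (χ : MulChar (ZMod (a * b)) ℂ) : MulChar (ZMod b) ℂ where
  toFun x := χ ((ZMod.chineseRemainder h).symm (1, x))
  map_one' := by rw [← Prod.one_eq_mk, map_one, map_one]
  map_mul' x y := by rw [← map_mul, ← map_mul, Prod.mk_mul_mk, one_mul]
  map_nonunit' x hx := by
    apply MulChar.map_nonunit
    rw [isUnit_map_iff, Prod.isUnit_iff]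
    exact fun h => hx h.2

theorem crt_mul_apply (h : Nat.Coprime a b) (χ : MulChar (ZMod (a * b)) ℂ) (x : ZMod a) (y : ZMod b) :
    χ ((ZMod.chineseRemainder h).symm (x, y)) = crtLeft h χ x * crtRight h χ y := by
  change _ = χ _ * χ _
  rw [← map_mul, ← map_mul, Prod.mk_mul_mk, one_mul, mul_one]

theorem IsLocallyPrimitive.crtLeft (h : Nat.Coprime a b) {χ : MulChar (ZMod (a * b)) ℂ} (hχ : IsLocallyPrimitive χ) :
    IsLocallyPrimitive (crtLeft h χ) := by
  intro p hp hpa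
  obtain ⟨z, hz1, hz2⟩ := hχ p hp (hpa.mul_right b)
  obtain ⟨w, rfl⟩ := (ZMod.chineseRemainder h).symm.surjective z
  have hdiv : a * b / p = a / p * b := (Nat.div_mul_right_comm hpa b).symm
  have h1 : 1 + ((a * b / p : ℕ) : ZMod (a * b)) * (ZMod.chineseRemainder h).symm w =
      (ZMod.chineseRemainder h).symm (1 + ((a / p : ℕ) : ZMod a) * (b * w.1), 1) := by
    rw [← map_natCast (ZMod.chineseRemainder h).symm, ← map_mul, ← map_one (ZMod.chineseRemainder h).symm, ← map_add]
    congr 1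
    refine Prod.ext ?_ ?_
    · simp [hdiv, mul_assoc]
    · simp [hdiv]
  rw [h1] at hz1 hz2
  refine ⟨b * w.1, ?_, hz2⟩
  rw [isUnit_map_iff, Prod.isUnit_iff] at hz1
  exact hz1.1

theorem IsLocallyPrimitive.crtRight (h : Nat.Coprime a b) {χ : MulChar (ZMod (a * b)) ℂ} (hχ : IsLocallyPrimitive χ) :
    IsLocallyPrimitive (crtRight h χ) := by
  intro p hp hpb
  obtain ⟨z, hz1, hz2⟩ := hχ p hp (hpb.mul_left a)
  obtain ⟨w, rfl⟩ := (ZMod.chineseRemainder h).symm.surjective z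
  have hdiv : a * b / p = a * (b / p) := Nat.mul_div_assoc a hpb
  have h1 : 1 + ((a * b / p : ℕ) : ZMod (a * b)) * (ZMod.chineseRemainder h).symm w =
      (ZMod.chineseRemainder h).symm (1, 1 + ((b / p : ℕ) : ZMod b) * (a * w.2)) := by
    rw [← map_natCast (ZMod.chineseRemainder h).symm, ← map_mul, ← map_one (ZMod.chineseRemainder h).symm, ← map_add]
    congr 1
    refine Prod.ext ?_ ?_
    · simp [hdiv]
    · simp [hdiv]; ring
  rw [h1] at hz1 hz2
  refine ⟨a * w.2, ?_, hz2⟩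
  rw [isUnit_map_iff, Prod.isUnit_iff] at hz1
  exact hz1.2

theorem sum_prod_signed_mulChar_crt [NeZero a] [NeZero b] [NeZero (a * b)] (h : Nat.Coprime a b) {ι : Type*} [Fintype ι]
    (χ : MulChar (ZMod (a * b)) ℂ) (n : ι → ℤ) (σ : ι → Bool) :
    ∑ x, ∏ i, (if σ i then χ else χ⁻¹) (x + (n i : ZMod (a * b))) =
      (∑ x, ∏ i, (if σ i then crtLeft h χ else (crtLeft h χ)⁻¹) (x + (n i : ZMod a))) *
      ∑ x, ∏ i, (if σ i then crtRight h χ else (crtRight h χ)⁻¹) (x + (n i : ZMod b)) := by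
  rw [← Equiv.sum_comp (ZMod.chineseRemainder h).symm.toEquiv, Fintype.sum_prod_type, Finset.sum_mul_sum]
  refine Finset.sum_congr rfl fun x _ => Finset.sum_congr rfl fun y _ => ?_
  rw [← Finset.prod_mul_distrib]
  refine Finset.prod_congr rfl fun i _ => ?_
  have h1 : (ZMod.chineseRemainder h).symm.toEquiv (x, y) + (n i : ZMod (a * b)) =
      (ZMod.chineseRemainder h).symm (x + n i, y + n i) := by
    rw [← map_intCast (ZMod.chineseRemainder h).symm]
    exact (map_add (ZMod.chineseRemainder h).symm _ _).symm
  rw [h1]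
  split_ifs
  · rw [crt_mul_apply]
  · rw [MulChar.inv_apply_eq_inv', MulChar.inv_apply_eq_inv', MulChar.inv_apply_eq_inv', crt_mul_apply, mul_inv]

end

theorem norm_sum_prod_signed_mulChar_cubefree_le {ι : Type*} [Fintype ι] [DecidableEq ι] (q : ℕ) :
    ∀ [NeZero q], (∀ p : ℕ, p.Prime → ¬ p ^ 3 ∣ q) → ∀ χ : MulChar (ZMod q) ℂ, IsLocallyPrimitive χ →
    ∀ (n : ι → ℤ) (σ : ι → Bool) (i₀ : ι),
    ‖∑ x, ∏ i, (if σ i then χ else χ⁻¹) (x + (n i : ZMod q))‖ ≤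
      (Fintype.card ι : ℝ) ^ q.primeFactors.card * Real.sqrt q *
        Nat.gcd q (∏ i ∈ Finset.univ.erase i₀, (n i - n i₀)).natAbs := by
  have htriv : ∀ (q : ℕ) [NeZero q] (χ : MulChar (ZMod q) ℂ) (n : ι → ℤ) (σ : ι → Bool),
      ‖∑ x, ∏ i, (if σ i then χ else χ⁻¹) (x + (n i : ZMod q))‖ ≤ q := by
    intro q _ χ n σ
    refine (norm_sum_le _ _).trans ((Finset.sum_le_sum (g := fun _ => (1 : ℝ)) fun x _ => ?_).trans ?_)
    · rw [norm_prod]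
      exact Finset.prod_le_one (fun _ _ => norm_nonneg _) fun i _ => norm_mulChar_apply_le_one _ _
    · simp [ZMod.card]
  induction q using Nat.recOnPosPrimePosCoprime with
  | zero => intro h; exact (h.out rfl).elim
  | one =>
    intro _ _ χ _ n σ i₀
    refine (htriv 1 χ n σ).trans ?_
    simp
  | prime_pow p k hp hk =>
    have : Fact p.Prime := ⟨hp⟩
    intro _ hcf χ hχ n σ i₀
    have hk3 : k < 3 := by
      by_contra! h
      exact hcf p hp (pow_dvd_pow p h)
    rw [Nat.primeFactors_prime_pow hk.ne' hp, Finset.card_singleton, pow_one]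
    have hι : (1 : ℝ) ≤ Fintype.card ι := by exact_mod_cast Fintype.card_pos_iff.mpr ⟨i₀⟩
    have hp1 : (1 : ℝ) ≤ p := by exact_mod_cast hp.pos
    set A := (∏ i ∈ Finset.univ.erase i₀, (n i - n i₀)).natAbs with hA
    by_cases hpA : p ∣ A
    · refine (htriv _ χ n σ).trans ?_
      have h1 : p ≤ Nat.gcd (p ^ k) A :=
        Nat.le_of_dvd (Nat.gcd_pos_of_pos_left _ (pow_pos hp.pos k)) (Nat.dvd_gcd (dvd_pow_self p hk.ne') hpA)
      have h2 : (p : ℝ) ≤ (Nat.gcd (p ^ k) A : ℝ) := by exact_mod_cast h1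
      have h3 : ((p ^ k : ℕ) : ℝ) ≤ Real.sqrt (p ^ k : ℕ) * p := by
        have h4 : Real.sqrt (p ^ k : ℕ) ≤ p := by
          rw [Real.sqrt_le_left (by positivity)]
          push_cast
          exact pow_le_pow_right₀ hp1 (by omega)
        calc ((p ^ k : ℕ) : ℝ) = Real.sqrt (p ^ k : ℕ) * Real.sqrt (p ^ k : ℕ) := (Real.mul_self_sqrt (by positivity)).symm
          _ ≤ _ := by gcongr
      calc ((p ^ k : ℕ) : ℝ) ≤ Real.sqrt (p ^ k : ℕ) * p := h3
        _ = 1 * Real.sqrt (p ^ k : ℕ) * p := by ring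
        _ ≤ _ := by gcongr
    · have h1 : (1 : ℝ) ≤ (Nat.gcd (p ^ k) A : ℝ) := by
        exact_mod_cast Nat.gcd_pos_of_pos_left _ (pow_pos hp.pos k)
      refine le_trans ?_ (le_mul_of_one_le_right (by positivity) h1)
      have hiso : ∀ i, i ≠ i₀ → ¬ (p : ℤ) ∣ n i - n i₀ := by
        intro i hi h
        apply hpA
        rw [hA, ← Int.natCast_dvd]
        exact h.trans (Finset.dvd_prod_of_mem (fun i => n i - n i₀) (Finset.mem_erase.mpr ⟨hi, Finset.mem_univ _⟩))
      clear_value A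
      obtain rfl | rfl : k = 1 ∨ k = 2 := by omega
      · clear hpA h1 hA hcf hk hk3
        rename_i inst
        revert inst χ
        generalize hq : p ^ 1 = q
        rw [pow_one] at hq
        subst hq
        intro inst χ hχ
        refine norm_sum_prod_signed_mulChar_le χ ?_ (fun i => (n i : ZMod p)) σ i₀ ?_
        · rintro rfl
          obtain ⟨z, hz1, hz2⟩ := hχ p hp dvd_rfl
          exact hz2 (MulChar.one_apply hz1)
        · intro i hi h
          apply hiso i hi
          rw [← ZMod.intCast_zmod_eq_zero_iff_dvd]; push_cast
          exact sub_eq_zero.mpr h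
      · have h2 : Real.sqrt (p ^ 2 : ℕ) = p := by
          push_cast; exact Real.sqrt_sq (by positivity)
        rw [h2]
        refine norm_sum_prod_signed_mulChar_sq_le χ ?_ (fun i => (n i : ZMod (p ^ 2))) σ i₀ ?_
        · obtain ⟨z, -, hz2⟩ := hχ p hp (dvd_pow_self p two_ne_zero)
          have h3 : p ^ 2 / p = p := by rw [pow_two, Nat.mul_div_cancel _ hp.pos]
          rw [h3] at hz2
          exact ⟨z, hz2⟩
        · intro i hi
          rw [isUnit_zmod_sq_iff, ← Int.cast_sub, map_intCast, Ne, ZMod.intCast_zmod_eq_zero_iff_dvd]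
          exact hiso i hi
  | coprime a b ha hb hab iha ihb =>
    intro _ hcf χ hχ n σ i₀
    have : NeZero a := ⟨by omega⟩
    have : NeZero b := ⟨by omega⟩
    rw [sum_prod_signed_mulChar_crt hab, norm_mul, hab.primeFactors_mul,
      Finset.card_union_of_disjoint hab.disjoint_primeFactors, Nat.gcd_comm (a * b), Nat.Coprime.gcd_mul _ hab, Nat.gcd_comm _ a, Nat.gcd_comm _ b]
    refine (mul_le_mul (iha (fun p hp h => hcf p hp (h.mul_right b)) _ (hχ.crtLeft hab) n σ i₀)
      (ihb (fun p hp h => hcf p hp (h.mul_left a)) _ (hχ.crtRight hab) n σ i₀) (norm_nonneg _) (by positivity)).trans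
      (le_of_eq ?_)
    push_cast
    rw [Real.sqrt_mul (by positivity), pow_add]
    ring

theorem Nat.card_divisors_le_three_pow {q : ℕ} (hq : q ≠ 0) (hcf : ∀ p : ℕ, p.Prime → ¬ p ^ 3 ∣ q) :
    q.divisors.card ≤ 3 ^ q.primeFactors.card := by
  rw [Nat.card_divisors hq, ← Finset.prod_const]
  refine Finset.prod_le_prod' fun p hp => ?_
  have hp' := Nat.prime_of_mem_primeFactors hp
  by_contra! h
  exact hcf p hp' ((hp'.pow_dvd_iff_le_factorization hq).mpr (by omega))

theorem sum_gcd_Ioc_le {q : ℕ} (hq : q ≠ 0) (h : ℕ) :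
    ∑ m ∈ Finset.Ioc 0 h, Nat.gcd q m ≤ h * q.divisors.card := by
  calc ∑ m ∈ Finset.Ioc 0 h, Nat.gcd q m
      ≤ ∑ m ∈ Finset.Ioc 0 h, ∑ d ∈ q.divisors, if d ∣ m then d else 0 := by
        refine Finset.sum_le_sum fun m _ => ?_
        refine le_trans ?_ (Finset.single_le_sum (f := fun d => if d ∣ m then d else 0)
          (fun _ _ => Nat.zero_le _) (Nat.mem_divisors.mpr ⟨Nat.gcd_dvd_left q m, hq⟩))
        rw [if_pos (Nat.gcd_dvd_right q m)]
    _ = ∑ d ∈ q.divisors, h / d * d := by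
        rw [Finset.sum_comm]
        refine Finset.sum_congr rfl fun d _ => ?_
        rw [← Finset.sum_filter, Finset.sum_const, Nat.Ioc_filter_dvd_card_eq_div, smul_eq_mul]
    _ ≤ ∑ d ∈ q.divisors, h := Finset.sum_le_sum fun d _ => Nat.div_mul_le_self h d
    _ = _ := by rw [Finset.sum_const, smul_eq_mul, mul_comm]

theorem sum_gcd_sub_le {q : ℕ} (hq : q ≠ 0) (h c : ℕ) (hc : c < h) :
    ∑ b ∈ Finset.range h, (if b = c then 0 else Nat.gcd q ((b : ℤ) - c).natAbs) ≤ 2 * h * q.divisors.card := by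
  have h1 : ∑ b ∈ Finset.range h with b < c, Nat.gcd q ((b : ℤ) - c).natAbs ≤ h * q.divisors.card := by
    refine le_trans ?_ (sum_gcd_Ioc_le hq h)
    rw [← Finset.sum_image (s := {b ∈ Finset.range h | b < c}) (g := fun b => c - b) (f := fun m => Nat.gcd q m) ?_ |>.trans
      (Finset.sum_congr rfl fun b hb => ?_)]
    · refine Finset.sum_le_sum_of_subset fun m hm => ?_
      simp only [Finset.mem_image, Finset.mem_filter, Finset.mem_range, Finset.mem_Ioc] at hm ⊢
      omega
    · intro x hx y hy hxy
      simp only [Finset.coe_filter, Finset.mem_range, Set.mem_ofPred_eq] at hx hy hxy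
      omega
    · simp only [Finset.mem_filter, Finset.mem_range] at hb
      congr 1; omega
  have h2 : ∑ b ∈ Finset.range h with c < b, Nat.gcd q ((b : ℤ) - c).natAbs ≤ h * q.divisors.card := by
    refine le_trans ?_ (sum_gcd_Ioc_le hq h)
    rw [← Finset.sum_image (s := {b ∈ Finset.range h | c < b}) (g := fun b => b - c) (f := fun m => Nat.gcd q m) ?_ |>.trans
      (Finset.sum_congr rfl fun b hb => ?_)]
    · refine Finset.sum_le_sum_of_subset fun m hm => ?_
      simp only [Finset.mem_image, Finset.mem_filter, Finset.mem_range, Finset.mem_Ioc] at hm ⊢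
      omega
    · intro x hx y hy hxy
      simp only [Finset.coe_filter, Finset.mem_range, Set.mem_ofPred_eq] at hx hy hxy
      omega
    · simp only [Finset.mem_filter, Finset.mem_range] at hb
      congr 1; omega
  calc _ ≤ ∑ b ∈ Finset.range h, ((if b < c then Nat.gcd q ((b : ℤ) - c).natAbs else 0) +
        if c < b then Nat.gcd q ((b : ℤ) - c).natAbs else 0) := by
        refine Finset.sum_le_sum fun b _ => ?_
        split_ifs <;> omega
    _ ≤ _ := by
        rw [Finset.sum_add_distrib, ← Finset.sum_filter, ← Finset.sum_filter]
        linarith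

/-- The tuples in which every value is attained at least twice. -/
theorem card_tuples_no_isolated_le (r h : ℕ) :
    (Finset.card {n ∈ Fintype.piFinset fun _ : Fin r × Bool => Finset.range h | ∀ i, ∃ j, j ≠ i ∧ n j = n i}) ≤
      r ^ (2 * r) * h ^ r := by
  classical
  have hcard : (Finset.univ ×ˢ (Fintype.piFinset fun _ : Fin r => Finset.range h) :
      Finset ((Fin r × Bool → Fin r) × (Fin r → ℕ))).card = r ^ (2 * r) * h ^ r := by
    rw [Finset.card_product, Finset.card_univ, Fintype.card_fun]
    simp [mul_comm]
  rw [← hcard]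
  refine (Finset.card_le_card (t := Finset.image (fun x : (Fin r × Bool → Fin r) × (Fin r → ℕ) => x.2 ∘ x.1) _) ?_).trans
    Finset.card_image_le
  intro n hn
  simp only [Finset.mem_filter, Fintype.mem_piFinset, Finset.mem_range] at hn
  obtain ⟨hn1, hn2⟩ := hn
  have hle : (Finset.univ.image n).card ≤ r := by
    have h1 : 2 * (Finset.univ.image n).card ≤ (Finset.univ : Finset (Fin r × Bool)).card := by
      refine Finset.mul_card_image_le_card (s := Finset.univ) (f := n) (n := 2) ?_
      intro b hb
      obtain ⟨i, -, rfl⟩ := Finset.mem_image.mp hb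
      obtain ⟨j, hj1, hj2⟩ := hn2 i
      rw [← Finset.card_pair hj1]
      refine Finset.card_le_card ?_
      intro x hx
      simp only [Finset.mem_insert, Finset.mem_singleton] at hx
      obtain rfl | rfl := hx <;> simp [hj2]
    simp at h1
    omega
  simp only [Finset.mem_image, Finset.mem_product, Finset.mem_univ, true_and, Fintype.mem_piFinset, Finset.mem_range, Prod.exists]
  rcases isEmpty_or_nonempty (Fin r × Bool) with hE | ⟨⟨i₁⟩⟩
  · have hr : IsEmpty (Fin r) := by
      by_contra h'
      rw [not_isEmpty_iff] at h'
      exact hE.false (h'.some, true)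
    exact ⟨fun i => hE.elim i, fun i => hr.elim i, fun i => hr.elim i, funext fun i => hE.elim i⟩
  · have : Nonempty {x // x ∈ Finset.univ.image n} := ⟨⟨n i₁, Finset.mem_image_of_mem _ (Finset.mem_univ _)⟩⟩
    let e := (Finset.univ.image n).equivFin.toEmbedding.trans (Fin.castLEEmb hle)
    refine ⟨fun i => e ⟨n i, Finset.mem_image_of_mem _ (Finset.mem_univ _)⟩, fun t => (Function.invFun e t).1, ?_, ?_⟩
    · intro t
      obtain ⟨i, -, hi⟩ := Finset.mem_image.mp (Function.invFun e t).2
      change (Function.invFun e t).1 < h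
      rw [← hi]; exact hn1 i
    · funext i
      simp only [Function.comp]
      rw [Function.leftInverse_invFun e.injective]

/-- The absolute value of the sum of `χ` over the interval of length `h` starting at `x`. -/
noncomputable def shortSum {q : ℕ} (χ : MulChar (ZMod q) ℂ) (h : ℕ) (x : ZMod q) : ℝ :=
  ‖∑ b ∈ Finset.range h, χ (x + b)‖

theorem shortSum_nonneg {q : ℕ} (χ : MulChar (ZMod q) ℂ) (h : ℕ) (x : ZMod q) : 0 ≤ shortSum χ h x :=
  norm_nonneg _

theorem shortSum_le {q : ℕ} [NeZero q] (χ : MulChar (ZMod q) ℂ) (h : ℕ) (x : ZMod q) : shortSum χ h x ≤ h := by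
  refine (norm_sum_le _ _).trans ((Finset.sum_le_sum (g := fun _ => (1 : ℝ)) fun b _ => norm_mulChar_apply_le_one _ _).trans ?_)
  simp

theorem shortSum_pow_eq {q : ℕ} [NeZero q] (χ : MulChar (ZMod q) ℂ) (r h : ℕ) (x : ZMod q) :
    ((shortSum χ h x ^ (2 * r) : ℝ) : ℂ) = ∑ n ∈ Fintype.piFinset fun _ : Fin r × Bool => Finset.range h,
      ∏ i : Fin r × Bool, (if i.2 then χ else χ⁻¹) (x + (n i : ZMod q)) := by
  classical
  rw [← Finset.prod_univ_sum (fun _ : Fin r × Bool => Finset.range h) (fun i b => (if i.2 then χ else χ⁻¹) (x + (b : ZMod q))),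
    Fintype.prod_prod_type]
  simp only [Fintype.prod_bool, if_true, Bool.false_eq_true, if_false, Finset.prod_const, Finset.card_univ, Fintype.card_fin]
  have h1 : ∑ b ∈ Finset.range h, χ⁻¹ (x + (b : ZMod q)) = (starRingEnd ℂ) (∑ b ∈ Finset.range h, χ (x + (b : ZMod q))) := by
    rw [map_sum]
    exact Finset.sum_congr rfl fun b _ => by rw [← MulChar.star_eq_inv, MulChar.star_apply]; rfl
  rw [h1, RCLike.mul_conj, pow_mul]
  simp [shortSum]

theorem sum_gcd_prod_le {q : ℕ} (hq : q ≠ 0) {ι : Type*} [Fintype ι] [DecidableEq ι] (h : ℕ) (i₀ : ι) :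
    ∑ n ∈ Fintype.piFinset (fun _ : ι => Finset.range h) with (∀ j, j ≠ i₀ → n j ≠ n i₀),
      Nat.gcd q (∏ j ∈ Finset.univ.erase i₀, ((n j : ℤ) - n i₀)).natAbs ≤
    h * (2 * h * q.divisors.card) ^ (Fintype.card ι - 1) := by
  let F : ℕ → ι → ℕ → ℕ := fun c j b => if j = i₀ then (if b = c then 1 else 0) else
    if b = c then 0 else Nat.gcd q ((b : ℤ) - c).natAbs
  have hgcd : ∀ (s : Finset ι) (f : ι → ℤ), Nat.gcd q (∏ j ∈ s, f j).natAbs ≤ ∏ j ∈ s, Nat.gcd q (f j).natAbs := by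
    intro s f
    induction s using Finset.induction_on with
    | empty => simp
    | insert a s ha ih =>
      rw [Finset.prod_insert ha, Finset.prod_insert ha, Int.natAbs_mul]
      have h1 := Nat.le_of_dvd (Nat.mul_pos (Nat.gcd_pos_of_pos_left _ (Nat.pos_of_ne_zero hq))
        (Nat.gcd_pos_of_pos_left _ (Nat.pos_of_ne_zero hq))) (Nat.gcd_mul_right_dvd_mul_gcd q (f a).natAbs (∏ j ∈ s, f j).natAbs)
      exact h1.trans (Nat.mul_le_mul_left _ ih)
  calc _ ≤ ∑ n ∈ Fintype.piFinset (fun _ : ι => Finset.range h), ∑ c ∈ Finset.range h, ∏ j, F c j (n j) := by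
        rw [Finset.sum_filter]
        refine Finset.sum_le_sum fun n hn => ?_
        rw [Fintype.mem_piFinset] at hn
        split_ifs with hiso
        · refine le_trans ?_ (Finset.single_le_sum (f := fun c => ∏ j, F c j (n j)) (fun _ _ => Nat.zero_le _) (hn i₀))
          refine (hgcd _ _).trans (le_of_eq ?_)
          rw [← Finset.mul_prod_erase _ _ (Finset.mem_univ i₀)]
          have h1 : F (n i₀) i₀ (n i₀) = 1 := by simp [F]
          rw [h1, one_mul]
          refine Finset.prod_congr rfl fun j hj => ?_
          have hj' := Finset.ne_of_mem_erase hj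
          simp [F, hj', hiso j hj']
        · exact Nat.zero_le _
    _ = ∑ c ∈ Finset.range h, ∏ j, ∑ b ∈ Finset.range h, F c j b := by
        rw [Finset.sum_comm]
        exact Finset.sum_congr rfl fun c _ => (Finset.prod_univ_sum (fun _ : ι => Finset.range h) (F c)).symm
    _ ≤ ∑ c ∈ Finset.range h, (2 * h * q.divisors.card) ^ (Fintype.card ι - 1) := by
        refine Finset.sum_le_sum fun c hc => ?_
        rw [← Finset.mul_prod_erase _ _ (Finset.mem_univ i₀)]
        have h1 : ∑ b ∈ Finset.range h, F c i₀ b = 1 := by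
          simp only [F, if_true, Finset.sum_ite_eq', if_pos hc]
        rw [h1, one_mul, ← Finset.card_univ, ← Finset.card_erase_of_mem (Finset.mem_univ i₀)]
        refine Finset.prod_le_pow_card _ _ _ fun j hj => ?_
        simp only [F, if_neg (Finset.ne_of_mem_erase hj)]
        exact sum_gcd_sub_le hq h c (Finset.mem_range.mp hc)
    _ = _ := by rw [Finset.sum_const, Finset.card_range, smul_eq_mul]

theorem sum_shortSum_pow_le {q : ℕ} [NeZero q] (hcf : ∀ p : ℕ, p.Prime → ¬ p ^ 3 ∣ q) {χ : MulChar (ZMod q) ℂ}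
    (hχ : IsLocallyPrimitive χ) {r : ℕ} (hr : 0 < r) (h : ℕ) :
    ∑ x, shortSum χ h x ^ (2 * r) ≤ q * (r ^ (2 * r) * h ^ r) +
      (2 * r) * ((2 * r : ℝ) ^ q.primeFactors.card * Real.sqrt q * (2 * h * q.divisors.card) ^ (2 * r)) := by
  classical
  have hq : q ≠ 0 := NeZero.ne q
  set N := Fintype.piFinset fun _ : Fin r × Bool => Finset.range h with hN
  let S : (Fin r × Bool → ℕ) → ℝ := fun n => ‖∑ x, ∏ i : Fin r × Bool, (if i.2 then χ else χ⁻¹) (x + (n i : ZMod q))‖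
  have h1 : ∑ x, shortSum χ h x ^ (2 * r) ≤ ∑ n ∈ N, S n := by
    have h2 : ((∑ x, shortSum χ h x ^ (2 * r) : ℝ) : ℂ) =
        ∑ n ∈ N, ∑ x, ∏ i : Fin r × Bool, (if i.2 then χ else χ⁻¹) (x + (n i : ZMod q)) := by
      rw [Finset.sum_comm, Complex.ofReal_sum]
      exact Finset.sum_congr rfl fun x _ => shortSum_pow_eq χ r h x
    have h3 := norm_sum_le N fun n => ∑ x, ∏ i : Fin r × Bool, (if i.2 then χ else χ⁻¹) (x + (n i : ZMod q))
    rw [← h2, Complex.norm_real] at h3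
    exact (le_abs_self _).trans h3
  have htriv : ∀ n, S n ≤ q := by
    intro n
    refine (norm_sum_le _ _).trans ((Finset.sum_le_sum (g := fun _ => (1 : ℝ)) fun x _ => ?_).trans ?_)
    · rw [norm_prod]
      exact Finset.prod_le_one (fun _ _ => norm_nonneg _) fun i _ => norm_mulChar_apply_le_one _ _
    · simp [ZMod.card]
  have hcardι : Fintype.card (Fin r × Bool) = 2 * r := by simp [mul_comm]
  have hweil : ∀ n i₀, S n ≤ (2 * r : ℝ) ^ q.primeFactors.card * Real.sqrt q *
      (Nat.gcd q (∏ j ∈ Finset.univ.erase i₀, ((n j : ℤ) - n i₀)).natAbs : ℝ) := by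
    intro n i₀
    have h2 := norm_sum_prod_signed_mulChar_cubefree_le q hcf χ hχ (fun i => (n i : ℤ)) Prod.snd i₀
    rw [hcardι] at h2
    push_cast at h2
    exact h2
  refine h1.trans ?_
  rw [← Finset.sum_filter_add_sum_filter_not N fun n => ∀ i, ∃ j, j ≠ i ∧ n j = n i]
  refine add_le_add ?_ ?_
  · refine (Finset.sum_le_sum fun n _ => htriv n).trans ?_
    rw [Finset.sum_const, nsmul_eq_mul, mul_comm]
    refine mul_le_mul_of_nonneg_left ?_ (by positivity)
    exact_mod_cast card_tuples_no_isolated_le r h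
  · calc _ ≤ ∑ n ∈ N with ¬ ∀ i, ∃ j, j ≠ i ∧ n j = n i, ∑ i₀, (if ∀ j, j ≠ i₀ → n j ≠ n i₀ then
          (2 * r : ℝ) ^ q.primeFactors.card * Real.sqrt q *
            (Nat.gcd q (∏ j ∈ Finset.univ.erase i₀, ((n j : ℤ) - n i₀)).natAbs : ℝ) else 0) := by
          refine Finset.sum_le_sum fun n hn => ?_
          have hn2 := (Finset.mem_filter.mp hn).2
          push Not at hn2
          obtain ⟨i₀, hi₀⟩ := hn2
          refine le_trans ?_ (Finset.single_le_sum (fun i _ => ?_) (Finset.mem_univ i₀))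
          · rw [if_pos hi₀]; exact hweil n i₀
          · split_ifs <;> positivity
      _ ≤ ∑ n ∈ N, ∑ i₀, (if ∀ j, j ≠ i₀ → n j ≠ n i₀ then
          (2 * r : ℝ) ^ q.primeFactors.card * Real.sqrt q *
            (Nat.gcd q (∏ j ∈ Finset.univ.erase i₀, ((n j : ℤ) - n i₀)).natAbs : ℝ) else 0) := by
          refine Finset.sum_le_sum_of_subset_of_nonneg (Finset.filter_subset _ _) fun n _ _ =>
            Finset.sum_nonneg fun i _ => ?_
          split_ifs <;> positivity
      _ ≤ ∑ i₀ : Fin r × Bool, (2 * r : ℝ) ^ q.primeFactors.card * Real.sqrt q * (2 * h * q.divisors.card) ^ (2 * r) := by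
          rw [Finset.sum_comm]
          refine Finset.sum_le_sum fun i₀ _ => ?_
          rw [← Finset.sum_filter, ← Finset.mul_sum]
          refine mul_le_mul_of_nonneg_left ?_ (by positivity)
          have h3 := sum_gcd_prod_le hq h i₀
          rw [hcardι] at h3
          have h4 : h * (2 * h * q.divisors.card) ^ (2 * r - 1) ≤ (2 * h * q.divisors.card) ^ (2 * r) := by
            have h5 : 2 * r = (2 * r - 1) + 1 := by omega
            conv_rhs => rw [h5, pow_succ']
            refine Nat.mul_le_mul_right _ ?_
            have : 0 < q.divisors.card := Finset.card_pos.mpr ⟨1, Nat.one_mem_divisors.mpr hq⟩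
            nlinarith
          exact_mod_cast h3.trans h4
      _ = _ := by
          rw [Finset.sum_const, Finset.card_univ, hcardι, nsmul_eq_mul]; push_cast; ring

theorem exists_pow_card_primeFactors_le {K η : ℝ} (hK : 1 ≤ K) (hη : 0 < η) :
    ∃ C : ℝ, 0 < C ∧ ∀ q : ℕ, 0 < q → K ^ q.primeFactors.card ≤ C * (q : ℝ) ^ η := by
  have hK0 : 0 < K := by linarith
  obtain ⟨N, hN⟩ := exists_nat_ge (K ^ (1 / η))
  refine ⟨K ^ N, by positivity, fun q hq => ?_⟩
  have hNK : K ≤ (N : ℝ) ^ η := by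
    calc K = (K ^ (1 / η)) ^ η := by
            rw [← Real.rpow_mul hK0.le, one_div_mul_cancel hη.ne', Real.rpow_one]
      _ ≤ _ := Real.rpow_le_rpow (by positivity) hN hη.le
  calc K ^ q.primeFactors.card = ∏ p ∈ q.primeFactors, K := by rw [Finset.prod_const]
    _ ≤ ∏ p ∈ q.primeFactors, ((if p < N then K else 1) * (p : ℝ) ^ η) := by
        refine Finset.prod_le_prod (fun _ _ => hK0.le) fun p hp => ?_
        have hp1 : (1 : ℝ) ≤ p := by exact_mod_cast (Nat.prime_of_mem_primeFactors hp).pos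
        split_ifs with h
        · exact le_mul_of_one_le_right hK0.le (Real.one_le_rpow hp1 hη.le)
        · rw [one_mul]
          exact hNK.trans (Real.rpow_le_rpow (by positivity) (by exact_mod_cast not_lt.mp h) hη.le)
    _ = (∏ p ∈ q.primeFactors, if p < N then K else 1) * ∏ p ∈ q.primeFactors, (p : ℝ) ^ η := Finset.prod_mul_distrib
    _ ≤ K ^ N * (q : ℝ) ^ η := by
        gcongr
        · rw [← Finset.prod_filter, Finset.prod_const]
          refine pow_le_pow_right₀ hK ?_
          calc _ ≤ (Finset.range N).card := Finset.card_le_card fun p hp => by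
                  simpa using (Finset.mem_filter.mp hp).2
            _ = N := Finset.card_range N
        · rw [Real.finsetProd_rpow _ _ fun _ _ => by positivity]
          refine Real.rpow_le_rpow (by positivity) ?_ hη.le
          rw [← Nat.cast_prod]
          exact_mod_cast Nat.le_of_dvd hq (Nat.prod_primeFactors_dvd q)

/-- The points at which the normalized short character sum is at least `θ`. -/
noncomputable def largeSet {q : ℕ} [NeZero q] (χ : MulChar (ZMod q) ℂ) (h : ℕ) (θ : ℝ) : Finset (ZMod q) :=
  {x | θ * h ≤ shortSum χ h x}

theorem exists_card_largeSet_le {η η' : ℝ} (hη : 0 < η) (hη' : 0 < η') :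
    ∃ C : ℝ, 0 < C ∧ ∃ m : ℕ, ∀ (q : ℕ) [NeZero q], (∀ p : ℕ, p.Prime → ¬ p ^ 3 ∣ q) →
      ∀ χ : MulChar (ZMod q) ℂ, IsLocallyPrimitive χ → ∀ (h : ℕ) (θ : ℝ), 0 < θ → (q : ℝ) ^ η' ≤ h →
      (largeSet χ h θ).card * θ ^ m ≤ C * (q : ℝ) ^ (1 / 2 + η) := by
  obtain ⟨r, hr⟩ := exists_nat_ge (1 / (2 * η') + 1)
  have hr1 : (1 : ℝ) ≤ r := le_trans (by simp [hη'.le]) hr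
  have hr0 : 0 < r := by exact_mod_cast (by linarith : (0 : ℝ) < r)
  have hr2 : 1 / 2 ≤ η' * r := by
    have : 1 / (2 * η') ≤ r := by linarith
    rw [div_le_iff₀ (by positivity)] at this
    linarith
  obtain ⟨C, hC, hCq⟩ := exists_pow_card_primeFactors_le (K := 2 * r * 9 ^ r) (η := η)
    (by nlinarith [one_le_pow₀ (n := r) (by norm_num : (1 : ℝ) ≤ 9)]) hη
  refine ⟨r ^ (2 * r) + 2 * r * (4 ^ r * C), by positivity, 2 * r, ?_⟩
  intro q _ hcf χ hχ h θ hθ hh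
  have hq : q ≠ 0 := NeZero.ne q
  have hq1 : (1 : ℝ) ≤ q := by exact_mod_cast Nat.pos_of_ne_zero hq
  have hh0 : (0 : ℝ) < h := lt_of_lt_of_le (by positivity) hh
  have hsq : Real.sqrt q ≤ (h : ℝ) ^ r := by
    calc Real.sqrt q = (q : ℝ) ^ (1 / 2 : ℝ) := Real.sqrt_eq_rpow _
      _ ≤ (q : ℝ) ^ (η' * r) := Real.rpow_le_rpow_of_exponent_le hq1 hr2
      _ = ((q : ℝ) ^ η') ^ r := by rw [Real.rpow_mul (by positivity), Real.rpow_natCast]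
      _ ≤ _ := pow_le_pow_left₀ (by positivity) hh r
  have hτ : (q.divisors.card : ℝ) ≤ 3 ^ q.primeFactors.card := by
    exact_mod_cast Nat.card_divisors_le_three_pow hq hcf
  have hone : (1 : ℝ) ≤ (q : ℝ) ^ η := Real.one_le_rpow hq1 hη.le
  have h1 : (q : ℝ) * (r ^ (2 * r) * h ^ r) ≤ r ^ (2 * r) * ((q : ℝ) ^ η * Real.sqrt q) * h ^ (2 * r) := by
    calc (q : ℝ) * (r ^ (2 * r) * h ^ r) = r ^ (2 * r) * (1 * Real.sqrt q) * (Real.sqrt q * h ^ r) := by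
            have := Real.mul_self_sqrt (show (0 : ℝ) ≤ q by positivity)
            linear_combination (-(r : ℝ) ^ (2 * r) * h ^ r) * this
      _ ≤ r ^ (2 * r) * ((q : ℝ) ^ η * Real.sqrt q) * (h ^ r * h ^ r) := by gcongr
      _ = _ := by rw [two_mul, pow_add _ r r]; ring
  have h2 : (2 * r) * ((2 * r : ℝ) ^ q.primeFactors.card * Real.sqrt q * (2 * h * q.divisors.card) ^ (2 * r)) ≤
      2 * r * (4 ^ r * C) * ((q : ℝ) ^ η * Real.sqrt q) * h ^ (2 * r) := by
    calc (2 * r) * ((2 * r : ℝ) ^ q.primeFactors.card * Real.sqrt q * (2 * h * q.divisors.card) ^ (2 * r))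
        ≤ (2 * r) * ((2 * r : ℝ) ^ q.primeFactors.card * Real.sqrt q * (2 * h * 3 ^ q.primeFactors.card) ^ (2 * r)) := by gcongr
      _ = 2 * r * 4 ^ r * Real.sqrt q * h ^ (2 * r) * (2 * r * 9 ^ r) ^ q.primeFactors.card := by
          rw [mul_pow, mul_pow, mul_pow, mul_pow (2 * r : ℝ) (9 ^ r) q.primeFactors.card, pow_mul (2 : ℝ) 2 r,
            ← pow_mul (3 : ℝ) , ← pow_mul (9 : ℝ), show (9 : ℝ) = 3 ^ 2 by norm_num, ← pow_mul (3 : ℝ)]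
          norm_num
          ring
      _ ≤ 2 * r * 4 ^ r * Real.sqrt q * h ^ (2 * r) * (C * (q : ℝ) ^ η) := by
          gcongr; exact hCq q (Nat.pos_of_ne_zero hq)
      _ = _ := by ring
  have h3 : ((largeSet χ h θ).card : ℝ) * (θ * h) ^ (2 * r) ≤ ∑ x, shortSum χ h x ^ (2 * r) := by
    calc ((largeSet χ h θ).card : ℝ) * (θ * h) ^ (2 * r) = ∑ x ∈ largeSet χ h θ, (θ * h) ^ (2 * r) := by
          rw [Finset.sum_const, nsmul_eq_mul]
      _ ≤ ∑ x ∈ largeSet χ h θ, shortSum χ h x ^ (2 * r) := by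
          refine Finset.sum_le_sum fun x hx => pow_le_pow_left₀ (by positivity) ?_ _
          simpa [largeSet] using hx
      _ ≤ _ := Finset.sum_le_univ_sum_of_nonneg fun x => pow_nonneg (shortSum_nonneg χ h x) _
  have h4 := (h3.trans (sum_shortSum_pow_le hcf hχ hr0 h)).trans (add_le_add h1 h2)
  rw [Real.rpow_add (by positivity), ← Real.sqrt_eq_rpow]
  refine le_of_mul_le_mul_right (a := (h : ℝ) ^ (2 * r)) ?_ (by positivity)
  calc _ = ((largeSet χ h θ).card : ℝ) * (θ * h) ^ (2 * r) := by rw [mul_pow]; ring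
    _ ≤ _ := h4
    _ = _ := by ring

/-- A bipartite multigraph with many edges contains a nonempty submultigraph with large minimal degrees. -/
theorem exists_subset_min_degree {α β γ : Type*} [DecidableEq α] [DecidableEq β] [DecidableEq γ] (f : γ → α) (g : γ → β)
    (m d : ℕ) (E : Finset γ) (hE : m * (E.image f).card + d * (E.image g).card < E.card) :
    ∃ E' ⊆ E, E'.Nonempty ∧ (∀ e ∈ E', m ≤ Finset.card {e' ∈ E' | f e' = f e}) ∧
      ∀ e ∈ E', d ≤ Finset.card {e' ∈ E' | g e' = g e} := by
  induction E using Finset.strongInduction with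
  | H E ih =>
    by_cases h1 : ∃ e ∈ E, Finset.card {e' ∈ E | f e' = f e} < m
    · obtain ⟨e, he, hlt⟩ := h1
      have hss : {e' ∈ E | ¬ f e' = f e} ⊂ E := Finset.filter_ssubset.mpr ⟨e, he, by simp⟩
      have hc := Finset.card_filter_add_card_filter_not (s := E) (fun e' => f e' = f e)
      have hf : ({e' ∈ E | ¬ f e' = f e}.image f).card + 1 ≤ (E.image f).card := by
        refine Finset.card_lt_card ((Finset.ssubset_iff_of_subset (Finset.image_subset_image hss.1)).mpr
          ⟨f e, Finset.mem_image_of_mem _ he, ?_⟩)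
        simp
      have hg : ({e' ∈ E | ¬ f e' = f e}.image g).card ≤ (E.image g).card :=
        Finset.card_le_card (Finset.image_subset_image hss.1)
      obtain ⟨E', hE', h⟩ := ih _ hss (by
        have h2 := Nat.mul_le_mul_left m hf
        have h3 := Nat.mul_le_mul_left d hg
        rw [mul_add, mul_one] at h2
        omega)
      exact ⟨E', hE'.trans hss.1, h⟩
    by_cases h2 : ∃ e ∈ E, Finset.card {e' ∈ E | g e' = g e} < d
    · obtain ⟨e, he, hlt⟩ := h2
      have hss : {e' ∈ E | ¬ g e' = g e} ⊂ E := Finset.filter_ssubset.mpr ⟨e, he, by simp⟩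
      have hc := Finset.card_filter_add_card_filter_not (s := E) (fun e' => g e' = g e)
      have hf : ({e' ∈ E | ¬ g e' = g e}.image g).card + 1 ≤ (E.image g).card := by
        refine Finset.card_lt_card ((Finset.ssubset_iff_of_subset (Finset.image_subset_image hss.1)).mpr
          ⟨g e, Finset.mem_image_of_mem _ he, ?_⟩)
        simp
      have hg : ({e' ∈ E | ¬ g e' = g e}.image f).card ≤ (E.image f).card :=
        Finset.card_le_card (Finset.image_subset_image hss.1)
      obtain ⟨E', hE', h⟩ := ih _ hss (by
        have h2 := Nat.mul_le_mul_left d hf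
        have h3 := Nat.mul_le_mul_left m hg
        rw [mul_add, mul_one] at h2
        omega)
      exact ⟨E', hE'.trans hss.1, h⟩
    push Not at h1 h2
    exact ⟨E, subset_rfl, Finset.card_pos.mp (by omega), h1, h2⟩

section
variable {q : ℕ}

theorem exists_reduced_fractions {k y : ℕ} {E : Finset (ZMod q × ℕ)} (hE : ∀ e ∈ E, e.2.Prime ∧ ¬ e.2 ∣ q ∧ e.2 ≤ y)
    {w₀ : ZMod q} (hw₀ : w₀ ∈ E.image Prod.fst) {d m : ℕ} (hd : ∀ e ∈ E, d + k ≤ Finset.card {e' ∈ E | e'.1 = e.1})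
    (hm : ∀ e ∈ E, m + k ≤ Finset.card {e' ∈ E | (e'.2 : ZMod q) * e'.1 = e.2 * e.1}) (j : ℕ) (hj : j ≤ k) :
    ∃ F : Finset (ℕ × ℕ), (∀ x ∈ F, Nat.Coprime x.1 x.2 ∧ 0 < x.1 ∧ 0 < x.2 ∧ x.1 ≤ y ^ j ∧ x.2 ≤ y ^ j ∧
      x.1.primeFactors.card ≤ j ∧ x.2.primeFactors.card ≤ j ∧
      ∃ w ∈ E.image Prod.fst, (x.2 : ZMod q) * w = x.1 * w₀) ∧ (d * m) ^ j ≤ k ^ (2 * j) * F.card := by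
  classical
  induction j with
  | zero =>
    refine ⟨{(1, 1)}, ?_, by simp⟩
    intro x hx
    rw [Finset.mem_singleton] at hx
    subst hx
    simp only [Nat.coprime_one_right_eq_true, Nat.primeFactors_one, Finset.card_empty, Nat.cast_one, one_mul, pow_zero]
    exact ⟨trivial, by simp, by simp, le_rfl, le_rfl, le_rfl, le_rfl, w₀, hw₀, rfl⟩
  | succ j ih =>
    obtain ⟨F, hF, hFc⟩ := ih (by omega)
    have hext : ∀ x ∈ F, ∃ S : Finset (Σ _ : ℕ, ℕ), d * m ≤ S.card ∧ ∀ p ∈ S, p.1.Prime ∧ p.2.Prime ∧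
        p.1 ≤ y ∧ p.2 ≤ y ∧ ¬ p.1 ∣ x.2 ∧ ¬ p.2 ∣ x.1 * p.1 ∧
        ∃ w ∈ E.image Prod.fst, ((x.2 * p.2 : ℕ) : ZMod q) * w = ((x.1 * p.1 : ℕ) : ZMod q) * w₀ := by
      intro x hx
      obtain ⟨-, hx1, hx2, -, -, hc1, hc2, w, hw, hxw⟩ := hF x hx
      obtain ⟨e₀, he₀, rfl⟩ := Finset.mem_image.mp hw
      let A : Finset ℕ := ({e' ∈ E | e'.1 = e₀.1}.image Prod.snd) \ x.2.primeFactors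
      let B : ℕ → Finset ℕ := fun p => ({e' ∈ E | (e'.2 : ZMod q) * e'.1 = p * e₀.1}.image Prod.snd) \ (x.1 * p).primeFactors
      have hAmem : ∀ p ∈ A, (e₀.1, p) ∈ E ∧ ¬ p ∣ x.2 := by
        intro p hp
        simp only [A, Finset.mem_sdiff, Finset.mem_image, Finset.mem_filter] at hp
        obtain ⟨⟨⟨w, p'⟩, ⟨he1, he2⟩, rfl⟩, hp2⟩ := hp
        simp only at he2 hp2 ⊢
        subst he2
        refine ⟨he1, fun h => hp2 ?_⟩
        rw [Nat.mem_primeFactors]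
        exact ⟨(hE _ he1).1, h, hx2.ne'⟩
      have hA : d ≤ A.card := by
        have h1 : d + k ≤ ({e' ∈ E | e'.1 = e₀.1}.image Prod.snd).card := by
          rw [Finset.card_image_of_injOn]
          · exact hd e₀ he₀
          · intro e he e' he' hee'
            simp only [Finset.coe_filter, Set.mem_ofPred_eq] at he he'
            exact Prod.ext (he.2.trans he'.2.symm) hee'
        have h2 := Finset.le_card_sdiff x.2.primeFactors ({e' ∈ E | e'.1 = e₀.1}.image Prod.snd)
        simp only [A]
        omega
      have hB : ∀ p ∈ A, m ≤ (B p).card := by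
        intro p hp
        have hpE := (hAmem p hp).1
        have h1 : m + k ≤ ({e' ∈ E | (e'.2 : ZMod q) * e'.1 = p * e₀.1}.image Prod.snd).card := by
          rw [Finset.card_image_of_injOn]
          · exact hm _ hpE
          · intro e he e' he' hee'
            simp only [Finset.coe_filter, Set.mem_ofPred_eq] at he he'
            obtain ⟨hpr, hpq, -⟩ := hE e he.1
            have hu : IsUnit (e.2 : ZMod q) := (ZMod.isUnit_prime_iff_not_dvd hpr).mpr hpq
            refine Prod.ext ?_ hee'
            apply hu.mul_left_cancel
            rw [he.2, ← he'.2, hee']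
        have h2 := Finset.le_card_sdiff (x.1 * p).primeFactors ({e' ∈ E | (e'.2 : ZMod q) * e'.1 = p * e₀.1}.image Prod.snd)
        have h3 : (x.1 * p).primeFactors.card ≤ j + 1 := by
          rw [Nat.primeFactors_mul hx1.ne' (hE _ hpE).1.ne_zero, (hE _ hpE).1.primeFactors]
          exact (Finset.card_union_le _ _).trans (by simpa using hc1)
        simp only [B]
        omega
      refine ⟨A.sigma B, ?_, ?_⟩
      · rw [Finset.card_sigma]
        calc d * m ≤ A.card * m := Nat.mul_le_mul_right _ hA
          _ = ∑ p ∈ A, m := by rw [Finset.sum_const, smul_eq_mul]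
          _ ≤ _ := Finset.sum_le_sum hB
      · rintro ⟨p, p'⟩ hp
        rw [Finset.mem_sigma] at hp
        obtain ⟨hpA, hpB⟩ := hp
        obtain ⟨hpE, hpx⟩ := hAmem p hpA
        simp only [B, Finset.mem_sdiff, Finset.mem_image, Finset.mem_filter] at hpB
        obtain ⟨⟨⟨w', p''⟩, ⟨he1, he2⟩, h3⟩, hp2⟩ := hpB
        simp only at he2 hp2 h3
        subst h3
        refine ⟨(hE _ hpE).1, (hE _ he1).1, (hE _ hpE).2.2, (hE _ he1).2.2, hpx, fun h => hp2 ?_, w',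
          Finset.mem_image.mpr ⟨_, he1, rfl⟩, ?_⟩
        · rw [Nat.mem_primeFactors]
          exact ⟨(hE _ he1).1, h, mul_ne_zero hx1.ne' (hE _ hpE).1.ne_zero⟩
        · push_cast
          rw [mul_assoc, he2]
          linear_combination (p : ZMod q) * hxw
    choose! S hS hS2 using hext
    let φ : (Σ _ : ℕ × ℕ, Σ _ : ℕ, ℕ) → ℕ × ℕ := fun t => (t.1.1 * t.2.1, t.1.2 * t.2.2)
    have hT : ∀ t ∈ F.sigma S, (t.1.1 * t.2.1).primeFactors.card ≤ j + 1 ∧ (t.1.2 * t.2.2).primeFactors.card ≤ j + 1 := by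
      rintro ⟨x, p⟩ ht
      rw [Finset.mem_sigma] at ht
      obtain ⟨hx, hp⟩ := ht
      obtain ⟨hp1, hp2, -⟩ := hS2 x hx p hp
      obtain ⟨-, hx1, hx2, -, -, hc1, hc2, -⟩ := hF x hx
      simp only
      rw [Nat.primeFactors_mul hx1.ne' hp1.ne_zero, Nat.primeFactors_mul hx2.ne' hp2.ne_zero, hp1.primeFactors, hp2.primeFactors]
      exact ⟨(Finset.card_union_le _ _).trans (by simpa using hc1), (Finset.card_union_le _ _).trans (by simpa using hc2)⟩
    refine ⟨(F.sigma S).image φ, ?_, ?_⟩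
    · intro z hz
      obtain ⟨⟨x, p⟩, ht, rfl⟩ := Finset.mem_image.mp hz
      obtain ⟨hx, hp⟩ := Finset.mem_sigma.mp ht
      obtain ⟨hp1, hp2, hp3, hp4, hp5, hp6, hw⟩ := hS2 x hx p hp
      obtain ⟨hcop, hx1, hx2, hb1, hb2, -⟩ := hF x hx
      refine ⟨?_, Nat.mul_pos hx1 hp1.pos, Nat.mul_pos hx2 hp2.pos, ?_, ?_, (hT _ ht).1, (hT _ ht).2, hw⟩
      · simp only [φ]
        rw [Nat.coprime_mul_iff_right]
        refine ⟨Nat.Coprime.mul_left hcop ((Nat.Prime.coprime_iff_not_dvd hp1).mpr hp5), ?_⟩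
        exact ((Nat.Prime.coprime_iff_not_dvd hp2).mpr hp6).symm
      · rw [pow_succ]; exact Nat.mul_le_mul hb1 hp3
      · rw [pow_succ]; exact Nat.mul_le_mul hb2 hp4
    · have h1 : (F.sigma S).card ≤ k ^ 2 * ((F.sigma S).image φ).card := by
        refine Finset.card_le_mul_card_image _ _ fun z hz => ?_
        obtain ⟨t₀, ht₀, rfl⟩ := Finset.mem_image.mp hz
        calc _ ≤ ((φ t₀).1.primeFactors ×ˢ (φ t₀).2.primeFactors).card := by
              refine Finset.card_le_card_of_injOn (fun t => (t.2.1, t.2.2)) ?_ ?_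
              · rintro ⟨x, p⟩ ht
                simp only [Finset.coe_filter, Set.mem_ofPred_eq] at ht
                obtain ⟨hx, hp⟩ := Finset.mem_sigma.mp ht.1
                obtain ⟨hp1, hp2, -⟩ := hS2 x hx p hp
                obtain ⟨-, hx1, hx2, -⟩ := hF x hx
                rw [← ht.2]
                simp only [φ, Finset.coe_product, Set.mem_prod, Finset.mem_coe, Nat.mem_primeFactors]
                exact ⟨⟨hp1, dvd_mul_left _ _, mul_ne_zero hx1.ne' hp1.ne_zero⟩,
                  ⟨hp2, dvd_mul_left _ _, mul_ne_zero hx2.ne' hp2.ne_zero⟩⟩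
              · rintro ⟨⟨x1, x2⟩, ⟨p1, p2⟩⟩ ht ⟨⟨x1', x2'⟩, ⟨p1', p2'⟩⟩ ht' heq
                simp only [Finset.coe_filter, Set.mem_ofPred_eq] at ht ht'
                obtain ⟨hx, hp⟩ := Finset.mem_sigma.mp ht.1
                obtain ⟨hp1, hp2, -⟩ := hS2 _ hx _ hp
                have h3 := ht.2.trans ht'.2.symm
                simp only [Prod.mk.injEq, φ] at heq h3
                obtain ⟨rfl, rfl⟩ := heq
                have h4 := Nat.eq_of_mul_eq_mul_right hp1.pos h3.1
                have h5 := Nat.eq_of_mul_eq_mul_right hp2.pos h3.2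
                subst h4 h5
                rfl
          _ ≤ (j + 1) * (j + 1) := by
              rw [Finset.card_product]
              exact Nat.mul_le_mul (hT t₀ ht₀).1 (hT t₀ ht₀).2
          _ ≤ k ^ 2 := by rw [pow_two]; exact Nat.mul_le_mul hj hj
      have h2 : F.card * (d * m) ≤ (F.sigma S).card := by
        rw [Finset.card_sigma, ← smul_eq_mul, ← Finset.sum_const]
        exact Finset.sum_le_sum hS
      calc (d * m) ^ (j + 1) = (d * m) ^ j * (d * m) := pow_succ _ _
        _ ≤ k ^ (2 * j) * F.card * (d * m) := Nat.mul_le_mul_right _ hFc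
        _ = k ^ (2 * j) * (F.card * (d * m)) := by ring
        _ ≤ k ^ (2 * j) * (k ^ 2 * ((F.sigma S).image φ).card) := Nat.mul_le_mul_left _ (h2.trans h1)
        _ = _ := by ring

theorem pow_le_card_image_fst {k y : ℕ} {E : Finset (ZMod q × ℕ)} (hE : ∀ e ∈ E, e.2.Prime ∧ ¬ e.2 ∣ q ∧ e.2 ≤ y)
    {w₀ : ZMod q} (hw₀ : w₀ ∈ E.image Prod.fst) (hgood : ∀ c : ℕ, 0 < c → c ≤ y ^ (2 * k) → (c : ZMod q) * w₀ ≠ 0)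
    {d m : ℕ} (hd : ∀ e ∈ E, d + k ≤ Finset.card {e' ∈ E | e'.1 = e.1})
    (hm : ∀ e ∈ E, m + k ≤ Finset.card {e' ∈ E | (e'.2 : ZMod q) * e'.1 = e.2 * e.1}) :
    (d * m) ^ k ≤ k ^ (2 * k) * (E.image Prod.fst).card := by
  obtain ⟨F, hF, hFc⟩ := exists_reduced_fractions hE hw₀ hd hm k le_rfl
  refine hFc.trans (Nat.mul_le_mul_left _ ?_)
  have h1 : ∀ x ∈ F, ∃ w ∈ E.image Prod.fst, (x.2 : ZMod q) * w = x.1 * w₀ := fun x hx => (hF x hx).2.2.2.2.2.2.2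
  choose! ψ hψ1 hψ2 using h1
  refine Finset.card_le_card_of_injOn ψ hψ1 ?_
  intro x hx z hz hxz
  obtain ⟨hxc, hx1, hx2, hx3, hx4, -⟩ := hF x hx
  obtain ⟨hzc, hz1, hz2, hz3, hz4, -⟩ := hF z hz
  have h2 : ((x.1 * z.2 : ℕ) : ZMod q) * w₀ = ((z.1 * x.2 : ℕ) : ZMod q) * w₀ := by
    have e1 := hψ2 x hx
    have e2 := hψ2 z hz
    rw [hxz] at e1
    push_cast
    linear_combination (x.2 : ZMod q) * e2 - (z.2 : ZMod q) * e1
  have hbound : ∀ a b : ℕ, a ≤ y ^ k → b ≤ y ^ k → a * b ≤ y ^ (2 * k) := fun a b ha hb => by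
    rw [two_mul, pow_add]; exact Nat.mul_le_mul ha hb
  have h3 : x.1 * z.2 = z.1 * x.2 := by
    by_contra hne
    rcases lt_or_gt_of_ne hne with h | h
    · refine hgood (z.1 * x.2 - x.1 * z.2) (by omega) ((Nat.sub_le _ _).trans (hbound _ _ hz3 hx4)) ?_
      rw [Nat.cast_sub h.le, sub_mul, h2, sub_self]
    · refine hgood (x.1 * z.2 - z.1 * x.2) (by omega) ((Nat.sub_le _ _).trans (hbound _ _ hx3 hz4)) ?_
      rw [Nat.cast_sub h.le, sub_mul, h2, sub_self]
  have h4 : x.1 = z.1 := by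
    apply Nat.dvd_antisymm
    · exact hxc.dvd_of_dvd_mul_right (h3 ▸ dvd_mul_right _ _)
    · exact hzc.dvd_of_dvd_mul_right (h3 ▸ dvd_mul_right _ _)
  have h5 : x.2 = z.2 := by
    rw [h4] at h3
    exact (Nat.eq_of_mul_eq_mul_left hz1 h3).symm
  exact Prod.ext h4 h5

end

section
variable {q : ℕ}

theorem exists_separated_subset {h : ℕ} (hh : 0 < h) (X : Finset (ZMod q)) :
    ∃ N ⊆ X, X.card ≤ 2 * h * N.card ∧
      ∀ n ∈ N, ∀ n' ∈ N, ∀ b < h, ∀ b' < h, n + (b : ZMod q) = n' + b' → n = n' := by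
  classical
  induction X using Finset.strongInduction with
  | H X ih =>
    rcases X.eq_empty_or_nonempty with rfl | ⟨x, hx⟩
    · exact ⟨∅, subset_rfl, by simp, by simp⟩
    · let B : Finset (ZMod q) := (Finset.range h).image (fun b : ℕ => x + (b : ZMod q)) ∪
        (Finset.range h).image (fun b : ℕ => x - (b : ZMod q))
      have hxB : x ∈ B := Finset.mem_union_left _ (Finset.mem_image.mpr ⟨0, Finset.mem_range.mpr hh, by simp⟩)
      have hBc : B.card ≤ 2 * h := by
        refine (Finset.card_union_le _ _).trans ?_
        have h1 := Finset.card_image_le (s := Finset.range h) (f := fun b : ℕ => x + (b : ZMod q))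
        have h2 := Finset.card_image_le (s := Finset.range h) (f := fun b : ℕ => x - (b : ZMod q))
        rw [Finset.card_range] at h1 h2
        omega
      have hss : X \ B ⊂ X := by
        refine (Finset.ssubset_iff_of_subset Finset.sdiff_subset).mpr ⟨x, hx, ?_⟩
        simp [hxB]
      obtain ⟨N, hN, hN1, hN2⟩ := ih _ hss
      have hxN : x ∉ N := fun h => (Finset.mem_sdiff.mp (hN h)).2 hxB
      have hsep : ∀ n ∈ N, ∀ b < h, ∀ b' < h, n + (b : ZMod q) ≠ x + b' := by
        intro n hn b hb b' hb' heq
        refine (Finset.mem_sdiff.mp (hN hn)).2 ?_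
        rcases le_total b b' with hle | hle
        · refine Finset.mem_union_left _ (Finset.mem_image.mpr ⟨b' - b, Finset.mem_range.mpr (by omega), ?_⟩)
          rw [Nat.cast_sub hle]
          linear_combination -heq
        · refine Finset.mem_union_right _ (Finset.mem_image.mpr ⟨b - b', Finset.mem_range.mpr (by omega), ?_⟩)
          rw [Nat.cast_sub hle]
          linear_combination -heq
      refine ⟨insert x N, Finset.insert_subset hx (hN.trans hss.1), ?_, ?_⟩
      · rw [Finset.card_insert_of_notMem hxN, mul_add, mul_one]
        have h1 := Finset.le_card_sdiff B X
        omega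
      · intro n hn n' hn' b hb b' hb' heq
        rw [Finset.mem_insert] at hn hn'
        rcases hn with rfl | hn <;> rcases hn' with rfl | hn'
        · rfl
        · exact (hsep n' hn' b' hb' b hb heq.symm).elim
        · exact (hsep n hn b hb b' hb' heq).elim
        · exact hN2 n hn n' hn' b hb b' hb' heq

theorem shortSum_mul_le [NeZero q] (χ : MulChar (ZMod q) ℂ) (h l : ℕ) (x : ZMod q) {p : ℕ} (hp : IsUnit (p : ZMod q)) :
    shortSum χ h x * l ≤ ∑ b ∈ Finset.range h, shortSum χ l ((x + b) * (p : ZMod q)⁻¹) + 2 * p * l ^ 2 := by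
  let f : ℕ → ℂ := fun b => χ (x + b)
  have hf : ∀ b, ‖f b‖ ≤ 1 := fun b => norm_mulChar_apply_le_one _ _
  have hbd : ∀ (g : ℕ → ℂ) (a : ℕ), (∀ b, ‖g b‖ ≤ 1) → ‖∑ b ∈ Finset.range a, g b‖ ≤ a := by
    intro g a hg
    refine (norm_sum_le _ _).trans ((Finset.sum_le_sum fun b _ => hg b).trans ?_)
    simp
  let S : ℕ → ℂ := fun a => ∑ b ∈ Finset.range h, f (a + b)
  have hS : ∀ a, ‖S 0 - S a‖ ≤ 2 * a := by
    intro a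
    have h1 := Finset.sum_range_add f a h
    have h2 := Finset.sum_range_add f h a
    rw [add_comm h a] at h2
    have h3 : S 0 - S a = ∑ b ∈ Finset.range a, f b - ∑ b ∈ Finset.range a, f (h + b) := by
      simp only [S, zero_add]
      linear_combination h1 - h2
    rw [h3]
    refine (norm_sub_le _ _).trans ?_
    linarith [hbd f a hf, hbd (fun b => f (h + b)) a fun b => hf _]
  have h4 : S 0 * l = ∑ j ∈ Finset.range l, S (p * j) + ∑ j ∈ Finset.range l, (S 0 - S (p * j)) := by
    rw [← Finset.sum_add_distrib]; simp [mul_comm]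
  have h5 : ‖∑ j ∈ Finset.range l, (S 0 - S (p * j))‖ ≤ 2 * p * l ^ 2 := by
    refine (norm_sum_le _ _).trans ((Finset.sum_le_sum (g := fun _ => 2 * (p : ℝ) * l) fun j hj => ?_).trans ?_)
    · refine (hS _).trans ?_
      have : (j : ℝ) ≤ l := by exact_mod_cast (Finset.mem_range.mp hj).le
      push_cast
      rw [mul_assoc]
      gcongr
    · rw [Finset.sum_const, Finset.card_range, nsmul_eq_mul]
      exact le_of_eq (by ring)
  have h6 : ‖∑ j ∈ Finset.range l, S (p * j)‖ ≤ ∑ b ∈ Finset.range h, shortSum χ l ((x + b) * (p : ZMod q)⁻¹) := by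
    rw [Finset.sum_comm]
    refine (norm_sum_le _ _).trans (Finset.sum_le_sum fun b _ => ?_)
    have h7 : ∑ j ∈ Finset.range l, f (p * j + b) = χ p * ∑ j ∈ Finset.range l, χ ((x + b) * (p : ZMod q)⁻¹ + j) := by
      rw [Finset.mul_sum]
      refine Finset.sum_congr rfl fun j _ => ?_
      rw [← map_mul]
      simp only [f]
      congr 1
      push_cast
      have := ZMod.mul_inv_of_unit _ hp
      linear_combination (-(x + b)) * this
    rw [h7, norm_mul]
    exact mul_le_of_le_one_left (norm_nonneg _) (norm_mulChar_apply_le_one _ _)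
  have h8 : shortSum χ h x * l = ‖S 0 * l‖ := by
    rw [norm_mul]; simp [shortSum, S, f]
  rw [h8, h4]
  exact (norm_add_le _ _).trans (add_le_add h6 h5)

theorem card_dilated_largeSet_ge [NeZero q] {χ : MulChar (ZMod q) ℂ} {h l : ℕ} {θ : ℝ} {x : ZMod q}
    (hx : x ∈ largeSet χ h θ) (hl : 0 < l) {p : ℕ} (hp : IsUnit (p : ZMod q)) (hθ : 0 < θ) (hpl : 8 * p * l ≤ θ * h) :
    θ * h / 2 ≤ Finset.card ((Finset.range h).filter fun b : ℕ => (x + (b : ZMod q)) * (p : ZMod q)⁻¹ ∈ largeSet χ l (θ / 4)) := by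
  have h1 := shortSum_mul_le χ h l x hp
  have h2 : θ * h ≤ shortSum χ h x := by simpa [largeSet] using hx
  have hl' : (0 : ℝ) < l := by exact_mod_cast hl
  have h3 : ∑ b ∈ Finset.range h, shortSum χ l ((x + b) * (p : ZMod q)⁻¹) ≤
      (Finset.card ((Finset.range h).filter fun b : ℕ => (x + (b : ZMod q)) * (p : ZMod q)⁻¹ ∈ largeSet χ l (θ / 4))) * l + h * (θ / 4 * l) := by
    calc _ ≤ ∑ b ∈ Finset.range h, ((if (x + (b : ZMod q)) * (p : ZMod q)⁻¹ ∈ largeSet χ l (θ / 4) then (l : ℝ) else 0) + θ / 4 * l) := by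
          refine Finset.sum_le_sum fun b _ => ?_
          split_ifs with hb
          · have := shortSum_le χ l ((x + b) * (p : ZMod q)⁻¹)
            have : 0 ≤ θ / 4 * l := by positivity
            linarith
          · simp only [largeSet, Finset.mem_filter, Finset.mem_univ, true_and, not_le] at hb
            linarith
      _ = _ := by
          rw [Finset.sum_add_distrib, ← Finset.sum_filter, Finset.sum_const, Finset.sum_const, Finset.card_range, nsmul_eq_mul, nsmul_eq_mul]
  refine le_of_mul_le_mul_right ?_ hl'
  have h4 : θ * h * l ≤ shortSum χ h x * l := by gcongr
  have h5 : 8 * p * l * l ≤ θ * h * (l : ℝ) := by gcongr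
  nlinarith

theorem card_dvd_le (n h d : ℕ) : (Finset.card {b ∈ Finset.range h | d ∣ n + b} : ℝ) ≤ h / d + 1 := by
  have h1 : Finset.card {b ∈ Finset.range h | d ∣ n + b} ≤ h / d + 1 := by
    have h2 : Finset.card {b ∈ Finset.range h | d ∣ n + b} ≤ (Finset.range (h / d + 1)).card := by
      refine Finset.card_le_card_of_injOn (fun b => b / d) ?_ ?_
      · intro b hb
        simp only [Finset.coe_filter, Finset.mem_range, Set.mem_ofPred_eq] at hb
        simp only [Finset.coe_range, Set.mem_Iio]
        exact Nat.lt_succ_of_le (Nat.div_le_div_right hb.1.le)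
      · intro b hb b' hb' heq
        simp only [Finset.coe_filter, Finset.mem_range, Set.mem_ofPred_eq] at hb hb' heq
        have h3 : n + b ≡ n + b' [MOD d] := by
          rw [Nat.ModEq, Nat.mod_eq_zero_of_dvd hb.2, Nat.mod_eq_zero_of_dvd hb'.2]
        have h4 : b % d = b' % d := Nat.ModEq.add_left_cancel' n h3
        rw [← Nat.div_add_mod b d, ← Nat.div_add_mod b' d, heq, h4]
    simpa using h2
  calc _ ≤ ((h / d + 1 : ℕ) : ℝ) := by exact_mod_cast h1
    _ ≤ _ := by push_cast; gcongr; exact Nat.cast_div_le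

open scoped Classical in
theorem card_small_annihilator_le [NeZero q] (x : ZMod q) (h Y : ℕ) :
    (Finset.card ((Finset.range h).filter fun b : ℕ => ¬ ∀ c : ℕ, 0 < c → c ≤ Y → (c : ZMod q) * (x + b) ≠ 0) : ℝ) ≤
      q.divisors.card * (h * Y / q + 1) := by
  have hq : q ≠ 0 := NeZero.ne q
  have hq' : (0 : ℝ) < q := by exact_mod_cast Nat.pos_of_ne_zero hq
  calc (Finset.card ((Finset.range h).filter fun b : ℕ => ¬ ∀ c : ℕ, 0 < c → c ≤ Y → (c : ZMod q) * (x + b) ≠ 0) : ℝ)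
      ≤ (Finset.card (({d ∈ q.divisors | q ≤ d * Y} : Finset ℕ).biUnion fun d => {b ∈ Finset.range h | d ∣ x.val + b}) : ℝ) := by
        refine Nat.cast_le.mpr (Finset.card_le_card ?_)
        intro b hb
        simp only [Finset.mem_filter] at hb
        obtain ⟨hb1, hb2⟩ := hb
        push Not at hb2
        obtain ⟨c, hc0, hcY, hc⟩ := hb2
        have h1 : q ∣ c * (x.val + b) := by
          rw [← ZMod.natCast_eq_zero_iff]
          push_cast
          rwa [ZMod.natCast_zmod_val]
        have h2 : q / Nat.gcd q c ∣ x.val + b := by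
          have hg : 0 < Nat.gcd q c := Nat.gcd_pos_of_pos_left _ (Nat.pos_of_ne_zero hq)
          have hcop := Nat.coprime_div_gcd_div_gcd hg
          refine hcop.dvd_of_dvd_mul_left ?_
          rw [← Nat.mul_dvd_mul_iff_left hg, ← mul_assoc, Nat.mul_div_cancel' (Nat.gcd_dvd_left q c),
            Nat.mul_div_cancel' (Nat.gcd_dvd_right q c)]
          exact h1
        simp only [Finset.mem_biUnion, Finset.mem_filter, Nat.mem_divisors]
        refine ⟨q / Nat.gcd q c, ⟨⟨Nat.div_dvd_of_dvd (Nat.gcd_dvd_left q c), hq⟩, ?_⟩, hb1, h2⟩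
        calc q = q / Nat.gcd q c * Nat.gcd q c := (Nat.div_mul_cancel (Nat.gcd_dvd_left q c)).symm
          _ ≤ _ := Nat.mul_le_mul_left _ ((Nat.le_of_dvd hc0 (Nat.gcd_dvd_right q c)).trans hcY)
    _ ≤ ∑ d ∈ q.divisors with q ≤ d * Y, (Finset.card {b ∈ Finset.range h | d ∣ x.val + b} : ℝ) := by
        exact_mod_cast Finset.card_biUnion_le
    _ ≤ ∑ d ∈ q.divisors with q ≤ d * Y, ((h : ℝ) * Y / q + 1) := by
        refine Finset.sum_le_sum fun d hd => ?_
        obtain ⟨hd1, hd2⟩ := Finset.mem_filter.mp hd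
        have hd0 : 0 < d := Nat.pos_of_mem_divisors hd1
        have hd0' : (0 : ℝ) < d := by exact_mod_cast hd0
        refine (card_dvd_le _ h d).trans ?_
        have h3 : (q : ℝ) ≤ d * Y := by exact_mod_cast hd2
        gcongr ?_ + 1
        rw [div_le_div_iff₀ hd0' hq']
        nlinarith [(Nat.cast_nonneg h : (0 : ℝ) ≤ h)]
    _ ≤ ∑ d ∈ q.divisors, ((h : ℝ) * Y / q + 1) :=
        Finset.sum_le_sum_of_subset_of_nonneg (Finset.filter_subset _ _) fun _ _ _ => by positivity
    _ = _ := by rw [Finset.sum_const, nsmul_eq_mul]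

end

set_option maxHeartbeats 1000000 in
theorem pow_le_card_largeSet {q : ℕ} [NeZero q] {χ : MulChar (ZMod q) ℂ} {h l k y m d : ℕ} {θ : ℝ} (hθ : 0 < θ)
    {P : Finset ℕ} (hP : ∀ p ∈ P, p.Prime ∧ ¬ p ∣ q ∧ p ≤ y) (hl : 0 < l) (hk : 0 < k) (hhq : h ≤ q)
    (hyl : 8 * y * l ≤ θ * h) (hbad : q.divisors.card * ((h : ℝ) * (y ^ (2 * k) : ℕ) / q + 1) ≤ θ * h / 4)
    (hX : (largeSet χ h θ).Nonempty) (hm : (m + k : ℝ) ≤ P.card * θ / 16)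
    (hd : (d + k : ℝ) * (largeSet χ l (θ / 4)).card ≤ (largeSet χ h θ).card * P.card * θ / 32) :
    (d * m) ^ k ≤ k ^ (2 * k) * (largeSet χ l (θ / 4)).card := by
  classical
  have hk' : (0 : ℝ) < k := by exact_mod_cast hk
  have hPc : (0 : ℝ) < P.card := by
    by_contra hcon
    have h0 : (P.card : ℝ) = 0 := le_antisymm (not_lt.mp hcon) (by positivity)
    rw [h0] at hm
    have : (0 : ℝ) ≤ m := by positivity
    linarith
  obtain ⟨p₀, hp₀⟩ := Finset.card_pos.mp (by exact_mod_cast hPc : 0 < P.card)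
  have hl' : (0 : ℝ) < l := by exact_mod_cast hl
  have hh' : (0 : ℝ) < h := by
    have hy : 0 < y := (hP p₀ hp₀).1.pos.trans_le (hP p₀ hp₀).2.2
    have hy' : (0 : ℝ) < y := by exact_mod_cast hy
    have : 0 < θ * h := lt_of_lt_of_le (by positivity) hyl
    exact (pos_iff_pos_of_mul_pos this).mp hθ
  have hh : 0 < h := by exact_mod_cast hh'
  obtain ⟨N, hNX, hNc, hNsep⟩ := exists_separated_subset hh (largeSet χ h θ)
  set X := largeSet χ h θ
  set W := largeSet χ l (θ / 4)
  let good : ZMod q → Prop := fun v => ∀ c : ℕ, 0 < c → c ≤ y ^ (2 * k) → (c : ZMod q) * v ≠ 0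
  let T : Finset (Σ _ : ZMod q × ℕ, ℕ) := (N ×ˢ P).sigma fun z => (Finset.range h).filter fun b : ℕ =>
    (z.1 + (b : ZMod q)) * (z.2 : ZMod q)⁻¹ ∈ W ∧ good (z.1 + b)
  let φ : (Σ _ : ZMod q × ℕ, ℕ) → ZMod q × ℕ := fun t => ((t.1.1 + (t.2 : ZMod q)) * (t.1.2 : ZMod q)⁻¹, t.1.2)
  have hunit : ∀ p ∈ P, IsUnit (p : ZMod q) := fun p hp => (ZMod.isUnit_prime_iff_not_dvd (hP p hp).1).mpr (hP p hp).2.1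
  have hTmem : ∀ t ∈ T, t.1.1 ∈ N ∧ t.1.2 ∈ P ∧ t.2 < h ∧ (t.1.1 + (t.2 : ZMod q)) * (t.1.2 : ZMod q)⁻¹ ∈ W ∧
      good (t.1.1 + t.2) := by
    intro t ht
    simp only [T, Finset.mem_sigma, Finset.mem_product, Finset.mem_filter, Finset.mem_range] at ht
    tauto
  have hTφ : ∀ t ∈ T, ((φ t).2 : ZMod q) * (φ t).1 = t.1.1 + t.2 := by
    intro t ht
    have := ZMod.mul_inv_of_unit _ (hunit _ (hTmem t ht).2.1)
    simp only [φ]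
    linear_combination (t.1.1 + (t.2 : ZMod q)) * this
  have hinj : Set.InjOn φ T := by
    rintro ⟨⟨n, p⟩, b⟩ ht ⟨⟨n', p'⟩, b'⟩ ht' heq
    have e1 := hTφ _ ht
    have e2 := hTφ _ ht'
    rw [heq, e2] at e1
    obtain ⟨hn, hp, hb, -⟩ := hTmem _ ht
    obtain ⟨hn', hp', hb', -⟩ := hTmem _ ht'
    have hpp : p = p' := congrArg Prod.snd heq
    simp only at hn hp hb hn' hp' hb' e1
    have hnn := hNsep n hn n' hn' b hb b' hb' e1.symm
    subst hpp hnn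
    have h1 : (b : ZMod q) = b' := (add_left_cancel e1).symm
    have h2 : b = b' := by
      rw [ZMod.natCast_eq_natCast_iff'] at h1
      rwa [Nat.mod_eq_of_lt (by omega), Nat.mod_eq_of_lt (by omega)] at h1
    subst h2
    rfl
  have hTc : (N.card * P.card : ℝ) * (θ * h / 4) ≤ T.card := by
    rw [Finset.card_sigma, ← Nat.cast_mul, ← Finset.card_product, ← nsmul_eq_mul, ← Finset.sum_const, Nat.cast_sum]
    refine Finset.sum_le_sum fun z hz => ?_
    obtain ⟨hz1, hz2⟩ := Finset.mem_product.mp hz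
    have hpl : 8 * (z.2 : ℝ) * l ≤ θ * h := by
      refine le_trans ?_ hyl
      have : (z.2 : ℝ) ≤ y := by exact_mod_cast (hP _ hz2).2.2
      gcongr
    have h1 := card_dilated_largeSet_ge (hNX hz1) hl (hunit _ hz2) hθ hpl
    have h2 := card_small_annihilator_le z.1 h (y ^ (2 * k))
    have h3 : ((Finset.range h).filter fun b : ℕ => (z.1 + (b : ZMod q)) * (z.2 : ZMod q)⁻¹ ∈ W).card ≤
        ((Finset.range h).filter fun b : ℕ => (z.1 + (b : ZMod q)) * (z.2 : ZMod q)⁻¹ ∈ W ∧ good (z.1 + b)).card +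
        ((Finset.range h).filter fun b : ℕ => ¬ good (z.1 + b)).card := by
      refine le_trans (Finset.card_le_card ?_) (Finset.card_union_le _ _)
      intro b hb
      simp only [Finset.mem_union, Finset.mem_filter] at hb ⊢
      tauto
    have h4 : ((((Finset.range h).filter fun b : ℕ => (z.1 + (b : ZMod q)) * (z.2 : ZMod q)⁻¹ ∈ W).card : ℕ) : ℝ) ≤
        (((Finset.range h).filter fun b : ℕ => (z.1 + (b : ZMod q)) * (z.2 : ZMod q)⁻¹ ∈ W ∧ good (z.1 + b)).card : ℝ) +
        (((Finset.range h).filter fun b : ℕ => ¬ good (z.1 + b)).card : ℝ) := by exact_mod_cast h3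
    have h5 : (((Finset.range h).filter fun b : ℕ => ¬ good (z.1 + b)).card : ℝ) ≤ θ * h / 4 := h2.trans hbad
    have h6 : θ * h / 2 ≤ (((Finset.range h).filter fun b : ℕ => (z.1 + (b : ZMod q)) * (z.2 : ZMod q)⁻¹ ∈ W).card : ℝ) := h1
    linarith
  set E := T.image φ with hE
  have hEc : E.card = T.card := Finset.card_image_of_injOn hinj
  have hVc : (E.image fun e => (e.2 : ZMod q) * e.1).card ≤ N.card * h := by
    have : E.image (fun e => (e.2 : ZMod q) * e.1) ⊆ (N ×ˢ Finset.range h).image fun z => z.1 + (z.2 : ZMod q) := by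
      intro v hv
      obtain ⟨e, he, rfl⟩ := Finset.mem_image.mp hv
      obtain ⟨t, ht, rfl⟩ := Finset.mem_image.mp he
      refine Finset.mem_image.mpr ⟨(t.1.1, t.2), ?_, (hTφ t ht).symm⟩
      simp [(hTmem t ht).1, (hTmem t ht).2.2.1]
    refine (Finset.card_le_card this).trans (Finset.card_image_le.trans ?_)
    rw [Finset.card_product, Finset.card_range]
  have hWsub : E.image Prod.fst ⊆ W := by
    intro v hv
    obtain ⟨e, he, rfl⟩ := Finset.mem_image.mp hv
    obtain ⟨t, ht, rfl⟩ := Finset.mem_image.mp he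
    exact (hTmem t ht).2.2.2.1
  have hN0 : (0 : ℝ) < N.card := by
    have h1 : 0 < N.card := by
      by_contra hcon
      have h2 : N.card = 0 := by omega
      rw [h2, mul_zero] at hNc
      have := Finset.card_pos.mpr hX
      omega
    exact_mod_cast h1
  have hNc' : (X.card : ℝ) ≤ 2 * h * N.card := by exact_mod_cast hNc
  have hmain : (m + k) * (E.image fun e => (e.2 : ZMod q) * e.1).card + (d + k) * (E.image Prod.fst).card < E.card := by
    have h1 : ((m + k) * (E.image fun e => (e.2 : ZMod q) * e.1).card : ℝ) ≤ P.card * θ / 16 * (N.card * h) := by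
      have : ((E.image fun e => (e.2 : ZMod q) * e.1).card : ℝ) ≤ N.card * h := by exact_mod_cast hVc
      gcongr
    have h2 : ((d + k) * (E.image Prod.fst).card : ℝ) ≤ 2 * h * N.card * P.card * θ / 32 := by
      calc ((d + k) * (E.image Prod.fst).card : ℝ) ≤ (d + k) * W.card := by
            gcongr
        _ ≤ _ := hd
        _ ≤ _ := by gcongr
    have h3 : 0 < P.card * θ * (N.card * h) := by positivity
    rw [← hEc] at hTc
    have h4 : ((m + k) * (E.image fun e => (e.2 : ZMod q) * e.1).card + (d + k) * (E.image Prod.fst).card : ℝ) < E.card := by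
      nlinarith
    exact_mod_cast h4
  obtain ⟨E', hE', ⟨e₀, he₀⟩, hf, hg⟩ := exists_subset_min_degree (fun e : ZMod q × ℕ => (e.2 : ZMod q) * e.1) Prod.fst
    (m + k) (d + k) E hmain
  have hfin := pow_le_card_image_fst (k := k) (y := y) (E := E') (fun e he => ?_) (Finset.mem_image_of_mem Prod.fst he₀) ?_ hg hf
  · refine hfin.trans (Nat.mul_le_mul_left _ (Finset.card_le_card ?_))
    exact (Finset.image_subset_image hE').trans hWsub
  · obtain ⟨t, ht, rfl⟩ := Finset.mem_image.mp (hE' he)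
    exact hP _ (hTmem t ht).2.1
  · intro c hc0 hcY hc
    obtain ⟨t, ht, rfl⟩ := Finset.mem_image.mp (hE' he₀)
    refine (hTmem t ht).2.2.2.2 c hc0 hcY ?_
    rw [← hTφ t ht, mul_left_comm, hc, mul_zero]

open Filter in
theorem eventually_rpow_le_primeCounting {ν : ℝ} (hν : 0 < ν) (hν' : ν < 1) :
    ∀ᶠ x : ℝ in atTop, 2 * x ^ (1 - ν) ≤ (Nat.primeCounting ⌊x⌋₊ : ℝ) := by
  have h := (isLittleO_log_rpow_atTop hν).bound (by norm_num : (0 : ℝ) < 1 / 16)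
  filter_upwards [h, eventually_ge_atTop 5] with x hx hx5
  have hlog : 0 < Real.log x := Real.log_pos (by linarith)
  have hx0 : 0 < x := by linarith
  rw [Real.norm_of_nonneg hlog.le, Real.norm_of_nonneg (by positivity)] at hx
  have h1 := Chebyshev.pi_ge' (x := x) (by linarith)
  refine le_trans ?_ h1
  rw [le_div_iff₀ hlog]
  have h2 : x ^ (1 - ν) * x ^ ν = x := by
    rw [← Real.rpow_add hx0]; simp
  have h3 : x ^ ν ≤ x := by
    conv_rhs => rw [← Real.rpow_one x]
    exact Real.rpow_le_rpow_of_exponent_le (by linarith) hν'.le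
  have h4 : Real.log (x + 2) ≤ 2 * Real.log x := by
    rw [← Real.log_rpow hx0]
    apply Real.log_le_log (by linarith)
    norm_num
    nlinarith
  have h5 : 2 * x ^ (1 - ν) * Real.log x ≤ 2 * x ^ (1 - ν) * (1 / 16 * x ^ ν) := by gcongr
  have h6 := Real.log_two_gt_d9
  nlinarith

open Filter in
theorem eventually_rpow_le_card_primes_not_dvd {α σ : ℝ} (hσ : 0 < σ) (hσα : σ < α) :
    ∀ᶠ q : ℕ in atTop, (q : ℝ) ^ (α - σ) ≤
      ((((Finset.range (⌊(q : ℝ) ^ α⌋₊ + 1)).filter Nat.Prime).filter fun p => ¬ p ∣ q).card : ℝ) := by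
  have hα : 0 < α := hσ.trans hσα
  obtain ⟨C, hC, hCq⟩ := exists_pow_card_primeFactors_le (K := 2) (η := (α - σ) / 2) (by norm_num) (by linarith)
  have h1 := ((tendsto_rpow_atTop hα).comp tendsto_natCast_atTop_atTop).eventually
    (eventually_rpow_le_primeCounting (ν := σ / α) (by positivity) ((div_lt_one hα).2 hσα))
  have h2 := ((tendsto_rpow_atTop (y := (α - σ) / 2) (by linarith)).comp
    tendsto_natCast_atTop_atTop).eventually_ge_atTop C
  filter_upwards [h1, h2, eventually_gt_atTop 0] with q hq1 hq2 hq0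
  simp only [Function.comp] at hq1 hq2
  have hq0' : (0 : ℝ) < q := by exact_mod_cast hq0
  rw [← Real.rpow_mul hq0'.le, mul_sub, mul_one, mul_div_cancel₀ _ hα.ne'] at hq1
  have h3 : (q.primeFactors.card : ℝ) ≤ q ^ (α - σ) := by
    have h4 : (q.primeFactors.card : ℝ) ≤ 2 ^ q.primeFactors.card := by
      exact_mod_cast (Nat.lt_two_pow_self).le
    have h5 := hCq q hq0
    have h6 : (q : ℝ) ^ (α - σ) = q ^ ((α - σ) / 2) * q ^ ((α - σ) / 2) := by
      rw [← Real.rpow_add hq0']; congr 1; ring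
    rw [h6]
    refine h4.trans (h5.trans ?_)
    gcongr
  have h7 : Nat.primeCounting ⌊(q : ℝ) ^ α⌋₊ ≤
      (((Finset.range (⌊(q : ℝ) ^ α⌋₊ + 1)).filter Nat.Prime).filter fun p => ¬ p ∣ q).card + q.primeFactors.card := by
    rw [Nat.primeCounting, Nat.primeCounting', Nat.count_eq_card_filter_range,
      ← Finset.card_filter_add_card_filter_not (s := (Finset.range (⌊(q : ℝ) ^ α⌋₊ + 1)).filter Nat.Prime) (fun p => ¬ p ∣ q)]
    gcongr
    intro p hp
    simp only [Finset.mem_filter, not_not] at hp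
    exact Nat.mem_primeFactors.2 ⟨hp.1.2, hp.2, hq0.ne'⟩
  have h8 : (Nat.primeCounting ⌊(q : ℝ) ^ α⌋₊ : ℝ) ≤
      ((((Finset.range (⌊(q : ℝ) ^ α⌋₊ + 1)).filter Nat.Prime).filter fun p => ¬ p ∣ q).card : ℝ) + q.primeFactors.card := by
    exact_mod_cast h7
  linarith

open Filter in
theorem eventually_mul_rpow_le_rpow (B : ℝ) {a b : ℝ} (hab : a < b) :
    ∀ᶠ q : ℕ in atTop, B * (q : ℝ) ^ a ≤ (q : ℝ) ^ b := by
  have h1 := ((tendsto_rpow_atTop (sub_pos.2 hab)).comp tendsto_natCast_atTop_atTop).eventually_ge_atTop B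
  filter_upwards [h1, eventually_gt_atTop 0] with q hq hq0
  have hq0' : (0 : ℝ) < q := by exact_mod_cast hq0
  have h2 : (q : ℝ) ^ b = q ^ (b - a) * q ^ a := by
    rw [← Real.rpow_add hq0']; congr 1; ring
  rw [h2]
  exact mul_le_mul_of_nonneg_right hq (by positivity)

open Filter in
set_option maxHeartbeats 2000000 in
theorem eventually_largeSet_descent {ε : ℝ} (hε : 0 < ε) (hε1 : ε ≤ 1) {C : ℝ} (hC : 0 < C) {M k : ℕ} {α σ : ℝ}
    (hk : 0 < k) (hσ : 0 < σ) (hα : 2 * k * α = 1 - ε / 32) (hαε : α ≤ ε / 8) (hσε : 256 * (k + M + 1) * σ = ε)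
    (hCM : ∀ (q : ℕ) [NeZero q], (∀ p : ℕ, p.Prime → ¬ p ^ 3 ∣ q) →
      ∀ χ : MulChar (ZMod q) ℂ, IsLocallyPrimitive χ → ∀ (h : ℕ) (θ : ℝ), 0 < θ → (q : ℝ) ^ (ε / 8) ≤ h →
      (largeSet χ h θ).card * θ ^ M ≤ C * (q : ℝ) ^ (1 / 2 + ε / 64)) :
    ∀ᶠ q : ℕ in atTop, ∀ [NeZero q], (∀ p : ℕ, p.Prime → ¬ p ^ 3 ∣ q) →
      ∀ χ : MulChar (ZMod q) ℂ, IsLocallyPrimitive χ → ∀ (h : ℕ) (θ : ℝ), (q : ℝ) ^ (-(2 * σ)) ≤ θ → θ ≤ 1 →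
      (q : ℝ) ^ (ε / 2) ≤ h → h ≤ q → ∃ l : ℕ, (q : ℝ) ^ (ε / 8) ≤ l ∧ l * (q : ℝ) ^ α ≤ h ∧
      (largeSet χ h θ).card * (h : ℝ) ≤
        (q : ℝ) ^ (ε / (16 * k) + 6 * σ) * ((largeSet χ l (θ / 4)).card * (l : ℝ)) := by
  have hk1 : (1 : ℝ) ≤ k := by exact_mod_cast hk
  have hM0 : (0 : ℝ) ≤ M := by positivity
  have hkσ : k * σ ≤ ε / 256 := by nlinarith [mul_nonneg hM0 hσ.le]
  have hMσ : M * σ ≤ ε / 256 := by nlinarith [mul_nonneg (sub_nonneg.2 hk1) hσ.le]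
  have hσ1 : 2 * σ ≤ ε / 256 := by nlinarith [mul_nonneg (sub_nonneg.2 hk1) hσ.le, mul_nonneg hM0 hσ.le]
  have hkM : (4 * k + 2 * M + 1) * σ ≤ ε / 64 := by nlinarith [mul_nonneg hM0 hσ.le]
  have hασ : 4 * σ < α := by
    by_contra! hcon
    have := mul_le_mul_of_nonneg_left hcon (by linarith : (0 : ℝ) ≤ 2 * k)
    nlinarith
  have hτ : k * (ε / (16 * k)) = ε / 16 := by field_simp
  have hτ0 : 0 < ε / (16 * k) := by positivity
  set τ := ε / (16 * k) with hτdef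
  clear_value τ
  obtain ⟨C', hC', hCq'⟩ := exists_pow_card_primeFactors_le (K := 3) (η := σ) (by norm_num) hσ
  filter_upwards [eventually_gt_atTop 1,
    eventually_rpow_le_card_primes_not_dvd (α := α) (σ := σ) hσ (by linarith),
    eventually_mul_rpow_le_rpow (8 * C') (a := 3 * σ) (b := ε / 32) (by linarith),
    eventually_mul_rpow_le_rpow 16 (a := ε / 8) (b := ε / 2 - 2 * σ - α) (by linarith),
    eventually_mul_rpow_le_rpow (512 * (k + 2)) (a := τ) (b := τ + σ) (by linarith),
    eventually_mul_rpow_le_rpow (16 * (k + 2)) (a := α - 4 * σ) (b := α - 3 * σ) (by linarith),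
    eventually_mul_rpow_le_rpow (2 * (k ^ (2 * k) * C * 4 ^ M)) (a := 0) (b := σ) hσ,
    eventually_mul_rpow_le_rpow 8 (a := 0) (b := α) (by linarith)]
    with q hq1 hP hbad hl hd hm hfin hy _ hcf χ hχ h θ hθ hθ1 hh hhq
  rw [Real.rpow_zero, mul_one] at hfin hy
  have hq1' : (1 : ℝ) < q := by exact_mod_cast hq1
  have hq0' : (0 : ℝ) < q := by linarith
  have hθ0 : 0 < θ := lt_of_lt_of_le (by positivity) hθ
  have hh0 : (0 : ℝ) < h := lt_of_lt_of_le (by positivity) hh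
  set y := ⌊(q : ℝ) ^ α⌋₊ with hydef
  have hyq : (y : ℝ) ≤ q ^ α := Nat.floor_le (by positivity)
  have hyq' : (q : ℝ) ^ α ≤ 8 * y := by
    have := Nat.lt_floor_add_one ((q : ℝ) ^ α)
    rw [← hydef] at this
    linarith
  have hy0 : (0 : ℝ) < y := by linarith
  have hone : ∀ a : ℝ, 0 ≤ a → (1 : ℝ) ≤ (q : ℝ) ^ a := fun a ha => Real.one_le_rpow hq1'.le ha
  have hbig : 16 * (q : ℝ) ^ (ε / 8) ≤ θ * h / y := by
    rw [le_div_iff₀ hy0]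
    calc 16 * (q : ℝ) ^ (ε / 8) * y ≤ q ^ (ε / 2 - 2 * σ - α) * q ^ α := by gcongr
      _ = q ^ (-(2 * σ)) * q ^ (ε / 2) := by
        rw [← Real.rpow_add hq0', ← Real.rpow_add hq0']; congr 1; ring
      _ ≤ θ * h := by gcongr
  set l := ⌊θ * h / y / 8⌋₊ with hldef
  have hl1 : (l : ℝ) ≤ θ * h / y / 8 := Nat.floor_le (by positivity)
  have hl2 : θ * h / y / 8 < l + 1 := Nat.lt_floor_add_one _
  have hl3 : θ * h / y ≤ 16 * l := by
    have := hone (ε / 8) (by positivity)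
    linarith
  have hlq : (q : ℝ) ^ (ε / 8) ≤ l := by
    linarith
  have hyl : 8 * y * l ≤ θ * h := by
    have := mul_le_mul_of_nonneg_left hl1 hy0.le
    have h2 : (y : ℝ) * (θ * h / y / 8) = θ * h / 8 := by field_simp
    linarith
  have hl3' : θ * h ≤ 16 * l * y := by rwa [div_le_iff₀ hy0] at hl3
  have hl0 : (0 : ℝ) < l := lt_of_lt_of_le (by positivity) hlq
  refine ⟨l, hlq, ?_, ?_⟩
  · calc l * (q : ℝ) ^ α ≤ l * (8 * y) := by gcongr
      _ ≤ θ * h := by linarith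
      _ ≤ h := by nlinarith
  by_contra! hcon
  have hX : (largeSet χ h θ).Nonempty := by
    rw [Finset.nonempty_iff_ne_empty]
    intro h0
    rw [h0] at hcon
    simp only [Finset.card_empty, Nat.cast_zero, zero_mul] at hcon
    exact absurd hcon (not_lt.2 (by positivity))
  set P := ((Finset.range (y + 1)).filter Nat.Prime).filter fun p => ¬ p ∣ q with hPdef
  set Xh : ℝ := ((largeSet χ h θ).card : ℝ) with hXh
  set Xl : ℝ := ((largeSet χ l (θ / 4)).card : ℝ) with hXl
  have hXl0 : 0 ≤ Xl := by positivity
  have key := pow_le_card_largeSet (χ := χ) (h := h) (l := l) (k := k) (y := y) (m := ⌈(q : ℝ) ^ (α - 4 * σ)⌉₊)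
    (d := ⌈(q : ℝ) ^ τ⌉₊) hθ0 (P := P) (by
      intro p hp
      simp only [hPdef, Finset.mem_filter, Finset.mem_range] at hp
      exact ⟨hp.1.2, hp.2, by omega⟩) (by exact_mod_cast hl0) hk hhq hyl ?_ hX ?_ ?_
  · have hX2 := hCM q hcf χ hχ l (θ / 4) (by positivity) hlq
    have key' : ((q : ℝ) ^ τ * q ^ (α - 4 * σ)) ^ k ≤ k ^ (2 * k) * Xl := by
      refine le_trans ?_ (by rw [hXl]; exact_mod_cast key : (((⌈(q : ℝ) ^ τ⌉₊ : ℝ) * (⌈(q : ℝ) ^ (α - 4 * σ)⌉₊ : ℝ)) ^ k ≤ k ^ (2 * k) * Xl))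
      gcongr <;> exact Nat.le_ceil _
    have e1 : ((q : ℝ) ^ τ * q ^ (α - 4 * σ)) ^ k = q ^ (1 / 2 + ε / 16 - ε / 64 - 4 * (k * σ)) := by
      rw [← Real.rpow_add hq0', ← Real.rpow_natCast, ← Real.rpow_mul hq0'.le]
      congr 1
      linear_combination hτ + hα / 2
    have e2 : (q : ℝ) ^ (-(2 * (M * σ))) ≤ θ ^ M := by
      calc (q : ℝ) ^ (-(2 * (M * σ))) = (q ^ (-(2 * σ))) ^ M := by
            rw [← Real.rpow_natCast, ← Real.rpow_mul hq0'.le]; congr 1; ring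
        _ ≤ θ ^ M := by gcongr
    have e3 : Xl * (q : ℝ) ^ (-(2 * (M * σ))) ≤ 4 ^ M * C * q ^ (1 / 2 + ε / 64) := by
      rw [div_pow, mul_div_assoc', div_le_iff₀ (by positivity)] at hX2
      calc Xl * (q : ℝ) ^ (-(2 * (M * σ))) ≤ Xl * θ ^ M := by gcongr
        _ ≤ _ := hX2
        _ = _ := by ring
    have e4 : (q : ℝ) ^ (1 / 2 + ε / 16 - ε / 64 - 4 * (k * σ)) * (q : ℝ) ^ (-(2 * (M * σ))) ≤
        (k ^ (2 * k) * C * 4 ^ M) * q ^ (1 / 2 + ε / 64) := by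
      rw [e1] at key'
      calc _ ≤ k ^ (2 * k) * Xl * (q : ℝ) ^ (-(2 * (M * σ))) := by gcongr
        _ = k ^ (2 * k) * (Xl * (q : ℝ) ^ (-(2 * (M * σ)))) := by ring
        _ ≤ k ^ (2 * k) * (4 ^ M * C * q ^ (1 / 2 + ε / 64)) := by gcongr
        _ = _ := by ring
    have e5 : (q : ℝ) ^ σ * (q : ℝ) ^ (1 / 2 + ε / 64) ≤
        (q : ℝ) ^ (1 / 2 + ε / 16 - ε / 64 - 4 * (k * σ)) * (q : ℝ) ^ (-(2 * (M * σ))) := by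
      rw [← Real.rpow_add hq0', ← Real.rpow_add hq0']
      apply Real.rpow_le_rpow_of_exponent_le hq1'.le
      linarith
    have e6 := e5.trans e4
    have e7 : (q : ℝ) ^ σ ≤ k ^ (2 * k) * C * 4 ^ M := le_of_mul_le_mul_right e6 (by positivity)
    have e8 : 0 < (k : ℝ) ^ (2 * k) * C * 4 ^ M := by positivity
    linarith
  · have hdiv : (q.divisors.card : ℝ) ≤ C' * q ^ σ := by
      refine le_trans ?_ (hCq' q (by omega))
      exact_mod_cast Nat.card_divisors_le_three_pow (by omega) hcf
    have hy2 : ((y ^ (2 * k) : ℕ) : ℝ) ≤ q ^ (1 - ε / 32) := by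
      push_cast
      calc (y : ℝ) ^ (2 * k) ≤ (q ^ α) ^ (2 * k) := by gcongr
        _ = _ := by
          rw [← Real.rpow_natCast, ← Real.rpow_mul hq0'.le]
          congr 1
          push_cast
          linarith
    have f1 : (h : ℝ) * (y ^ (2 * k) : ℕ) / q ≤ h * q ^ (-(ε / 32)) := by
      rw [div_le_iff₀ hq0', mul_assoc]
      gcongr
      refine hy2.trans (le_of_eq ?_)
      conv_rhs => rw [← Real.rpow_one (q : ℝ), ← Real.rpow_mul hq0'.le, ← Real.rpow_add hq0']
      congr 1; ring
    have f2 : 8 * (C' * q ^ σ) * q ^ (-(ε / 32)) ≤ (q : ℝ) ^ (-(2 * σ)) := by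
      calc 8 * (C' * q ^ σ) * (q : ℝ) ^ (-(ε / 32)) = 8 * C' * q ^ (3 * σ) * (q ^ (-(2 * σ)) * q ^ (-(ε / 32))) := by
            rw [show 3 * σ = σ + 2 * σ by ring, Real.rpow_add hq0', Real.rpow_neg hq0'.le (2 * σ)]
            field_simp
        _ ≤ q ^ (ε / 32) * (q ^ (-(2 * σ)) * q ^ (-(ε / 32))) := by gcongr
        _ = q ^ (-(2 * σ)) := by
            rw [← Real.rpow_add hq0', ← Real.rpow_add hq0']; congr 1; ring
    have f3 : (1 : ℝ) ≤ h * q ^ (-(ε / 32)) := by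
      calc (1 : ℝ) ≤ q ^ (ε / 2) * q ^ (-(ε / 32)) := by
            rw [← Real.rpow_add hq0']; exact hone _ (by linarith)
        _ ≤ _ := by gcongr
    calc (q.divisors.card : ℝ) * ((h : ℝ) * (y ^ (2 * k) : ℕ) / q + 1)
        ≤ (C' * q ^ σ) * (h * q ^ (-(ε / 32)) + h * q ^ (-(ε / 32))) := by gcongr
      _ = (8 * (C' * q ^ σ) * q ^ (-(ε / 32))) * h / 4 := by ring
      _ ≤ θ * h / 4 := by
        have := f2.trans hθ
        gcongr
  · have g1 : (⌈(q : ℝ) ^ (α - 4 * σ)⌉₊ : ℝ) < q ^ (α - 4 * σ) + 1 := Nat.ceil_lt_add_one (by positivity)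
    have g2 := hone (α - 4 * σ) (by linarith)
    have g3 : (q : ℝ) ^ (α - 3 * σ) ≤ P.card * θ := by
      calc (q : ℝ) ^ (α - 3 * σ) = q ^ (α - σ) * q ^ (-(2 * σ)) := by
            rw [← Real.rpow_add hq0']; congr 1; ring
        _ ≤ _ := by gcongr
    nlinarith
  · have g1 : (⌈(q : ℝ) ^ τ⌉₊ : ℝ) < q ^ τ + 1 := Nat.ceil_lt_add_one (by positivity)
    have g2 := hone τ hτ0.le
    have g3 : (⌈(q : ℝ) ^ τ⌉₊ + k : ℝ) ≤ q ^ (τ + σ) / 512 := by nlinarith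
    have g4 : (q : ℝ) ^ (τ + 6 * σ) * Xl * θ ≤ 16 * y * Xh := by
      have a1 := hcon.le
      have a2 : (q : ℝ) ^ (τ + 6 * σ) * (Xl * l) * θ ≤ Xh * (16 * l * y) := by
        calc _ ≤ Xh * h * θ := by gcongr
          _ = Xh * (θ * h) := by ring
          _ ≤ _ := by gcongr
      have a3 : ((q : ℝ) ^ (τ + 6 * σ) * Xl * θ) * l ≤ (16 * y * Xh) * l := by linarith
      exact le_of_mul_le_mul_right a3 hl0
    have g5 : (q : ℝ) ^ (τ + σ) * (16 * q ^ α) ≤ 16 * q ^ (τ + 6 * σ) * P.card * (θ * θ) := by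
      calc (q : ℝ) ^ (τ + σ) * (16 * q ^ α) = 16 * q ^ (τ + 6 * σ) * q ^ (α - σ) * (q ^ (-(2 * σ)) * q ^ (-(2 * σ))) := by
            have e : (q : ℝ) ^ (τ + σ) * q ^ α = q ^ (τ + 6 * σ) * q ^ (α - σ) * (q ^ (-(2 * σ)) * q ^ (-(2 * σ))) := by
              simp only [← Real.rpow_add hq0']
              congr 1; ring
            linear_combination 16 * e
        _ ≤ _ := by gcongr
    have g6 : (q : ℝ) ^ (τ + σ) * Xl * (16 * q ^ α) ≤ 16 * Xh * P.card * θ * (16 * q ^ α) := by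
      calc (q : ℝ) ^ (τ + σ) * Xl * (16 * q ^ α) = ((q : ℝ) ^ (τ + σ) * (16 * q ^ α)) * Xl := by ring
        _ ≤ (16 * q ^ (τ + 6 * σ) * P.card * (θ * θ)) * Xl := by gcongr
        _ = 16 * (q ^ (τ + 6 * σ) * Xl * θ) * P.card * θ := by ring
        _ ≤ 16 * (16 * y * Xh) * P.card * θ := by gcongr
        _ ≤ 16 * (16 * q ^ α * Xh) * P.card * θ := by gcongr
        _ = _ := by ring
    have g7 := le_of_mul_le_mul_right g6 (by positivity)
    calc (⌈(q : ℝ) ^ τ⌉₊ + k : ℝ) * Xl ≤ q ^ (τ + σ) / 512 * Xl := by gcongr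
      _ ≤ Xh * P.card * θ / 32 := by linarith

open Filter in
set_option maxHeartbeats 1000000 in
theorem eventually_card_largeSet_mul_le {ε : ℝ} (hε : 0 < ε) (hε1 : ε ≤ 1) :
    ∃ σ : ℝ, 0 < σ ∧ ∀ᶠ q : ℕ in atTop, ∀ [NeZero q], (∀ p : ℕ, p.Prime → ¬ p ^ 3 ∣ q) →
      ∀ χ : MulChar (ZMod q) ℂ, IsLocallyPrimitive χ → ∀ (h : ℕ) (θ : ℝ), (q : ℝ) ^ (-σ) ≤ θ → θ ≤ 1 →
      (q : ℝ) ^ ε ≤ h → h ≤ q → (largeSet χ h θ).card * (h : ℝ) ≤ (q : ℝ) ^ (1 / 2 + ε) := by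
  obtain ⟨C, hC, M, hCM⟩ := exists_card_largeSet_le (η := ε / 64) (η' := ε / 8) (by positivity) (by positivity)
  obtain ⟨k, hk⟩ := exists_nat_ge (4 / ε)
  have hk0 : (0 : ℝ) < k := lt_of_lt_of_le (by positivity) hk
  have hk1 : (1 : ℝ) ≤ k := by exact_mod_cast (by exact_mod_cast hk0 : 0 < k)
  have hkε : 4 ≤ k * ε := by rwa [div_le_iff₀ hε] at hk
  have hM0 : (0 : ℝ) ≤ M := by positivity
  obtain ⟨α, hα⟩ : ∃ α : ℝ, 2 * k * α = 1 - ε / 32 := ⟨(1 - ε / 32) / (2 * k), by field_simp⟩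
  obtain ⟨σ, hσε⟩ : ∃ σ : ℝ, 256 * (k + M + 1) * σ = ε := ⟨ε / (256 * (k + M + 1)), by field_simp⟩
  have hσ : 0 < σ := by
    by_contra! hcon
    have := mul_nonpos_of_nonneg_of_nonpos (by positivity : 0 ≤ 256 * ((k : ℝ) + M + 1)) hcon
    linarith
  have hα0 : 0 < α := by
    by_contra! hcon
    have := mul_nonpos_of_nonneg_of_nonpos (by positivity : 0 ≤ 2 * (k : ℝ)) hcon
    linarith
  have hαε : α ≤ ε / 8 := by
    by_contra! hcon
    have := mul_lt_mul_of_pos_left hcon (by positivity : 0 < 2 * (k : ℝ))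
    linarith
  have hkσ : k * σ ≤ ε / 256 := by nlinarith [mul_nonneg hM0 hσ.le]
  have hMσ : M * σ ≤ ε / 256 := by nlinarith [mul_nonneg (sub_nonneg.2 hk1) hσ.le]
  have hτ : k * (ε / (16 * k)) = ε / 16 := by field_simp
  have hκ : 4 * k * (ε / (16 * k) + 6 * σ) ≤ 11 / 32 * ε := by linarith
  have hκ0 : 0 < ε / (16 * k) + 6 * σ := by positivity
  refine ⟨σ, hσ, ?_⟩
  filter_upwards [eventually_gt_atTop 1,
    eventually_largeSet_descent hε hε1 hC (by exact_mod_cast hk0) hσ hα hαε hσε hCM,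
    eventually_mul_rpow_le_rpow C (a := 0) (b := ε / 128) (by positivity),
    eventually_mul_rpow_le_rpow (4 ^ (4 * k)) (a := -(2 * σ)) (b := -σ) (by linarith)]
    with q hq1 hdesc hCq h4q _ hcf χ hχ h θ hθ hθ1 hh hhq
  set κ := ε / (16 * k) + 6 * σ
  clear_value κ
  rw [Real.rpow_zero, mul_one] at hCq
  have hq1' : (1 : ℝ) < q := by exact_mod_cast hq1
  have hq0' : (0 : ℝ) < q := by linarith
  have hqσ : (0 : ℝ) < q ^ (-(2 * σ)) := by positivity
  have base : ∀ (h : ℕ) (θ : ℝ), (q : ℝ) ^ (-(2 * σ)) ≤ θ → (q : ℝ) ^ (ε / 8) ≤ h → (h : ℝ) ≤ q ^ (ε / 2) →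
      (largeSet χ h θ).card * (h : ℝ) ≤ (q : ℝ) ^ (1 / 2 + 17 / 32 * ε) := by
    intro h θ hθ hh hh2
    have hθ0 : 0 < θ := hqσ.trans_le hθ
    have h1 := hCM q hcf χ hχ h θ hθ0 hh
    have e2 : (q : ℝ) ^ (-(2 * (M * σ))) ≤ θ ^ M := by
      calc (q : ℝ) ^ (-(2 * (M * σ))) = (q ^ (-(2 * σ))) ^ M := by
            rw [← Real.rpow_natCast, ← Real.rpow_mul hq0'.le]; congr 1; ring
        _ ≤ θ ^ M := by gcongr
    have h2 : ((largeSet χ h θ).card * (h : ℝ)) * (q : ℝ) ^ (-(2 * (M * σ))) ≤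
        (q : ℝ) ^ (1 / 2 + 17 / 32 * ε) * (q : ℝ) ^ (-(2 * (M * σ))) := by
      calc ((largeSet χ h θ).card * (h : ℝ)) * (q : ℝ) ^ (-(2 * (M * σ)))
          ≤ ((largeSet χ h θ).card * (h : ℝ)) * θ ^ M := by gcongr
        _ = ((largeSet χ h θ).card * θ ^ M) * h := by ring
        _ ≤ (C * (q : ℝ) ^ (1 / 2 + ε / 64)) * q ^ (ε / 2) := by gcongr
        _ ≤ (q ^ (ε / 128) * (q : ℝ) ^ (1 / 2 + ε / 64)) * q ^ (ε / 2) := by gcongr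
        _ ≤ _ := by
          simp only [← Real.rpow_add hq0']
          apply Real.rpow_le_rpow_of_exponent_le hq1'.le
          linarith
    exact le_of_mul_le_mul_right h2 (by positivity)
  have main : ∀ (j : ℕ) (h : ℕ) (θ : ℝ), 4 ^ j * (q : ℝ) ^ (-(2 * σ)) ≤ θ → θ ≤ 1 → (q : ℝ) ^ (ε / 8) ≤ h →
      h ≤ q → (h : ℝ) ≤ q ^ (ε / 2 + j * α) →
      (largeSet χ h θ).card * (h : ℝ) ≤ (q : ℝ) ^ (1 / 2 + 17 / 32 * ε + j * κ) := by
    intro j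
    induction j with
    | zero =>
      intro h θ hθ _ hh _ hh2
      simp only [pow_zero, one_mul, Nat.cast_zero, zero_mul, add_zero] at *
      exact base h θ hθ hh hh2
    | succ j ih =>
      intro h θ hθ hθ1 hh hhq hh2
      have hθ' : (q : ℝ) ^ (-(2 * σ)) ≤ θ := by
        refine le_trans ?_ hθ
        have : (1 : ℝ) ≤ 4 ^ (j + 1) := one_le_pow₀ (by norm_num)
        nlinarith
      rcases le_total (h : ℝ) (q ^ (ε / 2)) with hle | hge
      · refine (base h θ hθ' hh hle).trans ?_
        apply Real.rpow_le_rpow_of_exponent_le hq1'.le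
        have : 0 ≤ ((j + 1 : ℕ) : ℝ) * κ := by positivity
        linarith
      · obtain ⟨l, hl1, hl2, hl3⟩ := hdesc hcf χ hχ h θ hθ' hθ1 hge hhq
        have hqα : (1 : ℝ) ≤ q ^ α := Real.one_le_rpow hq1'.le hα0.le
        have hlh : (l : ℝ) ≤ h := by
          have : (0 : ℝ) ≤ l := by positivity
          nlinarith
        have h5 := ih l (θ / 4) (by rw [pow_succ] at hθ; linarith) (by linarith) hl1
          ((by exact_mod_cast hlh : l ≤ h).trans hhq) (by
            have h6 : (q : ℝ) ^ (ε / 2 + (j + 1 : ℕ) * α) = q ^ (ε / 2 + j * α) * q ^ α := by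
              rw [← Real.rpow_add hq0']; congr 1; push_cast; ring
            rw [h6] at hh2
            exact le_of_mul_le_mul_right (hl2.trans hh2) (by positivity))
        refine hl3.trans ?_
        calc _ ≤ (q : ℝ) ^ κ * q ^ (1 / 2 + 17 / 32 * ε + j * κ) := by gcongr
          _ = _ := by rw [← Real.rpow_add hq0']; congr 1; push_cast; ring
  have hfin := main (4 * k) h θ (h4q.trans hθ) hθ1 ((Real.rpow_le_rpow_of_exponent_le hq1'.le (by linarith)).trans hh) hhq
    (by
      calc (h : ℝ) ≤ q := by exact_mod_cast hhq
        _ = (q : ℝ) ^ (1 : ℝ) := (Real.rpow_one _).symm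
        _ ≤ _ := by
          apply Real.rpow_le_rpow_of_exponent_le hq1'.le
          push_cast
          linarith)
  refine hfin.trans ?_
  apply Real.rpow_le_rpow_of_exponent_le hq1'.le
  push_cast
  linarith

theorem norm_sum_Icc_sub_sum_shift_le {f : ℕ → ℂ} (hf : ∀ n, ‖f n‖ ≤ 1) {a b : ℕ} (hab : a ≤ b) (c : ℕ) :
    ‖∑ n ∈ Finset.Icc a b, f n - ∑ n ∈ Finset.Icc a b, f (n + c)‖ ≤ 2 * c := by
  induction c with
  | zero => simp
  | succ c ih =>
    have h1 : ∑ n ∈ Finset.Icc a b, f (n + c) - ∑ n ∈ Finset.Icc a b, f (n + (c + 1)) = f (a + c) - f (b + 1 + c) := by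
      rw [← neg_inj, neg_sub, neg_sub, ← Finset.sum_sub_distrib, ← Finset.Ico_add_one_right_eq_Icc,
        ← Finset.sum_Ico_sub (fun n => f (n + c)) (by omega : a ≤ b + 1)]
      exact Finset.sum_congr rfl fun n _ => by rw [show n + (c + 1) = n + 1 + c by ring]
    have h2 : ‖f (a + c) - f (b + 1 + c)‖ ≤ 2 := by
      refine (norm_sub_le _ _).trans ?_
      linarith [hf (a + c), hf (b + 1 + c)]
    calc _ = ‖(∑ n ∈ Finset.Icc a b, f n - ∑ n ∈ Finset.Icc a b, f (n + c)) + (f (a + c) - f (b + 1 + c))‖ := by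
          rw [← h1]; congr 1; ring
      _ ≤ 2 * c + 2 := (norm_add_le _ _).trans (add_le_add ih h2)
      _ = _ := by push_cast; ring

theorem mul_card_le_card_filter_largeSet {q : ℕ} [NeZero q] (χ : MulChar (ZMod q) ℂ) {a b h : ℕ} {η : ℝ} (hη : 0 ≤ η)
    (hab : a ≤ b) (hh : 0 < h) (hhK : h ≤ η * (Finset.Icc a b).card / 16)
    (hS : η / 2 * (Finset.Icc a b).card ≤ ‖∑ n ∈ Finset.Icc a b, χ (n : ZMod q)‖) :
    η / 4 * (Finset.Icc a b).card ≤
      (((Finset.Icc a b).filter fun n : ℕ => (n : ZMod q) ∈ largeSet χ h (η / 8)).card : ℝ) := by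
  classical
  have hh' : (0 : ℝ) < h := by exact_mod_cast hh
  set I := Finset.Icc a b with hI
  set K : ℝ := (I.card : ℝ) with hK
  have hχ1 : ∀ n : ℕ, ‖χ (n : ZMod q)‖ ≤ 1 := fun n => DirichletCharacter.norm_le_one (χ : DirichletCharacter ℂ q) _
  have h1 : h * ‖∑ n ∈ I, χ (n : ZMod q)‖ - 2 * h * h ≤ ∑ n ∈ I, shortSum χ h (n : ZMod q) := by
    have e1 : ∀ c ∈ Finset.range h, ‖∑ n ∈ I, χ (n : ZMod q) - ∑ n ∈ I, χ ((n : ZMod q) + c)‖ ≤ 2 * h := by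
      intro c hc
      have := norm_sum_Icc_sub_sum_shift_le (f := fun n : ℕ => χ (n : ZMod q)) hχ1 hab c
      simp only [Nat.cast_add] at this
      refine this.trans ?_
      have : (c : ℝ) ≤ h := by exact_mod_cast (Finset.mem_range.1 hc).le
      linarith
    have e2 := norm_sum_le_of_le _ e1
    rw [Finset.sum_sub_distrib, Finset.sum_const, Finset.sum_const, Finset.card_range, nsmul_eq_mul, nsmul_eq_mul] at e2
    have e3 : ‖∑ c ∈ Finset.range h, ∑ n ∈ I, χ ((n : ZMod q) + c)‖ ≤ ∑ n ∈ I, shortSum χ h (n : ZMod q) := by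
      rw [Finset.sum_comm]
      exact norm_sum_le _ _
    have e4 := norm_sub_norm_le ((h : ℂ) * ∑ n ∈ I, χ (n : ZMod q)) (∑ c ∈ Finset.range h, ∑ n ∈ I, χ ((n : ZMod q) + c))
    rw [norm_mul, Complex.norm_natCast] at e4
    linarith
  have h2 : ∑ n ∈ I, shortSum χ h (n : ZMod q) ≤
      ((I.filter fun n : ℕ => (n : ZMod q) ∈ largeSet χ h (η / 8)).card : ℝ) * h + K * (η / 8 * h) := by
    rw [← Finset.sum_filter_add_sum_filter_not I (fun n : ℕ => (n : ZMod q) ∈ largeSet χ h (η / 8))]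
    refine add_le_add ?_ ?_
    · rw [← nsmul_eq_mul]
      exact Finset.sum_le_card_nsmul _ _ _ fun n _ => shortSum_le χ h _
    · calc _ ≤ ((I.filter fun n : ℕ => ¬ (n : ZMod q) ∈ largeSet χ h (η / 8)).card : ℝ) * (η / 8 * h) := by
            rw [← nsmul_eq_mul]
            refine Finset.sum_le_card_nsmul _ _ _ fun n hn => ?_
            have := (Finset.mem_filter.1 hn).2
            simp only [largeSet, Finset.mem_filter, Finset.mem_univ, true_and, not_le] at this
            exact this.le
        _ ≤ _ := by
            refine mul_le_mul_of_nonneg_right ?_ (by positivity)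
            exact Nat.cast_le.2 (Finset.card_filter_le _ _)
  have h3 : (h : ℝ) * (η / 2 * K) ≤ h * ‖∑ n ∈ I, χ (n : ZMod q)‖ := by gcongr
  have h4 : 2 * (h : ℝ) * h ≤ 2 * h * (η * K / 16) := by gcongr
  refine le_of_mul_le_mul_right ?_ hh'
  linarith

theorem sq_mul_sum_card_le_card_largeSet {q s : ℕ} [NeZero q] (χ : MulChar (ZMod q) ℂ) {a b : Fin s → ℕ} {h : ℕ} {η N : ℝ}
    (hη : 0 < η) (ha : ∀ j, 1 ≤ a j) (hab : ∀ j, a j ≤ b j) (hb : ∀ j, b j ≤ q)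
    (hdisj : ∀ i j, i ≠ j → Disjoint (Finset.Icc (a i) (b i)) (Finset.Icc (a j) (b j)))
    (hN : N = ∑ j, ((Finset.Icc (a j) (b j)).card : ℝ)) (hh : 0 < h) (hhN : h ≤ η ^ 2 * N / (64 * s))
    (hS : η * N ≤ ∑ j, ‖∑ n ∈ Finset.Icc (a j) (b j), χ (n : ZMod q)‖) :
    η ^ 2 / 16 * N ≤ ((largeSet χ h (η / 8)).card : ℝ) := by
  classical
  set K : Fin s → ℝ := fun j => ((Finset.Icc (a j) (b j)).card : ℝ) with hK
  set S : Fin s → ℝ := fun j => ‖∑ n ∈ Finset.Icc (a j) (b j), χ (n : ZMod q)‖ with hSdef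
  have hN0 : 0 ≤ N := hN ▸ Finset.sum_nonneg fun j _ => Nat.cast_nonneg _
  have hχ1 : ∀ n : ℕ, ‖χ (n : ZMod q)‖ ≤ 1 := fun n => DirichletCharacter.norm_le_one (χ : DirichletCharacter ℂ q) _
  have hSK : ∀ j, S j ≤ K j := by
    intro j
    refine (norm_sum_le_of_le _ fun n _ => hχ1 n).trans ?_
    rw [Finset.sum_const, nsmul_eq_mul, mul_one]
  have hs : (0 : ℝ) < s := by
    by_contra! hcon
    have h0 : (s : ℝ) = 0 := le_antisymm hcon (by positivity)
    rw [h0, mul_zero, div_zero] at hhN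
    exact absurd hhN (not_le.2 (by exact_mod_cast hh))
  set lam : ℝ := η * N / (4 * s) with hlam
  have hlam0 : 0 ≤ lam := by positivity
  set G : Finset (Fin s) := Finset.univ.filter fun j => η / 2 * K j ≤ S j ∧ lam ≤ K j with hG
  have hGsum : η * N / 4 ≤ ∑ j ∈ G, K j := by
    have h1 : ∑ j, S j ≤ ∑ j, ((if j ∈ G then K j else 0) + η / 2 * K j + lam) := by
      refine Finset.sum_le_sum fun j _ => ?_
      have hKj : 0 ≤ K j := by positivity
      split_ifs with hj
      · have := hSK j
        have : 0 ≤ η / 2 * K j := by positivity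
        linarith [hSK j]
      · simp only [hG, Finset.mem_filter, Finset.mem_univ, true_and, not_and_or, not_le] at hj
        rcases hj with hj | hj
        · linarith
        · have : 0 ≤ η / 2 * K j := by positivity
          linarith [hSK j]
    rw [Finset.sum_add_distrib, Finset.sum_add_distrib, ← Finset.sum_filter, ← Finset.mul_sum, ← hN,
      Finset.sum_const, Finset.card_univ, Fintype.card_fin, nsmul_eq_mul] at h1
    have h2 : Finset.univ.filter (· ∈ G) = G := by simp
    rw [h2] at h1
    have h3 : s * lam = η * N / 4 := by rw [hlam]; field_simp
    linarith
  have hcard : ∀ j ∈ G, η / 4 * K j ≤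
      (((Finset.Icc (a j) (b j)).filter fun n : ℕ => (n : ZMod q) ∈ largeSet χ h (η / 8)).card : ℝ) := by
    intro j hj
    simp only [hG, Finset.mem_filter, Finset.mem_univ, true_and] at hj
    refine mul_card_le_card_filter_largeSet χ hη.le (hab j) hh (hhN.trans ?_) hj.1
    calc η ^ 2 * N / (64 * s) = η * lam / 16 := by rw [hlam]; ring
      _ ≤ η * K j / 16 := by have := hj.2; gcongr
  have hinj : ∑ j ∈ G, ((Finset.Icc (a j) (b j)).filter fun n : ℕ => (n : ZMod q) ∈ largeSet χ h (η / 8)).card ≤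
      (largeSet χ h (η / 8)).card := by
    rw [← Finset.card_biUnion fun i _ j _ hij =>
      (hdisj i j hij).mono (Finset.filter_subset _ _) (Finset.filter_subset _ _)]
    refine Finset.card_le_card_of_injOn (fun n : ℕ => (n : ZMod q)) ?_ ?_
    · intro n hn
      simp only [Finset.coe_biUnion, Set.mem_iUnion, Finset.coe_filter] at hn
      obtain ⟨j, _, hn⟩ := hn
      exact hn.2
    · have hmem : ∀ n ∈ G.biUnion fun j => (Finset.Icc (a j) (b j)).filter fun n : ℕ => (n : ZMod q) ∈ largeSet χ h (η / 8),
          1 ≤ n ∧ n ≤ q := by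
        intro n hn
        simp only [Finset.mem_biUnion, Finset.mem_filter, Finset.mem_Icc] at hn
        obtain ⟨j, _, hn, _⟩ := hn
        exact ⟨(ha j).trans hn.1, hn.2.trans (hb j)⟩
      intro n hn m hm hnm
      obtain ⟨hn1, hn2⟩ := hmem n hn
      obtain ⟨hm1, hm2⟩ := hmem m hm
      have h1 : n ≡ m [MOD q] := (ZMod.natCast_eq_natCast_iff _ _ _).1 hnm
      have h2 : n - 1 ≡ m - 1 [MOD q] := by
        apply Nat.ModEq.add_right_cancel' 1
        rwa [Nat.sub_add_cancel hn1, Nat.sub_add_cancel hm1]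
      have h3 := Nat.ModEq.eq_of_lt_of_lt h2 (by omega) (by omega)
      omega
  calc η ^ 2 / 16 * N = η / 4 * (η * N / 4) := by ring
    _ ≤ η / 4 * ∑ j ∈ G, K j := by gcongr
    _ = ∑ j ∈ G, η / 4 * K j := Finset.mul_sum _ _ _
    _ ≤ ∑ j ∈ G, (((Finset.Icc (a j) (b j)).filter fun n : ℕ => (n : ZMod q) ∈ largeSet χ h (η / 8)).card : ℝ) :=
      Finset.sum_le_sum hcard
    _ ≤ _ := by exact_mod_cast hinj

open Filter in
set_option maxHeartbeats 1000000 in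
theorem eventually_norm_sum_dirichletCharacter_intervals_le {ε : ℝ} (hε : 0 < ε) (hε1 : ε ≤ 1) :
    ∃ δ : ℝ, 0 < δ ∧ ∀ᶠ q : ℕ in atTop, (∀ p : ℕ, p.Prime → ¬ p ^ 3 ∣ q) →
      ∀ (χ : DirichletCharacter ℂ q), DirichletCharacter.IsPrimitive χ →
      ∀ (s : ℕ) (a b : Fin s → ℕ) (N : ℝ),
        (∀ j, 1 ≤ a j) → (∀ j, a j ≤ b j) → (∀ j, b j ≤ q) →
        (∀ j, (q : ℝ) ^ ε ≤ ((Finset.Icc (a j) (b j)).card : ℝ)) →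
        (∀ i j, i ≠ j → Disjoint (Finset.Icc (a i) (b i)) (Finset.Icc (a j) (b j))) →
        N = ∑ j, ((Finset.Icc (a j) (b j)).card : ℝ) →
        (q : ℝ) ^ (1 / 4 + ε) < N * (s : ℝ) ^ (-(1 : ℝ) / 2) →
        ∑ j, ‖∑ n ∈ Finset.Icc (a j) (b j), χ (n : ZMod q)‖ ≤ N * (q : ℝ) ^ (-δ) := by
  obtain ⟨σ, hσ, hmain⟩ := eventually_card_largeSet_mul_le (ε := ε / 2) (by linarith) (by linarith)
  obtain ⟨δ, hδ, hδσ, hδε⟩ : ∃ δ : ℝ, 0 < δ ∧ δ < σ ∧ 8 * δ ≤ ε :=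
    ⟨min (σ / 2) (ε / 8), by positivity, (min_le_left _ _).trans_lt (by linarith),
      by linarith [min_le_right (σ / 2) (ε / 8)]⟩
  refine ⟨δ, hδ, ?_⟩
  filter_upwards [hmain, eventually_gt_atTop 1,
    eventually_mul_rpow_le_rpow 128 (a := ε / 2) (b := ε - 2 * δ) (by linarith),
    eventually_mul_rpow_le_rpow 4096 (a := 1 / 2 + ε / 2) (b := 1 / 2 + 2 * ε - 4 * δ) (by linarith),
    eventually_mul_rpow_le_rpow 8 (a := -σ) (b := -δ) (by linarith)]
    with q hq hq1 hh1 hX1 hθ1 hcf χ hχ s a b N ha hab hb hI hdisj hN hNs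
  have : NeZero q := ⟨by omega⟩
  have hq1' : (1 : ℝ) < q := by exact_mod_cast hq1
  have hq0' : (0 : ℝ) < q := by linarith
  by_contra! hcon
  set η : ℝ := (q : ℝ) ^ (-δ) with hη
  have hη0 : 0 < η := by positivity
  have hη1 : η ≤ 1 := Real.rpow_le_one_of_one_le_of_nonpos hq1'.le (by linarith)
  have hN0 : 0 ≤ N := hN ▸ Finset.sum_nonneg fun j _ => Nat.cast_nonneg _
  have hs : 0 < s := by
    rcases Nat.eq_zero_or_pos s with h0 | h0
    · exfalso
      subst h0
      rw [hN, Finset.univ_eq_empty, Finset.sum_empty, zero_mul] at hNs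
      exact absurd hNs (not_lt.2 (by positivity))
    · exact h0
  have hs' : (0 : ℝ) < s := by exact_mod_cast hs
  have hs1 : (1 : ℝ) ≤ s := by exact_mod_cast hs
  have hNq : (q : ℝ) ^ ε ≤ N / s := by
    rw [le_div_iff₀ hs', hN]
    calc (q : ℝ) ^ ε * s = ∑ _j : Fin s, (q : ℝ) ^ ε := by
          rw [Finset.sum_const, Finset.card_univ, Fintype.card_fin, nsmul_eq_mul, mul_comm]
      _ ≤ _ := Finset.sum_le_sum fun j _ => hI j
  have hNle : N ≤ s * q := by
    rw [hN]
    calc _ ≤ ∑ _j : Fin s, (q : ℝ) := Finset.sum_le_sum fun j _ => by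
          have h1 := ha j
          have h2 := hb j
          rw [Nat.card_Icc]
          exact_mod_cast (by omega : b j + 1 - a j ≤ q)
      _ = _ := by rw [Finset.sum_const, Finset.card_univ, Fintype.card_fin, nsmul_eq_mul]
  have hη2 : η ^ 2 = (q : ℝ) ^ (-(2 * δ)) := by
    rw [hη, ← Real.rpow_natCast, ← Real.rpow_mul hq0'.le]; congr 1; push_cast; ring
  have hx : 2 * (q : ℝ) ^ (ε / 2) ≤ η ^ 2 * N / (64 * s) := by
    have h1 : (q : ℝ) ^ (ε - 2 * δ) ≤ η ^ 2 * (N / s) := by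
      rw [hη2, show ε - 2 * δ = -(2 * δ) + ε by ring, Real.rpow_add hq0']
      gcongr
    have h2 : η ^ 2 * N / (64 * s) = η ^ 2 * (N / s) / 64 := by field_simp
    rw [h2]
    linarith
  have hqε : (1 : ℝ) ≤ q ^ (ε / 2) := Real.one_le_rpow hq1'.le (by linarith)
  set h := ⌊η ^ 2 * N / (64 * s)⌋₊ with hhdef
  have hh2 : (h : ℝ) ≤ η ^ 2 * N / (64 * s) := Nat.floor_le (by positivity)
  have hh3 : η ^ 2 * N / (64 * s) < h + 1 := Nat.lt_floor_add_one _
  have hh4 : η ^ 2 * N / (128 * s) ≤ h := by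
    have : η ^ 2 * N / (128 * s) = η ^ 2 * N / (64 * s) / 2 := by ring
    linarith
  have hh5 : (q : ℝ) ^ (ε / 2) ≤ h := by linarith
  have hh0 : 0 < h := by
    have : (0 : ℝ) < h := by linarith
    exact_mod_cast this
  have hhq : h ≤ q := by
    have : (h : ℝ) ≤ q := by
      refine hh2.trans ?_
      rw [div_le_iff₀ (by positivity)]
      have h1 : η ^ 2 ≤ 1 := pow_le_one₀ hη0.le hη1
      nlinarith
    exact_mod_cast this
  have hX := sq_mul_sum_card_le_card_largeSet χ hη0 ha hab hb hdisj hN hh0 hh2 (by linarith)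
  have hX2 := hq hcf χ hχ.isLocallyPrimitive h (η / 8) (by linarith) (by linarith) hh5 hhq
  have hNsq : (q : ℝ) ^ (1 / 2 + 2 * ε) < N ^ 2 / s := by
    calc (q : ℝ) ^ (1 / 2 + 2 * ε) = ((q : ℝ) ^ (1 / 4 + ε)) ^ 2 := by
          rw [← Real.rpow_natCast, ← Real.rpow_mul hq0'.le]; congr 1; push_cast; ring
      _ < (N * (s : ℝ) ^ (-(1 : ℝ) / 2)) ^ 2 := by gcongr
      _ = N ^ 2 / s := by
          rw [mul_pow, ← Real.rpow_natCast ((s : ℝ) ^ (-(1 : ℝ) / 2)), ← Real.rpow_mul hs'.le]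
          norm_num
          rw [Real.rpow_neg_one, div_eq_mul_inv]
  have hη4 : (q : ℝ) ^ (1 / 2 + 2 * ε - 4 * δ) = η ^ 2 * η ^ 2 * q ^ (1 / 2 + 2 * ε) := by
    rw [hη2, ← Real.rpow_add hq0', ← Real.rpow_add hq0']; congr 1; ring
  have hfin : η ^ 2 * η ^ 2 * q ^ (1 / 2 + 2 * ε) < 2048 * (q : ℝ) ^ (1 / 2 + ε / 2) := by
    calc η ^ 2 * η ^ 2 * q ^ (1 / 2 + 2 * ε) < η ^ 2 * η ^ 2 * (N ^ 2 / s) := by gcongr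
      _ = 2048 * ((η ^ 2 / 16 * N) * (η ^ 2 * N / (128 * s))) := by ring
      _ ≤ 2048 * ((largeSet χ h (η / 8)).card * (h : ℝ)) := by gcongr
      _ ≤ _ := by gcongr
  have : (0 : ℝ) < (q : ℝ) ^ (1 / 2 + ε / 2) := by positivity
  linarith

theorem stmt_3 (ε : ℝ) (hε : 0 < ε) :
    ∃ δ : ℝ, 0 < δ ∧ ∃ C : ℝ, 0 < C ∧
      ∀ (q : ℕ), 0 < q → (∀ p : ℕ, p.Prime → ¬ p ^ 3 ∣ q) →
      ∀ (χ : DirichletCharacter ℂ q), DirichletCharacter.IsPrimitive χ →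
      ∀ (s : ℕ) (a b : Fin s → ℕ) (A : Finset ℕ),
        (∀ j, 1 ≤ a j) → (∀ j, a j ≤ b j) → (∀ j, b j ≤ q) →
        (∀ j, (q : ℝ) ^ ε ≤ ((Finset.Icc (a j) (b j)).card : ℝ)) →
        (∀ i j, i ≠ j → Disjoint (Finset.Icc (a i) (b i)) (Finset.Icc (a j) (b j))) →
        A = Finset.univ.biUnion (fun j => Finset.Icc (a j) (b j)) →
        (q : ℝ) ^ ((1 : ℝ) / 4 + ε) < (A.card : ℝ) * (s : ℝ) ^ (-(1 : ℝ) / 2) →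
        ‖∑ n ∈ A, χ (n : ZMod q)‖ ≤ C * (A.card : ℝ) * (q : ℝ) ^ (-δ) := by
  obtain ⟨δ, hδ, hev⟩ := eventually_norm_sum_dirichletCharacter_intervals_le
    (ε := min ε 1) (lt_min hε one_pos) (min_le_right _ _)
  obtain ⟨q₀, hq₀⟩ := Filter.eventually_atTop.1 hev
  refine ⟨δ, hδ, max 1 ((q₀ : ℝ) ^ δ), by positivity, ?_⟩
  intro q hq hcf χ hχ s a b A ha hab hb hI hdisj hA hAs
  have hq' : (0 : ℝ) < q := by exact_mod_cast hq
  have hq1 : (1 : ℝ) ≤ q := by exact_mod_cast hq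
  have hdisj' : ((Finset.univ : Finset (Fin s)) : Set (Fin s)).PairwiseDisjoint fun j => Finset.Icc (a j) (b j) :=
    fun i _ j _ hij => hdisj i j hij
  have hmono : (q : ℝ) ^ min ε 1 ≤ q ^ ε := Real.rpow_le_rpow_of_exponent_le hq1 (min_le_left _ _)
  have hmono' : (q : ℝ) ^ (1 / 4 + min ε 1) ≤ q ^ (1 / 4 + ε) :=
    Real.rpow_le_rpow_of_exponent_le hq1 (by linarith [min_le_left ε 1])
  rcases le_total q₀ q with hle | hlt
  · have h1 := hq₀ q hle hcf χ hχ s a b A.card ha hab hb (fun j => hmono.trans (hI j)) hdisj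
      (by rw [hA, Finset.card_biUnion fun i _ j _ hij => hdisj i j hij]; push_cast; rfl) (hmono'.trans_lt hAs)
    calc ‖∑ n ∈ A, χ (n : ZMod q)‖ ≤ ∑ j, ‖∑ n ∈ Finset.Icc (a j) (b j), χ (n : ZMod q)‖ := by
          rw [hA, Finset.sum_biUnion hdisj']
          exact norm_sum_le _ _
      _ ≤ 1 * A.card * (q : ℝ) ^ (-δ) := by rwa [one_mul]
      _ ≤ _ := by gcongr; exact le_max_left _ _
  · have h1 : ‖∑ n ∈ A, χ (n : ZMod q)‖ ≤ A.card := by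
      refine (norm_sum_le_of_le _ fun n _ => DirichletCharacter.norm_le_one χ _).trans ?_
      rw [Finset.sum_const, nsmul_eq_mul, mul_one]
    have h2 : (q : ℝ) ^ δ ≤ max 1 ((q₀ : ℝ) ^ δ) :=
      le_trans (Real.rpow_le_rpow hq'.le (by exact_mod_cast hlt) hδ.le) (le_max_right _ _)
    calc ‖∑ n ∈ A, χ (n : ZMod q)‖ ≤ A.card := h1
      _ = q ^ δ * A.card * (q : ℝ) ^ (-δ) := by
          rw [Real.rpow_neg hq'.le]; field_simp
      _ ≤ _ := by gcongr
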